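/- Let c be a real number with 1 < c < 6/5. Then for every sufficiently small η > 0 there exist constants c₀ > 0 and R₀ > 0 such that for all R ≥ R₀, the number 𝒜₃(R) of ordered triples (p₁, p₂, p₃) of primes with X/8 < pⱼ ≤ X (j = 1,2,3), where X = R^{1/c}, satisfying |p₁^c + p₂^c + p₃^c − R| < R^{−η}, is at least c₀ · R^{3/c − 1 − η}/(log R)³. -/

import Mathlib

open Real MeasureTheory

/-- `countSol c η R s` is the number of ordered `s`-tuples of primes `p₁, …, pₛ` with
`X/8 < pⱼ ≤ X` (where `X = R^{1/c}`) and `|p₁^c + ⋯ + pₛ^c − R| < R^{−η}`. -/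
noncomputable def countSol (c η R : ℝ) (s : ℕ) : ℕ :=
  Nat.card {p : Fin s → ℕ //
    (∀ j, (p j).Prime ∧ R ^ (1/c) / 8 < (p j : ℝ) ∧ (p j : ℝ) ≤ R ^ (1/c)) ∧
    |(∑ j, (p j : ℝ) ^ c) - R| < R ^ (-η)}

section
open Real MeasureTheory
namespace BK

/-- `e x = exp(2πix)` -/
noncomputable def e (x : ℝ) : ℂ := Complex.exp (((2 * π * x : ℝ) : ℂ) * Complex.I)

lemma norm_e (x : ℝ) : ‖e x‖ = 1 := Complex.norm_exp_ofReal_mul_I _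

lemma e_add (x y : ℝ) : e (x + y) = e x * e y := by
  unfold e; rw [← Complex.exp_add]; congr 1; push_cast; ring

lemma e_zero : e 0 = 1 := by simp [e]

lemma e_neg (x : ℝ) : e (-x) = (starRingEnd ℂ) (e x) := by
  unfold e; rw [← Complex.exp_conj]; congr 1
  rw [map_mul, Complex.conj_I, Complex.conj_ofReal]; push_cast; ring

lemma e_nat (k : ℕ) : e k = 1 := by
  unfold e
  rw [Complex.exp_eq_one_iff]; exact ⟨k, by push_cast; ring⟩

lemma e_int (k : ℤ) : e k = 1 := by
  unfold e
  rw [Complex.exp_eq_one_iff]; exact ⟨k, by push_cast; ring⟩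

lemma e_sub_int (x : ℝ) (k : ℤ) : e (x - k) = e x := by
  have h := e_add (x - k) k
  rw [e_int, mul_one, sub_add_cancel] at h
  exact h.symm

lemma e_sub (x y : ℝ) : e (x - y) = e x * (starRingEnd ℂ) (e y) := by
  rw [sub_eq_add_neg, e_add, e_neg]

lemma continuous_e : Continuous e := by unfold e; fun_prop

/-- the value `1/(1-e g)` is `1/2 + (i/2) cot(π g)` -/
lemma kl_coef (g : ℝ) (h0 : 0 < g) (h1 : g < 1) :
    (1 - e g) * ((1/2 : ℂ) + ((cos (π * g) / sin (π * g) / 2 : ℝ) : ℂ) * Complex.I) = 1 := by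
  have hs : 0 < sin (π * g) := sin_pos_of_pos_of_lt_pi (by positivity) (by nlinarith [pi_pos])
  have he : e g = ((1 - 2 * sin (π * g) ^ 2 : ℝ) : ℂ) +
      ((2 * sin (π * g) * cos (π * g) : ℝ) : ℂ) * Complex.I := by
    unfold e
    rw [Complex.exp_mul_I, ← Complex.ofReal_cos, ← Complex.ofReal_sin]
    have : 2 * π * g = 2 * (π * g) := by ring
    rw [this, sin_two_mul, cos_two_mul, cos_sq']
    congr 2; ring_nf
  rw [he]
  set s := sin (π * g)
  set k := cos (π * g)
  have hsc : s ^ 2 + k ^ 2 = 1 := sin_sq_add_cos_sq _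
  have hs0 : (s : ℂ) ≠ 0 := by exact_mod_cast hs.ne'
  have hscC : (s : ℂ) ^ 2 + (k : ℂ) ^ 2 = 1 := by exact_mod_cast hsc
  push_cast
  field_simp
  linear_combination (2 * (s : ℂ)) * hscC - 2 * (s : ℂ) * (k : ℂ) ^ 2 * Complex.I_sq

lemma sin_lower (θ g : ℝ) (hθ : 0 < θ) (h0 : θ ≤ g) (h1 : g ≤ 1 - θ) : 2 * θ ≤ sin (π * g) := by
  rcases le_total g (1/2) with h | h
  · have := mul_le_sin (x := π * g) (mul_nonneg pi_pos.le (by linarith)) (by nlinarith [pi_pos])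
    have h2 : 2 / π * (π * g) = 2 * g := by field_simp
    linarith
  · have := mul_le_sin (x := π * (1 - g)) (mul_nonneg pi_pos.le (by linarith)) (by nlinarith [pi_pos])
    have h2 : 2 / π * (π * (1 - g)) = 2 * (1 - g) := by field_simp
    have h3 : sin (π * (1 - g)) = sin (π * g) := by
      rw [mul_sub, mul_one, sin_pi_sub]
    linarith

lemma cot_anti (a b : ℝ) (ha : 0 < a) (hab : a ≤ b) (hb : b < 1) :
    cos (π * b) / sin (π * b) ≤ cos (π * a) / sin (π * a) := by
  have hsa : 0 < sin (π * a) := sin_pos_of_pos_of_lt_pi (by positivity) (by nlinarith [pi_pos])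
  have hsb : 0 < sin (π * b) := sin_pos_of_pos_of_lt_pi (by nlinarith [pi_pos]) (by nlinarith [pi_pos])
  rw [div_le_div_iff₀ hsb hsa]
  have : 0 ≤ sin (π * b - π * a) := sin_nonneg_of_nonneg_of_le_pi (by nlinarith [pi_pos]) (by nlinarith [pi_pos])
  rw [sin_sub] at this
  linarith

/-- Kusmin and Landau inequality, discrete form. -/
lemma kusmin_landau (f : ℕ → ℝ) (N : ℕ) (θ : ℝ) (hθ : 0 < θ) (hθ1 : θ ≤ 1/2)
    (h1 : ∀ n, n + 1 < N → θ ≤ f (n+1) - f n ∧ f (n+1) - f n ≤ 1 - θ)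
    (h2 : ∀ n, n + 2 < N → f (n+1) - f n ≤ f (n+2) - f (n+1)) :
    ‖∑ n ∈ Finset.range N, e (f n)‖ ≤ 2 / θ := by
  classical
  set y : ℕ → ℝ := fun n => cos (π * (f (n+1) - f n)) / sin (π * (f (n+1) - f n)) / 2 with hy
  set c : ℕ → ℂ := fun n => (1/2 : ℂ) + (y n : ℂ) * Complex.I with hc
  have hyb : ∀ n, n + 1 < N → |y n| ≤ 1 / (4 * θ) := by
    intro n hn
    obtain ⟨ha, hb⟩ := h1 n hn
    have hs := sin_lower θ _ hθ ha hb
    simp only [hy]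
    rw [abs_div, abs_div, abs_two, abs_of_pos (by linarith : 0 < sin (π * (f (n+1) - f n)))]
    have : |cos (π * (f (n+1) - f n))| ≤ 1 := abs_cos_le_one _
    rw [div_div, div_le_div_iff₀ (by linarith) (by linarith)]
    nlinarith
  -- induction on partial sums
  have key : ∀ M, M + 1 < N → 
      ∑ n ∈ Finset.range (M+1), e (f n) - c 0 * e (f 0) + c M * e (f (M+1)) 
        = ∑ n ∈ Finset.range M, (c (n+1) - c n) * e (f (n+1)) := by
    intro M
    induction M with
    | zero =>
      intro hM
      obtain ⟨ha, hb⟩ := h1 0 hM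
      have hk := kl_coef (f 1 - f 0) (by simpa using by linarith) (by simp at ha hb; linarith)
      have : e (f 1) = e (f 0) * e (f 1 - f 0) := by rw [← e_add]; congr 1; ring
      simp only [hc, hy]
      simp only [zero_add, Finset.sum_range_one, Finset.range_zero, Finset.sum_empty]
      rw [this]
      linear_combination (-e (f 0)) * hk
    | succ M ih =>
      intro hM
      have ih' := ih (by omega)
      rw [Finset.sum_range_succ _ (M+1), Finset.sum_range_succ (fun n => (c (n+1) - c n) * e (f (n+1))) M, ← ih']
      obtain ⟨ha, hb⟩ := h1 (M+1) hM
      have hk := kl_coef (f (M+1+1) - f (M+1)) (by linarith) (by linarith)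
      have : e (f (M+1+1)) = e (f (M+1)) * e (f (M+1+1) - f (M+1)) := by rw [← e_add]; congr 1; ring
      have hcM : c (M+1) = ((1/2 : ℂ) + ((cos (π * (f (M+1+1) - f (M+1))) / sin (π * (f (M+1+1) - f (M+1))) / 2 : ℝ) : ℂ) * Complex.I) := rfl
      rw [← hcM] at hk
      rw [this]
      linear_combination (-e (f (M+1))) * hk
  rcases Nat.lt_or_ge N 2 with hN | hN
  · -- N ≤ 1
    interval_cases N
    · simp; positivity
    · simp only [Finset.sum_range_one, norm_e]
      rw [le_div_iff₀ hθ]; linarith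
  · obtain ⟨M, rfl⟩ : ∃ M, N = M + 2 := ⟨N - 2, by omega⟩
    have hk := key M (by omega)
    have htel : ‖∑ n ∈ Finset.range M, (c (n+1) - c n) * e (f (n+1))‖ ≤ y 0 - y M := by
      have hle : ∀ K, K ≤ M → ‖∑ n ∈ Finset.range K, (c (n+1) - c n) * e (f (n+1))‖ ≤ y 0 - y K := by
        intro K
        induction K with
        | zero => intro _; simp
        | succ K ih =>
          intro hK
          rw [Finset.sum_range_succ]
          refine (norm_add_le _ _).trans ?_
          have := ih (by omega)
          have hd : ‖(c (K+1) - c K) * e (f (K+1))‖ = |y (K+1) - y K| := by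
            rw [norm_mul, norm_e, mul_one]
            have : c (K+1) - c K = ((y (K+1) - y K : ℝ) : ℂ) * Complex.I := by
              simp only [hc]; push_cast; ring
            rw [this, norm_mul, Complex.norm_I, mul_one, Complex.norm_real, Real.norm_eq_abs]
          have hm : y (K+1) ≤ y K := by
            simp only [hy]
            have h3 := h1 K (by omega)
            have h4 := h1 (K+1) (by omega)
            have := cot_anti _ _ (by linarith [h3.1]) (h2 K (by omega)) (by linarith [h4.2])
            linarith
          rw [hd, abs_of_nonpos (by linarith)]
          linarith
      exact hle M le_rfl
    have hcb : ∀ n, n + 1 < M + 2 → ‖c n‖ ≤ 1/2 + 1 / (4 * θ) := by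
      intro n hn
      simp only [hc]
      refine (norm_add_le _ _).trans ?_
      rw [norm_mul, Complex.norm_I, mul_one, Complex.norm_real, Real.norm_eq_abs]
      have := hyb n hn
      have h5 : ‖(1/2 : ℂ)‖ = 1/2 := by norm_num
      rw [h5]; linarith
    rw [Finset.sum_range_succ]
    have heq : ∑ n ∈ Finset.range (M+1), e (f n) = c 0 * e (f 0) - c M * e (f (M+1)) 
        + ∑ n ∈ Finset.range M, (c (n+1) - c n) * e (f (n+1)) := by
      rw [← hk]; ring
    rw [heq]
    have n1 : ‖c 0 * e (f 0)‖ ≤ 1/2 + 1 / (4 * θ) := by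
      rw [norm_mul, norm_e, mul_one]; exact hcb 0 (by omega)
    have n2 : ‖c M * e (f (M+1))‖ ≤ 1/2 + 1 / (4 * θ) := by
      rw [norm_mul, norm_e, mul_one]; exact hcb M (by omega)
    have y0 := hyb 0 (by omega)
    have yM := hyb M (by omega)
    have h6 : y 0 - y M ≤ 2 * (1 / (4 * θ)) := by
      have := abs_le.mp y0; have := abs_le.mp yM; linarith
    have htot : ‖c 0 * e (f 0) - c M * e (f (M+1)) 
        + ∑ n ∈ Finset.range M, (c (n+1) - c n) * e (f (n+1)) + e (f (M+1))‖ ≤ 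
        (1/2 + 1 / (4 * θ)) + (1/2 + 1 / (4 * θ)) + 2 * (1 / (4 * θ)) + 1 := by
      refine (norm_add_le _ _).trans ?_
      rw [norm_e]
      refine add_le_add ((norm_add_le _ _).trans ?_) le_rfl
      refine add_le_add ((norm_sub_le _ _).trans ?_) (htel.trans h6)
      exact add_le_add n1 n2
    refine htot.trans ?_
    have : 1 / (4 * θ) = (1/4) * (1/θ) := by field_simp
    rw [this]
    have h7 : 2 ≤ 1 / θ := by rw [le_div_iff₀ hθ]; linarith
    have : 2 / θ = 2 * (1/θ) := by ring
    rw [this]; linarith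
end BK
end

section
open Real MeasureTheory
namespace BK

lemma thresh (g : ℕ → ℝ) (N : ℕ) (hg : ∀ n m, n ≤ m → m < N → g n ≤ g m) (t : ℝ) :
    ∃ r ≤ N, ∀ n, n < N → (g n < t ↔ n < r) := by
  classical
  have hex : ∃ n, n = N ∨ t ≤ g n := ⟨N, Or.inl rfl⟩
  refine ⟨Nat.find hex, Nat.find_min' hex (Or.inl rfl), fun n hn => ⟨fun h => ?_, fun h => ?_⟩⟩
  · by_contra hcon
    push Not at hcon
    rcases Nat.find_spec hex with h1 | h1
    · omega
    · have := hg _ _ hcon hn; linarith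
  · have := Nat.find_min hex h
    push Not at this
    exact this.2

lemma sum_Ico_e_le (f : ℕ → ℝ) (a b : ℕ) : ‖∑ n ∈ Finset.Ico a b, e (f n)‖ ≤ ((b - a : ℕ) : ℝ) := by
  refine (norm_sum_le _ _).trans ?_
  simp [norm_e]

lemma second_diff (f : ℕ → ℝ) (N : ℕ) (l L : ℝ) (hl : 0 < l) (hl1 : l ≤ 1/4) (hlL : l ≤ L)
    (h : ∀ n, n < N → l ≤ (f (n+2) - f (n+1)) - (f (n+1) - f n) ∧
      (f (n+2) - f (n+1)) - (f (n+1) - f n) ≤ L) :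
    ‖∑ n ∈ Finset.range N, e (f n)‖ ≤ 5 * (L * N + 2) / √l := by
  classical
  set g : ℕ → ℝ := fun n => f (n+1) - f n with hg
  have hδ : 0 < √l := sqrt_pos.mpr hl
  have hδ2 : √l ≤ 1/2 := by
    rw [show (1/2:ℝ) = √(1/4) by rw [show (1/4:ℝ) = (1/2)^2 by norm_num, sqrt_sq (by norm_num)]]
    exact sqrt_le_sqrt hl1
  have hsq : √l * √l = l := mul_self_sqrt hl.le
  set δ := √l with hδdef
  have hgl : ∀ n k, n + k ≤ N → g n + k * l ≤ g (n + k) := by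
    intro n k
    induction k with
    | zero => intro _; simp
    | succ k ih =>
      intro hk
      have h1 := ih (by omega)
      have h2 := (h (n+k) (by omega)).1
      have : g (n + (k+1)) = f (n+k+2) - f (n+k+1) := rfl
      have h3 : g (n+k) = f (n+k+1) - f (n+k) := rfl
      push_cast; linarith
  have hgu : ∀ n, n ≤ N → g n ≤ g 0 + n * L := by
    intro n
    induction n with
    | zero => intro _; simp
    | succ k ih =>
      intro hk
      have h1 := ih (by omega)
      have h2 := (h k (by omega)).2
      have : g (k+1) = f (k+2) - f (k+1) := rfl
      have h3 : g k = f (k+1) - f k := rfl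
      push_cast; linarith
  have hmono : ∀ n m, n ≤ m → m < N → g n ≤ g m := by
    intro n m hnm hm
    obtain ⟨k, rfl⟩ := Nat.exists_eq_add_of_le hnm
    have := hgl n k (by omega)
    have : (0:ℝ) ≤ k * l := by positivity
    linarith
  have hcount : ∀ s t : ℝ, ∀ a b : ℕ, s ≤ t → b ≤ N → (∀ n, a ≤ n → n < b → s ≤ g n ∧ g n < t) →
      ((b - a : ℕ) : ℝ) ≤ (t - s) / l + 1 := by
    intro s t a b hst hb hab
    rcases Nat.lt_or_ge a b with hlt | hge
    · obtain ⟨k, rfl⟩ : ∃ k, b = a + k + 1 := ⟨b - a - 1, by omega⟩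
      have h1 := hab a le_rfl (by omega)
      have h2 := hab (a+k) (by omega) (by omega)
      have h3 := hgl a k (by omega)
      have h4 : (k:ℝ) ≤ (t - s) / l := by rw [le_div_iff₀ hl]; linarith
      have : a + k + 1 - a = k + 1 := by omega
      rw [this]; push_cast; linarith
    · have : b - a = 0 := by omega
      rw [this]
      have : 0 ≤ (t - s)/l := div_nonneg (by linarith) hl.le
      push_cast; linarith
  have hfib : ∀ k : ℤ, ‖∑ n ∈ (Finset.range N).filter (fun n => ⌊g n⌋ = k), e (f n)‖ ≤ 5 / δ := by
    intro k
    obtain ⟨r0, hr0N, hr0⟩ := thresh g N hmono k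
    obtain ⟨r1, hr1N, hr1⟩ := thresh g N hmono (k + δ)
    obtain ⟨r2, hr2N, hr2⟩ := thresh g N hmono (k + 1 - δ)
    obtain ⟨r3, hr3N, hr3⟩ := thresh g N hmono (k + 1)
    have mono_r : ∀ {s t : ℝ} {a b : ℕ}, s ≤ t → a ≤ N → (∀ n, n < N → (g n < s ↔ n < a)) →
        (∀ n, n < N → (g n < t ↔ n < b)) → a ≤ b := by
      intro s t a b hst haN ha hb
      by_contra hcon
      push Not at hcon
      have h1 := (ha b (by omega)).2 hcon
      have h2 := (hb b (by omega)).1 (by linarith)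
      omega
    have h01 : r0 ≤ r1 := mono_r (by linarith) hr0N hr0 hr1
    have h12 : r1 ≤ r2 := mono_r (by linarith) hr1N hr1 hr2
    have h23 : r2 ≤ r3 := mono_r (by linarith) hr2N hr2 hr3
    have hset : (Finset.range N).filter (fun n => ⌊g n⌋ = k) = Finset.Ico r0 r3 := by
      ext n
      simp only [Finset.mem_filter, Finset.mem_range, Finset.mem_Ico, Int.floor_eq_iff]
      constructor
      · rintro ⟨hn, h1, h2⟩
        exact ⟨by by_contra hc; push Not at hc; linarith [(hr0 n hn).2 hc], (hr3 n hn).1 h2⟩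
      · rintro ⟨h1, h2⟩
        have hn : n < N := by omega
        exact ⟨hn, by by_contra hc; push Not at hc; have := (hr0 n hn).1 hc; omega, (hr3 n hn).2 h2⟩
    rw [hset, ← Finset.sum_Ico_consecutive _ (h01.trans h12) h23, ← Finset.sum_Ico_consecutive _ h01 h12]
    have e1 : ‖∑ n ∈ Finset.Ico r0 r1, e (f n)‖ ≤ δ / l + 1 := by
      refine (sum_Ico_e_le f _ _).trans ?_
      have := hcount k (k+δ) r0 r1 (by linarith) hr1N (fun n h1 h2 => 
        ⟨by by_contra hc; push Not at hc; have := (hr0 n (by omega)).1 hc; omega, (hr1 n (by omega)).2 h2⟩)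
      simpa using this
    have e3 : ‖∑ n ∈ Finset.Ico r2 r3, e (f n)‖ ≤ δ / l + 1 := by
      refine (sum_Ico_e_le f _ _).trans ?_
      have := hcount (k+1-δ) (k+1) r2 r3 (by linarith) hr3N (fun n h1 h2 => 
        ⟨by by_contra hc; push Not at hc; have := (hr2 n (by omega)).1 hc; omega, (hr3 n (by omega)).2 h2⟩)
      simpa using this
    have e2 : ‖∑ n ∈ Finset.Ico r1 r2, e (f n)‖ ≤ 2 / δ := by
      rw [Finset.sum_Ico_eq_sum_range]
      have hc : ∀ i ∈ Finset.range (r2 - r1), e (f (r1 + i)) = e (f (r1 + i) - k * i) := by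
        intro i _
        have := e_sub_int (f (r1+i)) (k * i)
        push_cast at this
        exact this.symm
      rw [Finset.sum_congr rfl hc]
      have hg' : ∀ i, f (r1 + (i+1)) - k * ((i+1 : ℕ):ℝ) - (f (r1 + i) - k * i) = g (r1+i) - k := by
        intro i; simp only [hg]; push_cast
        rw [show r1 + (i+1) = r1 + i + 1 by ring]; ring
      refine kusmin_landau (fun i => f (r1+i) - k * i) (r2 - r1) δ hδ hδ2 ?_ ?_
      · intro i hi
        rw [hg']
        refine ⟨?_, ?_⟩
        · by_contra hc; push Not at hc
          have := (hr1 (r1+i) (by omega)).1 (by linarith); omega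
        · have := (hr2 (r1+i) (by omega)).2 (by omega)
          linarith
      · intro i hi
        rw [hg', show i + 2 = (i+1) + 1 by ring, hg']
        have := hmono (r1+i) (r1+(i+1)) (by omega) (by omega)
        linarith
    have hdl : δ / l = 1 / δ := by rw [← hsq]; field_simp
    have h2d : 2 ≤ 1 / δ := by rw [le_div_iff₀ hδ]; linarith
    rw [hdl] at e1 e3
    have : (5:ℝ) / δ = 5 * (1/δ) := by ring
    have : (2:ℝ) / δ = 2 * (1/δ) := by ring
    refine (norm_add_le _ _).trans ((add_le_add_left (norm_add_le _ _) _).trans ?_)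
    linarith
  have hmaps : ∀ n ∈ Finset.range N, ⌊g n⌋ ∈ Finset.Icc ⌊g 0⌋ ⌊g 0 + N * L⌋ := by
    intro n hn
    have hn' := Finset.mem_range.1 hn
    rw [Finset.mem_Icc]
    refine ⟨Int.floor_le_floor (hmono 0 n (by omega) hn'), Int.floor_le_floor ((hgu n hn'.le).trans ?_)⟩
    have : (n:ℝ) ≤ N := by exact_mod_cast hn'.le
    nlinarith
  rw [← Finset.sum_fiberwise_of_maps_to hmaps]
  refine (norm_sum_le _ _).trans ((Finset.sum_le_sum (fun k _ => hfib k)).trans ?_)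
  rw [Finset.sum_const, nsmul_eq_mul, Int.card_Icc]
  have hNL : (0:ℝ) ≤ N * L := by have := hl.trans_le hlL; positivity
  have hcard : (((⌊g 0 + N * L⌋ + 1 - ⌊g 0⌋).toNat : ℕ) : ℝ) ≤ L * N + 2 := by
    have h0 : (0:ℤ) ≤ ⌊g 0 + N * L⌋ + 1 - ⌊g 0⌋ := by
      have := Int.floor_le_floor (show g 0 ≤ g 0 + N * L by linarith); omega
    have : (((⌊g 0 + N * L⌋ + 1 - ⌊g 0⌋).toNat : ℤ) : ℝ) = ((⌊g 0 + N * L⌋ + 1 - ⌊g 0⌋ : ℤ) : ℝ) := by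
      rw [Int.toNat_of_nonneg h0]
    rw [Int.cast_natCast] at this
    rw [this]; push_cast
    have := Int.floor_le (g 0 + N * L); have := Int.lt_floor_add_one (g 0)
    linarith
  calc _ ≤ (L * N + 2) * (5 / δ) := mul_le_mul_of_nonneg_right hcard (by positivity)
    _ = _ := by ring
end BK
end

section
open Real MeasureTheory
namespace BK

lemma rpow_diff (c : ℝ) (hc : 1 ≤ c) (u v : ℝ) (hu : 0 < u) (huv : u ≤ v) :
    c * u ^ (c-1) * (v - u) ≤ v ^ c - u ^ c ∧ v ^ c - u ^ c ≤ c * v ^ (c-1) * (v - u) := by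
  rcases huv.eq_or_lt with rfl | hlt
  · simp
  · obtain ⟨ξ, hξ, h⟩ := exists_hasDerivAt_eq_slope (fun t : ℝ => t ^ c) (fun t => c * t ^ (c-1)) hlt
      (by apply ContinuousOn.rpow_const continuousOn_id; intro x hx; right; linarith)
      (fun x hx => by
        have := hasDerivAt_rpow_const (x := x) (p := c) (Or.inr hc)
        simpa using this)
    have hξ0 : 0 < ξ := hu.trans hξ.1
    have h2 : v ^ c - u ^ c = c * ξ ^ (c-1) * (v - u) := by
      rw [h]; field_simp [sub_ne_zero.2 hlt.ne']
    rw [h2]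
    have h3 : u ^ (c-1) ≤ ξ ^ (c-1) := rpow_le_rpow hu.le hξ.1.le (by linarith)
    have h4 : ξ ^ (c-1) ≤ v ^ (c-1) := rpow_le_rpow hξ0.le hξ.2.le (by linarith)
    have : 0 < v - u := by linarith
    constructor <;> gcongr

lemma second_rpow (c : ℝ) (hc : 1 < c) (hc2 : c < 2) (t : ℝ) (ht : 0 < t) :
    c * (c-1) * (t+2) ^ (c-2) ≤ ((t+2) ^ c - (t+1) ^ c) - ((t+1) ^ c - t ^ c) ∧
    ((t+2) ^ c - (t+1) ^ c) - ((t+1) ^ c - t ^ c) ≤ c * (c-1) * t ^ (c-2) := by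
  have hd : ∀ x : ℝ, 0 < x → HasDerivAt (fun t : ℝ => t ^ c) (c * x ^ (c-1)) x := by
    intro x hx
    exact hasDerivAt_rpow_const (Or.inl hx.ne')
  have hd1 : ∀ x : ℝ, 0 < x → HasDerivAt (fun t : ℝ => t ^ (c-1)) ((c-1) * x ^ (c-2)) x := by
    intro x hx
    have := hasDerivAt_rpow_const (x := x) (p := c-1) (Or.inl hx.ne')
    rwa [show c - 1 - 1 = c - 2 by ring] at this
  have hd2 : ∀ x : ℝ, 0 < x → HasDerivAt (fun t : ℝ => (t+1) ^ c - t ^ c) (c * (x+1) ^ (c-1) - c * x ^ (c-1)) x := by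
    intro x hx
    have h1 := (hd (x+1) (by linarith)).comp x ((hasDerivAt_id x).add_const 1)
    simp only [mul_one] at h1
    exact h1.sub (hd x hx)
  obtain ⟨ξ, hξ, h⟩ := exists_hasDerivAt_eq_slope (fun t : ℝ => (t+1) ^ c - t ^ c) 
    (fun x => c * (x+1) ^ (c-1) - c * x ^ (c-1)) (show t < t + 1 by linarith)
    (fun x hx => (hd2 x (by linarith [hx.1])).continuousAt.continuousWithinAt)
    (fun x hx => hd2 x (by linarith [hx.1]))
  have hξ0 : 0 < ξ := ht.trans hξ.1
  obtain ⟨ζ, hζ, h'⟩ := exists_hasDerivAt_eq_slope (fun t : ℝ => t ^ (c-1)) 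
    (fun x => (c-1) * x ^ (c-2)) (show ξ < ξ + 1 by linarith)
    (fun x hx => (hd1 x (by linarith [hx.1])).continuousAt.continuousWithinAt)
    (fun x hx => hd1 x (by linarith [hx.1]))
  have hζ0 : 0 < ζ := hξ0.trans hζ.1
  simp only [add_sub_cancel_left, div_one] at h h'
  have h3 : ((t+2) ^ c - (t+1) ^ c) - ((t+1) ^ c - t ^ c) = c * (c-1) * ζ ^ (c-2) := by
    rw [show t + 2 = t + 1 + 1 by ring, ← h, ← mul_sub, ← h']; ring
  rw [h3]
  have hcc : 0 < c * (c-1) := mul_pos (by linarith) (by linarith)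
  constructor
  · refine mul_le_mul_of_nonneg_left (rpow_le_rpow_of_nonpos hζ0 (by linarith [hζ.2, hξ.2]) (by linarith)) hcc.le
  · refine mul_le_mul_of_nonneg_left (rpow_le_rpow_of_nonpos ht (by linarith [hζ.1, hξ.1]) (by linarith)) hcc.le

lemma norm_sum_e_neg (s : Finset ℕ) (f : ℕ → ℝ) : ‖∑ n ∈ s, e (-f n)‖ = ‖∑ n ∈ s, e (f n)‖ := by
  simp_rw [e_neg]
  rw [← map_sum, Complex.norm_conj]

lemma vdc_abs {c : ℝ} (A : ℝ) (s : Finset ℕ) : 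
    ‖∑ n ∈ s, e (A * (n:ℝ) ^ c)‖ = ‖∑ n ∈ s, e (|A| * (n:ℝ) ^ c)‖ := by
  rcases le_total 0 A with h | h
  · rw [abs_of_nonneg h]
  · rw [abs_of_nonpos h, ← norm_sum_e_neg]
    simp [neg_mul]

/-- second derivative test for `A n^c` -/
lemma vdc (c : ℝ) (hc : 1 < c) (hc2 : c < 2) : ∃ C : ℝ, 0 < C ∧ ∀ A : ℝ, A ≠ 0 → ∀ Y : ℝ, 1 ≤ Y →
    ∀ a b : ℕ, Y ≤ a → (b:ℝ) ≤ 17 * Y →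
    ‖∑ n ∈ Finset.Ico a b, e (A * (n:ℝ) ^ c)‖ ≤ C * (√(|A| * Y ^ c) + Y / √(|A| * Y ^ c)) := by
  set κ := c * (c-1) with hκ
  have hκ0 : 0 < κ := mul_pos (by linarith) (by linarith)
  set k1 := κ * 18 ^ (c-2) with hk1
  have hk10 : 0 < k1 := by positivity
  refine ⟨32 * √k1 + 80 * κ / √k1 + 10 / √k1, by positivity, ?_⟩
  intro A hA Y hY a b ha hb
  rw [vdc_abs]
  have hA' : 0 < |A| := abs_pos.2 hA
  have hY0 : 0 < Y := by linarith
  set F := |A| * Y ^ c with hF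
  have hF0 : 0 < F := by positivity
  have hsF : 0 < √F := sqrt_pos.2 hF0
  have hs1 : 0 < √k1 := sqrt_pos.2 hk10
  have hYc : Y ^ (c-2) = Y ^ c / Y ^ 2 := by
    rw [rpow_sub hY0]; norm_num
  have hsl : √(k1 * F / Y^2) = √k1 * √F / Y := by
    rw [sqrt_div (by positivity), sqrt_mul hk10.le, sqrt_sq hY0.le]
  rcases le_or_gt (k1 * F / Y ^ 2) (1/4) with hl | hl
  · have hba : ((b - a : ℕ) : ℝ) ≤ 16 * Y := by
      rcases le_total a b with hab | hab
      · rw [Nat.cast_sub hab]; linarith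
      · rw [Nat.sub_eq_zero_of_le hab]; push_cast; linarith
    rw [Finset.sum_Ico_eq_sum_range]
    have := second_diff (fun i => |A| * ((a + i : ℕ) : ℝ) ^ c) (b - a) (k1 * F / Y^2) (κ * F / Y^2)
      (by positivity) hl (by
        gcongr
        rw [hk1]
        have : (18:ℝ) ^ (c-2) ≤ 1 := rpow_le_one_of_one_le_of_nonpos (by norm_num) (by linarith)
        nlinarith) (by
        intro n hn
        have hn' : (n:ℝ) + a + 1 ≤ b := by
          have : n + a + 1 ≤ b := by omega
          exact_mod_cast this
        have hn0 : (0:ℝ) ≤ n := by positivity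
        have ht : 0 < (a:ℝ) + n := by linarith
        obtain ⟨h1, h2⟩ := second_rpow c hc hc2 ((a:ℝ) + n) ht
        have e2 : (((a + (n+2) : ℕ)) : ℝ) = (a:ℝ) + n + 2 := by push_cast; ring
        have e1 : (((a + (n+1) : ℕ)) : ℝ) = (a:ℝ) + n + 1 := by push_cast; ring
        have e0 : (((a + n : ℕ)) : ℝ) = (a:ℝ) + n := by push_cast; ring
        simp only [e2, e1, e0]
        have hlow : κ * 18 ^ (c-2) * Y ^ (c-2) ≤ κ * ((a:ℝ) + n + 2) ^ (c-2) := by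
          rw [mul_assoc, ← mul_rpow (by norm_num) hY0.le]
          refine mul_le_mul_of_nonneg_left (rpow_le_rpow_of_nonpos (by linarith) (by linarith) (by linarith)) hκ0.le
        have hup : κ * ((a:ℝ) + n) ^ (c-2) ≤ κ * Y ^ (c-2) := by
          refine mul_le_mul_of_nonneg_left (rpow_le_rpow_of_nonpos hY0 (by linarith) (by linarith)) hκ0.le
        have r1 : k1 * F / Y ^ 2 = |A| * (κ * 18 ^ (c-2) * Y ^ (c-2)) := by
          rw [hYc, hF, hk1]; ring
        have r2 : κ * F / Y ^ 2 = |A| * (κ * Y ^ (c-2)) := by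
          rw [hYc, hF]; ring
        rw [r1, r2]
        have r3 : |A| * ((a:ℝ) + n + 2) ^ c - |A| * ((a:ℝ) + n + 1) ^ c - 
          (|A| * ((a:ℝ) + n + 1) ^ c - |A| * ((a:ℝ) + n) ^ c) = 
          |A| * ((((a:ℝ) + n + 2) ^ c - ((a:ℝ) + n + 1) ^ c) - (((a:ℝ) + n + 1) ^ c - ((a:ℝ) + n) ^ c)) := by ring
        rw [r3]
        exact ⟨mul_le_mul_of_nonneg_left (hlow.trans h1) hA'.le, mul_le_mul_of_nonneg_left (h2.trans hup) hA'.le⟩)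
    refine this.trans ?_
    rw [hsl]
    have h5 : 5 * (κ * F / Y ^ 2 * ((b - a : ℕ) : ℝ) + 2) / (√k1 * √F / Y) ≤
        5 * (κ * F / Y ^ 2 * (16 * Y) + 2) / (√k1 * √F / Y) := by gcongr
    refine h5.trans ?_
    have h6 : 5 * (κ * F / Y ^ 2 * (16 * Y) + 2) / (√k1 * √F / Y) = 80 * κ / √k1 * √F + 10 / √k1 * (Y / √F) := by
      have : F = √F * √F := (mul_self_sqrt hF0.le).symm
      field_simp
      rw [sq_sqrt hF0.le]; ring
    rw [h6]
    have : 0 ≤ Y / √F := by positivity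
    have : 0 ≤ 32 * √k1 := by positivity
    have : 0 ≤ 80 * κ / √k1 := by positivity
    have : 0 ≤ 10 / √k1 := by positivity
    nlinarith [mul_nonneg ‹0 ≤ 32 * √k1› hsF.le, mul_nonneg ‹0 ≤ 32 * √k1› ‹0 ≤ Y / √F›,
      mul_nonneg ‹0 ≤ 80 * κ / √k1› ‹0 ≤ Y / √F›, mul_nonneg ‹0 ≤ 10 / √k1› hsF.le]
  · have h1 : 1/2 < √k1 * √F / Y := by
      rw [← hsl, show (1/2:ℝ) = √(1/4) by rw [show (1/4:ℝ) = (1/2)^2 by norm_num, sqrt_sq (by norm_num)]]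
      exact sqrt_lt_sqrt (by norm_num) hl
    rw [lt_div_iff₀ hY0] at h1
    refine (sum_Ico_e_le _ _ _).trans ?_
    have hba : ((b - a : ℕ) : ℝ) ≤ 16 * Y := by
      rcases le_total a b with hab | hab
      · rw [Nat.cast_sub hab]; linarith
      · rw [Nat.sub_eq_zero_of_le hab]; push_cast; linarith
    have : 0 ≤ Y / √F := by positivity
    have h80 : 0 ≤ 80 * κ / √k1 := by positivity
    have h10 : 0 ≤ 10 / √k1 := by positivity
    calc ((b - a : ℕ) : ℝ) ≤ 32 * √k1 * √F := by linarith
      _ ≤ (32 * √k1 + 80 * κ / √k1 + 10 / √k1) * √F := by gcongr; linarith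
      _ ≤ _ := by gcongr; linarith

/-- first derivative test -/
lemma vdc1 (c : ℝ) (hc : 1 < c) (A : ℝ) (hA : A ≠ 0) (Y : ℝ) (hY : 1 ≤ Y) (a b : ℕ)
    (ha : Y ≤ a) (hb : (b:ℝ) ≤ 17 * Y) (hF : c * 17 ^ (c-1) * (|A| * Y ^ c) ≤ Y / 2) :
    ‖∑ n ∈ Finset.Ico a b, e (A * (n:ℝ) ^ c)‖ ≤ 2 * (Y / (|A| * Y ^ c)) := by
  rw [vdc_abs]
  have hA' : 0 < |A| := abs_pos.2 hA
  have hY0 : 0 < Y := by linarith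
  have hYc : Y ^ (c-1) = Y ^ c / Y := by
    rw [rpow_sub hY0, rpow_one]
  set F := |A| * Y ^ c with hFd
  have hF0 : 0 < F := by positivity
  set θ := c * F / Y with hθ
  have hθ0 : 0 < θ := by positivity
  have h17 : (1:ℝ) ≤ 17 ^ (c-1) := one_le_rpow (by norm_num) (by linarith)
  have hup : c * 17 ^ (c-1) * F / Y ≤ 1/2 := by rw [div_le_iff₀ hY0]; linarith
  have hθ1 : θ ≤ 1/2 := by
    refine le_trans ?_ hup
    rw [hθ]; gcongr
    nlinarith
  rw [Finset.sum_Ico_eq_sum_range]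
  have hdiff : ∀ n : ℕ, n + 1 < b - a → θ ≤ |A| * ((a + (n+1) : ℕ) : ℝ) ^ c - |A| * ((a + n : ℕ) : ℝ) ^ c ∧
      |A| * ((a + (n+1) : ℕ) : ℝ) ^ c - |A| * ((a + n : ℕ) : ℝ) ^ c ≤ 1 - θ := by
    intro n hn
    have hn' : (n:ℝ) + a + 1 ≤ b := by
      have : n + a + 1 ≤ b := by omega
      exact_mod_cast this
    have hn0 : (0:ℝ) ≤ n := by positivity
    have ht : 0 < (a:ℝ) + n := by linarith
    obtain ⟨h1, h2⟩ := rpow_diff c hc.le ((a:ℝ) + n) ((a:ℝ) + n + 1) ht (by linarith)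
    have e1 : (((a + (n+1) : ℕ)) : ℝ) = (a:ℝ) + n + 1 := by push_cast; ring
    have e0 : (((a + n : ℕ)) : ℝ) = (a:ℝ) + n := by push_cast; ring
    rw [e1, e0, ← mul_sub]
    simp only [add_sub_cancel_left, mul_one] at h1 h2
    constructor
    · have : θ = |A| * (c * Y ^ (c-1)) := by rw [hθ, hFd, hYc]; ring
      rw [this]
      refine mul_le_mul_of_nonneg_left (le_trans ?_ h1) hA'.le
      gcongr; linarith
    · refine le_trans (mul_le_mul_of_nonneg_left h2 hA'.le) ?_
      have : |A| * (c * ((a:ℝ) + n + 1) ^ (c-1)) ≤ |A| * (c * (17 * Y) ^ (c-1)) := by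
        gcongr; linarith
      refine this.trans ?_
      rw [mul_rpow (by norm_num) hY0.le, hYc]
      have : |A| * (c * (17 ^ (c-1) * (Y ^ c / Y))) = c * 17 ^ (c-1) * F / Y := by rw [hFd]; ring
      linarith
  have := kusmin_landau (fun i => |A| * ((a + i : ℕ) : ℝ) ^ c) (b - a) θ hθ0 hθ1 hdiff (by
    intro n hn
    have hn0 : (0:ℝ) ≤ n := by positivity
    have ht : 0 < (a:ℝ) + n := by linarith
    obtain ⟨h1, h2⟩ := rpow_diff c hc.le ((a:ℝ) + n) ((a:ℝ) + n + 1) ht (by linarith)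
    obtain ⟨h3, h4⟩ := rpow_diff c hc.le ((a:ℝ) + n + 1) ((a:ℝ) + n + 2) (by linarith) (by linarith)
    have e2 : (((a + (n+2) : ℕ)) : ℝ) = (a:ℝ) + n + 2 := by push_cast; ring
    have e1 : (((a + (n+1) : ℕ)) : ℝ) = (a:ℝ) + n + 1 := by push_cast; ring
    have e0 : (((a + n : ℕ)) : ℝ) = (a:ℝ) + n := by push_cast; ring
    simp only [e2, e1, e0]
    rw [← mul_sub, ← mul_sub]
    refine mul_le_mul_of_nonneg_left ?_ hA'.le
    have : (a:ℝ) + n + 2 - ((a:ℝ) + n + 1) = (a:ℝ) + n + 1 - ((a:ℝ) + n) := by ring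
    rw [this] at h3
    linarith)
  refine this.trans ?_
  rw [hθ]
  have : 2 / (c * F / Y) = 2 * (Y / F) / c := by field_simp
  rw [this]
  exact div_le_self (by positivity) hc.le
end BK
end

section
open Real MeasureTheory
namespace BK

lemma sum_inv_sqrt (Q : ℕ) : ∑ q ∈ Finset.Icc 1 Q, 1 / √(q:ℝ) ≤ 2 * √(Q:ℝ) := by
  induction Q with
  | zero => simp
  | succ n ih =>
    rw [Finset.sum_Icc_succ_top (by omega)]
    have h1 : 0 < √((n+1 : ℕ):ℝ) := sqrt_pos.2 (by positivity)
    have h2 : √((n+1 : ℕ):ℝ) * √((n+1 : ℕ):ℝ) = n + 1 := by rw [mul_self_sqrt (by positivity)]; push_cast; ring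
    have h3 : √(n:ℝ) * √(n:ℝ) = n := mul_self_sqrt (by positivity)
    have h4 : 1 / √((n+1 : ℕ):ℝ) ≤ 2 * √((n+1 : ℕ):ℝ) - 2 * √(n:ℝ) := by
      rw [div_le_iff₀ h1]
      nlinarith [sq_nonneg (√((n+1 : ℕ):ℝ) - √(n:ℝ))]
    linarith

lemma sum_dist (t : Finset ℕ) (k Q : ℕ) (h : ℕ → ℝ) (hh : ∀ q, 0 ≤ h q) :
    ∑ l ∈ t.filter (fun l => l ≠ k ∧ Nat.dist k l < Q), h (Nat.dist k l) ≤ 2 * ∑ q ∈ Finset.Icc 1 Q, h q := by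
  classical
  have hm : ∀ l ∈ t.filter (fun l => l ≠ k ∧ Nat.dist k l < Q), Nat.dist k l ∈ Finset.Icc 1 Q := by
    intro l hl
    simp only [Finset.mem_filter] at hl
    rw [Finset.mem_Icc]
    refine ⟨Nat.pos_of_ne_zero fun h0 => hl.2.1 (Nat.eq_of_dist_eq_zero h0).symm, hl.2.2.le⟩
  rw [← Finset.sum_fiberwise_of_maps_to hm, Finset.mul_sum]
  refine Finset.sum_le_sum fun q _ => ?_
  have : ∀ l ∈ (t.filter (fun l => l ≠ k ∧ Nat.dist k l < Q)).filter (fun l => Nat.dist k l = q), h (Nat.dist k l) = h q := by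
    intro l hl; rw [(Finset.mem_filter.1 hl).2]
  rw [Finset.sum_congr rfl this, Finset.sum_const, nsmul_eq_mul]
  refine mul_le_mul_of_nonneg_right ?_ (hh q)
  have hsub : (t.filter (fun l => l ≠ k ∧ Nat.dist k l < Q)).filter (fun l => Nat.dist k l = q) ⊆ {k - q, k + q} := by
    intro l hl
    have := (Finset.mem_filter.1 hl).2
    unfold Nat.dist at this
    simp only [Finset.mem_insert, Finset.mem_singleton]
    omega
  have := (Finset.card_le_card hsub).trans Finset.card_le_two
  exact_mod_cast this

/-- the smooth inner sum over `m` -/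
lemma inner_pair (c : ℝ) (hc : 1 < c) (hc2 : c < 2) : ∃ C : ℝ, 0 < C ∧ ∀ x : ℝ, x ≠ 0 → ∀ X M N : ℝ, 
    1 ≤ M → 1 ≤ N → M * N = X / 16 → ∀ k l : ℕ, N ≤ k → (k:ℝ) ≤ 16 * N → N ≤ l → (l:ℝ) ≤ 16 * N → k ≠ l →
    ‖∑ m ∈ (Finset.Icc ⌈M⌉₊ ⌊16*M⌋₊).filter (fun m : ℕ => (X/8 < (m:ℝ)*k ∧ (m:ℝ)*k ≤ X) ∧ (X/8 < (m:ℝ)*l ∧ (m:ℝ)*l ≤ X)),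
      e (x * ((m:ℝ)*k)^c) * (starRingEnd ℂ) (e (x * ((m:ℝ)*l)^c))‖ ≤ 
      C * (√(|x| * X ^ c * (Nat.dist k l : ℝ) / N) + M * √(N / (|x| * X^c)) * (1 / √(Nat.dist k l : ℝ))) := by
  obtain ⟨C, hC, hv⟩ := vdc c hc hc2
  refine ⟨16 * C, by positivity, ?_⟩
  intro x hx X M N hM hN hMN k l hk1 hk2 hl1 hl2 hkl
  have hx' : 0 < |x| := abs_pos.2 hx
  have hX : 0 < X := by nlinarith
  have hk0 : (0:ℝ) < k := by linarith
  have hl0 : (0:ℝ) < l := by linarith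
  set q : ℝ := (Nat.dist k l : ℝ) with hq
  have hq1 : 1 ≤ q := by
    have : 1 ≤ Nat.dist k l := Nat.pos_of_ne_zero fun h0 => hkl (Nat.eq_of_dist_eq_zero h0)
    rw [hq]; exact_mod_cast this
  have hset : (Finset.Icc ⌈M⌉₊ ⌊16*M⌋₊).filter (fun m : ℕ => (X/8 < (m:ℝ)*k ∧ (m:ℝ)*k ≤ X) ∧ (X/8 < (m:ℝ)*l ∧ (m:ℝ)*l ≤ X))
     = Finset.Ico (max ⌈M⌉₊ (max (⌊X/8/k⌋₊+1) (⌊X/8/l⌋₊+1))) (min ⌊16*M⌋₊ (min ⌊X/k⌋₊ ⌊X/l⌋₊) + 1) := by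
    ext m
    simp only [Finset.mem_filter, Finset.mem_Icc, Finset.mem_Ico]
    have a1 : X/8 < (m:ℝ)*k ↔ ⌊X/8/k⌋₊ < m := by rw [Nat.floor_lt (by positivity), div_lt_iff₀ hk0]
    have a2 : X/8 < (m:ℝ)*l ↔ ⌊X/8/l⌋₊ < m := by rw [Nat.floor_lt (by positivity), div_lt_iff₀ hl0]
    have a3 : (m:ℝ)*k ≤ X ↔ m ≤ ⌊X/k⌋₊ := by rw [Nat.le_floor_iff (by positivity), le_div_iff₀ hk0]
    have a4 : (m:ℝ)*l ≤ X ↔ m ≤ ⌊X/l⌋₊ := by rw [Nat.le_floor_iff (by positivity), le_div_iff₀ hl0]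
    rw [a1, a2, a3, a4]
    omega
  rw [hset]
  set A := x * ((k:ℝ)^c - (l:ℝ)^c) with hA
  have hterm : ∀ m : ℕ, e (x * ((m:ℝ)*k)^c) * (starRingEnd ℂ) (e (x * ((m:ℝ)*l)^c)) = e (A * (m:ℝ)^c) := by
    intro m
    rw [← e_sub, mul_rpow (by positivity) (by positivity), mul_rpow (by positivity) (by positivity)]
    congr 1; rw [hA]; ring
  simp_rw [hterm]
  -- bounds on |k^c - l^c|
  have hdiff : ∀ u v : ℕ, N ≤ u → (v:ℝ) ≤ 16 * N → u ≤ v → 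
      N ^ (c-1) * ((v:ℝ) - u) ≤ (v:ℝ)^c - (u:ℝ)^c ∧ (v:ℝ)^c - (u:ℝ)^c ≤ c * (16*N)^(c-1) * ((v:ℝ) - u) := by
    intro u v hu hv huv
    have huv' : (u:ℝ) ≤ v := by exact_mod_cast huv
    obtain ⟨h1, h2⟩ := rpow_diff c hc.le u v (by linarith) huv'
    have hvu : 0 ≤ (v:ℝ) - u := by linarith
    constructor
    · refine le_trans ?_ h1
      have : N ^ (c-1) ≤ (u:ℝ) ^ (c-1) := rpow_le_rpow (by linarith) hu (by linarith)
      have h0 : 0 ≤ (u:ℝ) ^ (c-1) := by positivity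
      refine mul_le_mul_of_nonneg_right ?_ hvu
      nlinarith
    · refine h2.trans ?_
      gcongr
  have habs : N ^ (c-1) * q ≤ |(k:ℝ)^c - (l:ℝ)^c| ∧ |(k:ℝ)^c - (l:ℝ)^c| ≤ c * (16*N)^(c-1) * q := by
    rcases le_total k l with h | h
    · obtain ⟨h1, h2⟩ := hdiff k l hk1 hl2 h
      have hkl' : (k:ℝ) ≤ l := by exact_mod_cast h
      have hqq : q = (l:ℝ) - k := by rw [hq, Nat.dist_eq_sub_of_le h, Nat.cast_sub h]
      rw [hqq, abs_sub_comm, abs_of_nonneg]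
      · exact ⟨h1, h2⟩
      · exact le_trans (mul_nonneg (by positivity) (by linarith)) h1
    · obtain ⟨h1, h2⟩ := hdiff l k hl1 hk2 h
      have hkl' : (l:ℝ) ≤ k := by exact_mod_cast h
      have hqq : q = (k:ℝ) - l := by rw [hq, Nat.dist_eq_sub_of_le_right h, Nat.cast_sub h]
      rw [hqq, abs_of_nonneg]
      · exact ⟨h1, h2⟩
      · exact le_trans (mul_nonneg (by positivity) (by linarith)) h1
  have hN0 : 0 < N := by linarith
  have hM0 : 0 < M := by linarith
  have hNc : N ^ (c-1) = N ^ c / N := by rw [rpow_sub hN0, rpow_one]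
  have hXc : M ^ c * N ^ c = X ^ c / 16 ^ c := by
    rw [← mul_rpow hM0.le hN0.le, hMN, div_rpow hX.le (by norm_num)]
  have h16c : (1:ℝ) ≤ 16 ^ c := one_le_rpow (by norm_num) (by linarith)
  have h16c2 : (16:ℝ) ^ c ≤ 256 := by
    calc (16:ℝ) ^ c ≤ 16 ^ (2:ℝ) := rpow_le_rpow_of_exponent_le (by norm_num) hc2.le
      _ = 256 := by norm_num
  set T := |x| * X ^ c with hT
  have hT0 : 0 < T := by positivity
  have hFl : T * q / N / 256 ≤ |A| * M ^ c := by
    rw [hA, abs_mul]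
    calc T * q / N / 256 ≤ T * q / N / 16 ^ c := by gcongr
      _ = |x| * (N ^ (c-1) * q) * M ^ c := by
        rw [hT, hNc]
        have : X ^ c = 16 ^ c * (M ^ c * N ^ c) := by rw [hXc]; field_simp
        rw [this]; field_simp
      _ ≤ _ := by gcongr; exact habs.1
  have hFu : |A| * M ^ c ≤ T * q / N := by
    rw [hA, abs_mul]
    calc |x| * |(k:ℝ)^c - (l:ℝ)^c| * M ^ c ≤ |x| * (c * (16*N)^(c-1) * q) * M ^ c := by gcongr; exact habs.2
      _ = (c / 16) * (T * q / N) := by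
        rw [mul_rpow (by norm_num) hN0.le, hNc, rpow_sub (by norm_num : (0:ℝ) < 16), rpow_one, hT]
        have : X ^ c = 16 ^ c * (M ^ c * N ^ c) := by rw [hXc]; field_simp
        rw [this]; field_simp
      _ ≤ 1 * (T * q / N) := by gcongr; linarith
      _ = _ := one_mul _
  have hA0 : A ≠ 0 := by
    intro h0
    rw [h0] at hFl
    simp at hFl
    have : 0 < T * q / N / 256 := by positivity
    linarith
  have hb := hv A hA0 M hM (max ⌈M⌉₊ (max (⌊X/8/k⌋₊+1) (⌊X/8/l⌋₊+1))) (min ⌊16*M⌋₊ (min ⌊X/k⌋₊ ⌊X/l⌋₊) + 1)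
    (by
      refine (Nat.le_ceil M).trans ?_
      exact_mod_cast le_max_left _ _)
    (by
      have h1 : min ⌊16*M⌋₊ (min ⌊X/k⌋₊ ⌊X/l⌋₊) ≤ ⌊16*M⌋₊ := min_le_left _ _
      have h2 : ((⌊16*M⌋₊ : ℕ) : ℝ) ≤ 16 * M := Nat.floor_le (by positivity)
      have h3 : ((min ⌊16*M⌋₊ (min ⌊X/k⌋₊ ⌊X/l⌋₊) : ℕ) : ℝ) ≤ ((⌊16*M⌋₊ : ℕ) : ℝ) := by exact_mod_cast h1
      rw [Nat.cast_add, Nat.cast_one]; linarith)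
  refine hb.trans ?_
  have hs1 : √(|A| * M ^ c) ≤ √(T * q / N) := sqrt_le_sqrt hFu
  have hs2 : √(T * q / N) / 16 ≤ √(|A| * M ^ c) := by
    have : √(T * q / N) / 16 = √(T * q / N / 256) := by
      rw [sqrt_div' (T * q / N) (by norm_num : (0:ℝ) ≤ 256), show (256:ℝ) = 16^2 by norm_num, sqrt_sq (by norm_num : (0:ℝ) ≤ 16)]
    rw [this]; exact sqrt_le_sqrt hFl
  have hpos : 0 < √(T * q / N) := sqrt_pos.2 (by positivity)
  have hinv : M / √(|A| * M ^ c) ≤ 16 * (M * √(N / T) * (1 / √q)) := by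
    have e1 : √(T * q / N) * (√(N / T) * (1 / √q)) = 1 := by
      rw [← sqrt_one, ← sqrt_div (by norm_num), ← sqrt_mul (by positivity), ← sqrt_mul (by positivity)]
      congr 1; field_simp
    rw [div_le_iff₀ (lt_of_lt_of_le (by positivity) hs2)]
    calc M = 16 * (M * √(N / T) * (1 / √q)) * (√(T * q / N) / 16) := by
          linear_combination (-M) * e1
      _ ≤ _ := by gcongr
  have : 0 ≤ M * √(N / T) * (1 / √q) := by positivity
  nlinarith [mul_nonneg hC.le hpos.le]
end BK
end

section
open Real MeasureTheory
namespace BK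

lemma sq_norm_expand {ι κ : Type*} (s : Finset ι) (t : Finset κ) (a : κ → ι → ℂ) :
    ∑ m ∈ s, ‖∑ k ∈ t, a k m‖^2 ≤ ∑ k ∈ t, ∑ l ∈ t, ‖∑ m ∈ s, a k m * (starRingEnd ℂ) (a l m)‖ := by
  have h : ((∑ m ∈ s, ‖∑ k ∈ t, a k m‖^2 : ℝ) : ℂ) = ∑ k ∈ t, ∑ l ∈ t, ∑ m ∈ s, a k m * (starRingEnd ℂ) (a l m) := by
    push_cast
    have : ∀ m ∈ s, ((‖∑ k ∈ t, a k m‖ : ℝ) : ℂ)^2 = ∑ k ∈ t, ∑ l ∈ t, a k m * (starRingEnd ℂ) (a l m) := by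
      intro m _
      rw [← Complex.mul_conj', map_sum, Finset.sum_mul_sum]
    rw [Finset.sum_congr rfl this, Finset.sum_comm]
    refine Finset.sum_congr rfl fun k _ => Finset.sum_comm
  have h2 : ∑ m ∈ s, ‖∑ k ∈ t, a k m‖^2 = ‖((∑ m ∈ s, ‖∑ k ∈ t, a k m‖^2 : ℝ) : ℂ)‖ := by
    rw [Complex.norm_real, norm_of_nonneg]; positivity
  rw [h2, h]
  refine (norm_sum_le _ _).trans (Finset.sum_le_sum fun k _ => norm_sum_le _ _)

lemma norm_sum_sq_le {ι : Type*} (s : Finset ι) (a : ι → ℂ) :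
    ‖∑ k ∈ s, a k‖^2 ≤ (s.card:ℝ) * ∑ k ∈ s, ‖a k‖^2 := by
  have h1 : ‖∑ k ∈ s, a k‖ ≤ ∑ k ∈ s, ‖a k‖ := norm_sum_le _ _
  have h2 : (∑ k ∈ s, ‖a k‖)^2 ≤ (s.card:ℝ) * ∑ k ∈ s, ‖a k‖^2 := sq_sum_le_card_mul_sum_sq
  refine le_trans ?_ h2
  gcongr

/-- block decomposition -/
lemma block_sq (s t : Finset ℕ) (a : ℕ → ℕ → ℂ) (Q K : ℕ) (hQ : 1 ≤ Q) (ht : ∀ k ∈ t, k ≤ K) :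
    ∑ m ∈ s, ‖∑ k ∈ t, a k m‖^2 ≤ ((K/Q + 1 : ℕ):ℝ) * ∑ k ∈ t, ∑ l ∈ t.filter (fun l => Nat.dist k l < Q), 
      ‖∑ m ∈ s, a k m * (starRingEnd ℂ) (a l m)‖ := by
  classical
  have hmap : ∀ k ∈ t, k / Q ∈ Finset.range (K/Q+1) := by
    intro k hk
    rw [Finset.mem_range]
    have := Nat.div_le_div_right (c := Q) (ht k hk)
    omega
  have h1 : ∀ m ∈ s, ‖∑ k ∈ t, a k m‖^2 ≤ ((K/Q + 1 : ℕ):ℝ) * ∑ b ∈ Finset.range (K/Q+1), ‖∑ k ∈ t.filter (fun k => k / Q = b), a k m‖^2 := by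
    intro m _
    rw [← Finset.sum_fiberwise_of_maps_to hmap]
    have := norm_sum_sq_le (Finset.range (K/Q+1)) (fun b => ∑ k ∈ t.filter (fun k => k / Q = b), a k m)
    rwa [Finset.card_range] at this
  refine (Finset.sum_le_sum h1).trans ?_
  rw [← Finset.mul_sum, Finset.sum_comm]
  refine mul_le_mul_of_nonneg_left ?_ (by positivity)
  calc _ ≤ ∑ b ∈ Finset.range (K/Q+1), ∑ k ∈ t.filter (fun k => k / Q = b), ∑ l ∈ t.filter (fun k => k / Q = b), 
      ‖∑ m ∈ s, a k m * (starRingEnd ℂ) (a l m)‖ := Finset.sum_le_sum fun b _ => sq_norm_expand _ _ _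
    _ ≤ ∑ b ∈ Finset.range (K/Q+1), ∑ k ∈ t.filter (fun k => k / Q = b), ∑ l ∈ t.filter (fun l => Nat.dist k l < Q), 
      ‖∑ m ∈ s, a k m * (starRingEnd ℂ) (a l m)‖ := by
        refine Finset.sum_le_sum fun b _ => Finset.sum_le_sum fun k hk => ?_
        refine Finset.sum_le_sum_of_subset_of_nonneg ?_ (fun _ _ _ => norm_nonneg _)
        intro l hl
        rw [Finset.mem_filter] at hl hk ⊢
        refine ⟨hl.1, ?_⟩
        have e1 := Nat.div_add_mod k Q
        have e2 := Nat.div_add_mod l Q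
        have e3 := Nat.mod_lt k hQ
        have e4 := Nat.mod_lt l hQ
        rw [hk.2] at e1; rw [hl.2] at e2
        unfold Nat.dist; omega
    _ = _ := Finset.sum_fiberwise_of_maps_to hmap _

/-- the phase with cutoff -/
noncomputable def ph (c x X : ℝ) (m k : ℕ) : ℂ := if X/8 < (m:ℝ)*k ∧ (m:ℝ)*k ≤ X then e (x * ((m:ℝ)*k)^c) else 0

lemma norm_ph_le (c x X : ℝ) (m k : ℕ) : ‖ph c x X m k‖ ≤ 1 := by
  unfold ph; split_ifs
  · rw [norm_e]
  · simp

lemma bilinear (c : ℝ) (hc : 1 < c) (hc2 : c < 2) : ∃ C : ℝ, 0 < C ∧ ∀ x : ℝ, x ≠ 0 → ∀ X M N : ℝ, 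
    1 ≤ M → 1 ≤ N → M * N = X / 16 → ∀ Q : ℕ, 1 ≤ Q → (Q:ℝ) ≤ N → ∀ α β : ℕ → ℝ, ∀ D1 D2 : ℝ, (∀ m, |α m| ≤ D1) → (∀ k, |β k| ≤ D2) →
    ‖∑ m ∈ Finset.Icc ⌈M⌉₊ ⌊16*M⌋₊, ∑ k ∈ Finset.Icc ⌈N⌉₊ ⌊16*N⌋₊, (α m : ℂ) * (β k : ℂ) * ph c x X m k‖^2 ≤
     C * (D1 * D2)^2 * (X^2/Q + X * √(|x| * X ^ c*Q*N) + X^2 * √(N/(|x| * X ^ c*Q))) := by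
  obtain ⟨C, hC, hp⟩ := inner_pair c hc hc2
  refine ⟨16 * 17 * 16 * (16 + 4 * C), by positivity, ?_⟩
  intro x hx X M N hM hN hMN Q hQ hQN α β D1 D2 hα hβ
  set s := Finset.Icc ⌈M⌉₊ ⌊16*M⌋₊ with hs
  set t := Finset.Icc ⌈N⌉₊ ⌊16*N⌋₊ with ht
  set T := |x| * X ^ c with hT
  have hx' : 0 < |x| := abs_pos.2 hx
  have hX : 0 < X := by nlinarith
  have hT0 : 0 < T := by positivity
  have hM0 : 0 < M := by linarith
  have hN0 : 0 < N := by linarith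
  have hQ0 : (0:ℝ) < Q := by exact_mod_cast hQ
  have hD2 : 0 ≤ D2 := (abs_nonneg _).trans (hβ 0)
  have hD1 : 0 ≤ D1 := (abs_nonneg _).trans (hα 0)
  have cardI : ∀ Y : ℝ, 1 ≤ Y → ((Finset.Icc ⌈Y⌉₊ ⌊16*Y⌋₊).card : ℝ) ≤ 16 * Y := by
    intro Y hY
    rw [Nat.card_Icc]
    have h1 : 1 ≤ ⌈Y⌉₊ := Nat.one_le_ceil_iff.2 (by linarith)
    have h2 : ⌊16*Y⌋₊ + 1 - ⌈Y⌉₊ ≤ ⌊16*Y⌋₊ := by omega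
    calc ((⌊16*Y⌋₊ + 1 - ⌈Y⌉₊ : ℕ):ℝ) ≤ (⌊16*Y⌋₊:ℝ) := by exact_mod_cast h2
      _ ≤ _ := Nat.floor_le (by linarith)
  have memt : ∀ k ∈ t, N ≤ (k:ℝ) ∧ (k:ℝ) ≤ 16 * N := by
    intro k hk
    rw [ht, Finset.mem_Icc] at hk
    exact ⟨Nat.ceil_le.1 hk.1, (Nat.le_floor_iff (by linarith)).1 hk.2⟩
  -- Cauchy in m
  have step1 : ‖∑ m ∈ s, ∑ k ∈ t, (α m : ℂ) * (β k : ℂ) * ph c x X m k‖^2 ≤ 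
      (16 * M) * D1^2 * ∑ m ∈ s, ‖∑ k ∈ t, (β k : ℂ) * ph c x X m k‖^2 := by
    refine (norm_sum_sq_le _ _).trans ?_
    rw [mul_assoc]
    refine mul_le_mul (cardI M hM) ?_ (by positivity) (by positivity)
    rw [Finset.mul_sum]
    refine Finset.sum_le_sum fun m _ => ?_
    simp_rw [mul_assoc]
    rw [← Finset.mul_sum, norm_mul, mul_pow, Complex.norm_real, norm_eq_abs]
    gcongr
    exact hα m
  have step2 := block_sq s t (fun k m => (β k : ℂ) * ph c x X m k) Q ⌊16*N⌋₊ hQ (fun k hk => (Finset.mem_Icc.1 hk).2)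
  have hblocks : ((⌊16*N⌋₊/Q + 1 : ℕ):ℝ) ≤ 17 * N / Q := by
    push_cast
    have : ((⌊16*N⌋₊/Q : ℕ):ℝ) ≤ 16 * N / Q := by
      refine Nat.cast_div_le.trans ?_
      gcongr; exact Nat.floor_le (by positivity)
    have h2 : 1 ≤ N / Q := by rw [le_div_iff₀ hQ0]; linarith
    have : 17 * N / Q = 16 * N / Q + N / Q := by ring
    linarith
  -- pair bound
  have hpair : ∀ k ∈ t, ∑ l ∈ t.filter (fun l => Nat.dist k l < Q), 
      ‖∑ m ∈ s, ((β k : ℂ) * ph c x X m k) * (starRingEnd ℂ) ((β l : ℂ) * ph c x X m l)‖ ≤ 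
      D2^2 * (16 * M + 2 * C * (Q * √(T*Q/N)) + 4 * C * (M * √(N/T) * √Q)) := by
    intro k hk
    have hW : ∀ l ∈ t, ‖∑ m ∈ s, ((β k : ℂ) * ph c x X m k) * (starRingEnd ℂ) ((β l : ℂ) * ph c x X m l)‖ ≤
        D2^2 * ‖∑ m ∈ s, ph c x X m k * (starRingEnd ℂ) (ph c x X m l)‖ := by
      intro l hl
      have : ∑ m ∈ s, ((β k : ℂ) * ph c x X m k) * (starRingEnd ℂ) ((β l : ℂ) * ph c x X m l) = 
          ((β k : ℂ) * (β l : ℂ)) * ∑ m ∈ s, ph c x X m k * (starRingEnd ℂ) (ph c x X m l) := by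
        rw [Finset.mul_sum]
        refine Finset.sum_congr rfl fun m _ => ?_
        rw [map_mul, Complex.conj_ofReal]; ring
      rw [this, norm_mul, norm_mul, Complex.norm_real, Complex.norm_real, norm_eq_abs, norm_eq_abs, sq]
      gcongr
      · exact hβ k
      · exact hβ l
    have hWo : ∀ l ∈ t.filter (fun l => l ≠ k ∧ Nat.dist k l < Q), ‖∑ m ∈ s, ph c x X m k * (starRingEnd ℂ) (ph c x X m l)‖ ≤
        C * (√(T * Q / N) + M * √(N/T) * (1 / √(Nat.dist k l : ℝ))) := by
      intro l hl
      rw [Finset.mem_filter] at hl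
      have h1 := hp x hx X M N hM hN hMN k l (memt k hk).1 (memt k hk).2 (memt l hl.1).1 (memt l hl.1).2 (Ne.symm hl.2.1)
      have h2 : ∑ m ∈ s, ph c x X m k * (starRingEnd ℂ) (ph c x X m l) = ∑ m ∈ s.filter (fun m : ℕ => (X/8 < (m:ℝ)*k ∧ (m:ℝ)*k ≤ X) ∧ (X/8 < (m:ℝ)*l ∧ (m:ℝ)*l ≤ X)),
          e (x * ((m:ℝ)*k)^c) * (starRingEnd ℂ) (e (x * ((m:ℝ)*l)^c)) := by
        rw [Finset.sum_filter]
        refine Finset.sum_congr rfl fun m _ => ?_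
        unfold ph
        by_cases p1 : X/8 < (m:ℝ)*k ∧ (m:ℝ)*k ≤ X <;> by_cases p2 : X/8 < (m:ℝ)*l ∧ (m:ℝ)*l ≤ X <;> simp [p1, p2]
      rw [h2]
      refine h1.trans ?_
      gcongr
      exact hl.2.2.le
    have hWd : ‖∑ m ∈ s, ph c x X m k * (starRingEnd ℂ) (ph c x X m k)‖ ≤ 16 * M := by
      refine (norm_sum_le _ _).trans (le_trans ?_ (cardI M hM))
      rw [Finset.card_eq_sum_ones]; push_cast
      refine Finset.sum_le_sum fun m _ => ?_
      rw [norm_mul, RCLike.norm_conj]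
      have := norm_ph_le c x X m k
      nlinarith [norm_nonneg (ph c x X m k)]
    refine (Finset.sum_le_sum fun l hl => hW l (Finset.mem_filter.1 hl).1).trans ?_
    rw [← Finset.mul_sum]
    refine mul_le_mul_of_nonneg_left ?_ (by positivity)
    have hsplit : t.filter (fun l => Nat.dist k l < Q) = insert k (t.filter (fun l => l ≠ k ∧ Nat.dist k l < Q)) := by
      ext l
      simp only [Finset.mem_filter, Finset.mem_insert]
      constructor
      · intro h
        by_cases hlk : l = k
        · exact Or.inl hlk
        · exact Or.inr ⟨h.1, hlk, h.2⟩
      · rintro (h | h)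
        · subst h; exact ⟨hk, by rw [Nat.dist_self]; omega⟩
        · exact ⟨h.1, h.2.2⟩
    rw [hsplit, Finset.sum_insert (by simp)]
    have hoff : ∑ l ∈ t.filter (fun l => l ≠ k ∧ Nat.dist k l < Q), ‖∑ m ∈ s, ph c x X m k * (starRingEnd ℂ) (ph c x X m l)‖ ≤
        2 * ∑ q ∈ Finset.Icc 1 Q, C * (√(T * Q / N) + M * √(N/T) * (1 / √(q : ℝ))) := by
      refine (Finset.sum_le_sum hWo).trans ?_
      exact sum_dist t k Q (fun q => C * (√(T * Q / N) + M * √(N/T) * (1 / √(q : ℝ)))) (fun q => by positivity)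
    have hsum : ∑ q ∈ Finset.Icc 1 Q, C * (√(T * Q / N) + M * √(N/T) * (1 / √(q : ℝ))) ≤ C * (Q * √(T*Q/N)) + 2 * C * (M * √(N/T) * √Q) := by
      rw [← Finset.mul_sum, Finset.sum_add_distrib, ← Finset.mul_sum, Finset.sum_const, Nat.card_Icc, nsmul_eq_mul]
      have := mul_le_mul_of_nonneg_left (sum_inv_sqrt Q) (by positivity : 0 ≤ C * (M * √(N/T)))
      simp only [Nat.add_sub_cancel]
      nlinarith
    linarith
  have step3 : ∑ m ∈ s, ‖∑ k ∈ t, (β k : ℂ) * ph c x X m k‖^2 ≤ 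
      (17 * N / Q) * ((16 * N) * (D2^2 * (16 * M + 2 * C * (Q * √(T*Q/N)) + 4 * C * (M * √(N/T) * √Q)))) := by
    refine step2.trans ?_
    refine mul_le_mul hblocks ?_ (by positivity) (by positivity)
    refine (Finset.sum_le_sum hpair).trans ?_
    rw [Finset.sum_const, nsmul_eq_mul]
    gcongr
    exact cardI N hN
  refine step1.trans ((mul_le_mul_of_nonneg_left step3 (by positivity)).trans ?_)
  have r1 : √(T * Q * N) = N * √(T*Q/N) := by
    rw [show T * Q * N = N^2 * (T*Q/N) by field_simp, sqrt_mul (by positivity), sqrt_sq hN0.le]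
  have r2 : √(N/(T*Q)) * Q = √(N/T) * √Q := by
    rw [← sqrt_mul (by positivity), show N/T*(Q:ℝ) = Q^2 * (N/(T*Q)) by field_simp, sqrt_mul (by positivity), sqrt_sq hQ0.le]; ring
  rw [r1]
  have hX16 : X = 16 * (M * N) := by linarith
  set a := √(T*Q/N) with ha
  set b := √(N/(T*Q)) with hb
  have ha0 : 0 ≤ a := sqrt_nonneg _
  have hb0 : 0 ≤ b := sqrt_nonneg _
  calc _ = (D1*D2)^2 * (16 * 17 * 16) * (M * N) * (16 * (M*N) / Q + 2 * C * (N * a) + 4 * C * (M * N * (√(N/T) * √Q) / Q)) := by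
        field_simp
    _ = (D1*D2)^2 * (16 * 17 * 16) * (X/16) * (X / Q + 2 * C * (N * a) + 4 * C * (X/16) * b) := by
        rw [← r2, hX16]; field_simp
    _ ≤ (D1*D2)^2 * (16 * 17 * 16) * X * ((16 + 4 * C) * (X / Q) + (16 + 4 * C) * (N * a) + (16 + 4 * C) * (X * b)) := by
        have p1 : 0 ≤ X / Q := by positivity
        have p2 : 0 ≤ N * a := by positivity
        have p3 : 0 ≤ X * b := by positivity
        have g1 : X / Q ≤ (16 + 4 * C) * (X / Q) := by nlinarith
        have g2 : 2 * C * (N * a) ≤ (16 + 4 * C) * (N * a) := by nlinarith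
        have g3 : 4 * C * (X/16) * b ≤ (16 + 4 * C) * (X * b) := by nlinarith
        refine mul_le_mul (by gcongr; linarith) (by linarith) (by positivity) (by positivity)
    _ = _ := by ring
end BK
end

section
open Real MeasureTheory
namespace BK
open ArithmeticFunction in
/-- Truncation of an arithmetic function. -/
noncomputable def trunc (f : ArithmeticFunction ℝ) (U : ℝ) : ArithmeticFunction ℝ :=
  ⟨fun n => if (n:ℝ) ≤ U then f n else 0, by simp⟩

lemma trunc_apply (f : ArithmeticFunction ℝ) (U : ℝ) (n : ℕ) : trunc f U n = if (n:ℝ) ≤ U then f n else 0 := rfl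

/-- the phase function -/
noncomputable def F (c x X : ℝ) (n : ℕ) : ℂ := if X/8 < (n:ℝ) ∧ (n:ℝ) ≤ X then e (x * (n:ℝ)^c) else 0

lemma ph_eq (c x X : ℝ) (m k : ℕ) : ph c x X m k = F c x X (m*k) := by
  unfold ph F; push_cast; rfl

lemma F_zero (c x X : ℝ) (n : ℕ) (h : X < n) : F c x X n = 0 := by
  unfold F; rw [if_neg]; intro h2; linarith [h2.2]

open ArithmeticFunction in
noncomputable def muR : ArithmeticFunction ℝ := ((ArithmeticFunction.moebius : ArithmeticFunction ℤ) : ArithmeticFunction ℝ)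
noncomputable def zR : ArithmeticFunction ℝ := ((ArithmeticFunction.zeta : ArithmeticFunction ℕ) : ArithmeticFunction ℝ)

noncomputable def LamR : ArithmeticFunction ℝ := ArithmeticFunction.vonMangoldt

lemma vaughan (U : ℝ) : LamR = trunc LamR U + trunc muR U * ArithmeticFunction.log 
    - trunc muR U * trunc LamR U * zR + (muR - trunc muR U) * ((LamR - trunc LamR U) * zR) := by
  have h1 : muR * zR = 1 := ArithmeticFunction.coe_moebius_mul_coe_zeta
  have h2 : ArithmeticFunction.log = LamR * zR := ArithmeticFunction.vonMangoldt_mul_zeta.symm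
  rw [h2]
  linear_combination (trunc LamR U - LamR) * h1

lemma conv_sum (f g : ArithmeticFunction ℝ) (G : ℕ → ℂ) (K : ℕ) (hG : ∀ n, K < n → G n = 0) :
    ∑ n ∈ Finset.Icc 1 K, ((f * g) n : ℂ) * G n = ∑ m ∈ Finset.Icc 1 K, ∑ k ∈ Finset.Icc 1 K, (f m : ℂ) * (g k : ℂ) * G (m*k) := by
  classical
  rw [← Finset.sum_product']
  have hmap : ∀ p ∈ (Finset.Icc 1 K ×ˢ Finset.Icc 1 K).filter (fun p : ℕ × ℕ => p.1 * p.2 ≤ K), p.1 * p.2 ∈ Finset.Icc 1 K := by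
    intro p hp
    simp only [Finset.mem_filter, Finset.mem_product, Finset.mem_Icc] at hp ⊢
    exact ⟨Nat.mul_pos hp.1.1.1 hp.1.2.1, hp.2⟩
  have hsub : ∑ p ∈ Finset.Icc 1 K ×ˢ Finset.Icc 1 K, (f p.1 : ℂ) * (g p.2 : ℂ) * G (p.1*p.2) = 
      ∑ p ∈ (Finset.Icc 1 K ×ˢ Finset.Icc 1 K).filter (fun p : ℕ × ℕ => p.1 * p.2 ≤ K), (f p.1 : ℂ) * (g p.2 : ℂ) * G (p.1*p.2) := by
    rw [Finset.sum_filter]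
    refine Finset.sum_congr rfl fun p _ => ?_
    split_ifs with h
    · rfl
    · rw [hG _ (by omega), mul_zero]
  rw [hsub, ← Finset.sum_fiberwise_of_maps_to hmap]
  refine Finset.sum_congr rfl fun n hn => ?_
  rw [ArithmeticFunction.mul_apply, Complex.ofReal_sum, Finset.sum_mul]
  have : n.divisorsAntidiagonal = ((Finset.Icc 1 K ×ˢ Finset.Icc 1 K).filter (fun p : ℕ × ℕ => p.1 * p.2 ≤ K)).filter (fun p => p.1 * p.2 = n) := by
    ext p
    simp only [Finset.mem_filter, Finset.mem_product, Finset.mem_Icc, Nat.mem_divisorsAntidiagonal] at hn ⊢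
    constructor
    · rintro ⟨h1, h2⟩
      have hp1 : 1 ≤ p.1 := Nat.pos_of_ne_zero (by rintro h; rw [h] at h1; simp at h1; omega)
      have hp2 : 1 ≤ p.2 := Nat.pos_of_ne_zero (by rintro h; rw [h] at h1; simp at h1; omega)
      refine ⟨⟨⟨⟨hp1, ?_⟩, ⟨hp2, ?_⟩⟩, by omega⟩, h1⟩
      · nlinarith
      · nlinarith
    · rintro ⟨_, h⟩; exact ⟨h, by omega⟩
  rw [this]
  refine Finset.sum_congr rfl fun p hp => ?_
  rw [(Finset.mem_filter.1 hp).2]; push_cast; ring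

/-- Abel summation bound -/
lemma abel_bound (w : ℕ → ℝ) (z : ℕ → ℂ) (E : ℝ) (a b : ℕ) (hab : a ≤ b) (hw : ∀ n, a ≤ n → n < b → w n ≤ w (n+1)) (hw0 : 0 ≤ w a)
    (hE : ∀ j, a ≤ j → j ≤ b → ‖∑ n ∈ Finset.Ico j b, z n‖ ≤ E) :
    ‖∑ n ∈ Finset.Ico a b, (w n : ℂ) * z n‖ ≤ E * w b := by
  have key : ∀ d, ∀ j, a ≤ j → j + d = b → ‖∑ n ∈ Finset.Ico j b, (w n : ℂ) * z n - (w j : ℂ) * ∑ n ∈ Finset.Ico j b, z n‖ ≤ E * (w b - w j) := by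
    intro d
    induction d with
    | zero => intro j hj hjb; simp at hjb; subst hjb; simp
    | succ d ih =>
      intro j hj hjb
      have h1 := ih (j+1) (by omega) (by omega)
      have h2 := hE (j+1) (by omega) (by omega)
      have h3 := hw j hj (by omega)
      rw [Finset.sum_eq_sum_Ico_succ_bot (by omega), Finset.sum_eq_sum_Ico_succ_bot (by omega) z]
      have : (w j : ℂ) * z j + ∑ n ∈ Finset.Ico (j+1) b, (w n : ℂ) * z n - (w j : ℂ) * (z j + ∑ n ∈ Finset.Ico (j+1) b, z n) =
        (∑ n ∈ Finset.Ico (j+1) b, (w n : ℂ) * z n - (w (j+1) : ℂ) * ∑ n ∈ Finset.Ico (j+1) b, z n) + ((w (j+1) - w j : ℝ) : ℂ) * ∑ n ∈ Finset.Ico (j+1) b, z n := by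
        push_cast; ring
      rw [this]
      refine (norm_add_le _ _).trans ?_
      rw [norm_mul, Complex.norm_real, norm_of_nonneg (by linarith)]
      have := mul_le_mul_of_nonneg_left h2 (by linarith : 0 ≤ w (j+1) - w j)
      linarith
  have h1 := key (b - a) a le_rfl (by omega)
  have h2 := hE a le_rfl hab
  have h3 : ‖∑ n ∈ Finset.Ico a b, (w n : ℂ) * z n‖ ≤ ‖∑ n ∈ Finset.Ico a b, (w n : ℂ) * z n - (w a : ℂ) * ∑ n ∈ Finset.Ico a b, z n‖ + ‖(w a : ℂ) * ∑ n ∈ Finset.Ico a b, z n‖ := by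
    have := norm_add_le (∑ n ∈ Finset.Ico a b, (w n : ℂ) * z n - (w a : ℂ) * ∑ n ∈ Finset.Ico a b, z n) ((w a : ℂ) * ∑ n ∈ Finset.Ico a b, z n)
    simpa using this
  rw [norm_mul, Complex.norm_real, norm_of_nonneg hw0] at h3
  have := mul_le_mul_of_nonneg_left h2 hw0
  linarith

/-- Type I inner sum with monotone weight. -/
lemma typeI_inner (c : ℝ) (hc : 1 < c) (hc2 : c < 2) : ∃ C : ℝ, 0 < C ∧ ∀ x : ℝ, x ≠ 0 → ∀ X : ℝ, ∀ m : ℕ, 1 ≤ m → 8 * (m:ℝ) ≤ X → 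
    ∀ w : ℕ → ℝ, Monotone w → 0 ≤ w 0 → ∀ W : ℝ, w (⌊X/m⌋₊+1) ≤ W → 
    ‖∑ k ∈ Finset.Icc 1 ⌊X⌋₊, (w k : ℂ) * F c x X (m*k)‖ ≤ C * (√(|x| * X ^ c) + (X/m) / √(|x| * X ^ c)) * W := by
  obtain ⟨C, hC, hv⟩ := vdc c hc hc2
  refine ⟨8 * C, by positivity, ?_⟩
  intro x hx X m hm hmX w hw hw0 W hW
  have hm0 : (0:ℝ) < m := by exact_mod_cast hm
  have hx' : 0 < |x| := abs_pos.2 hx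
  have hm1 : (1:ℝ) ≤ m := by exact_mod_cast hm
  have hX : 0 < X := by linarith
  set Y := X / (8 * m) with hY
  have hY1 : 1 ≤ Y := by rw [hY, le_div_iff₀ (by positivity)]; linarith
  have hXm : X / m = 8 * Y := by rw [hY]; field_simp
  set A := x * (m:ℝ)^c with hA
  have hA0 : A ≠ 0 := mul_ne_zero hx (by positivity)
  set a := ⌊Y⌋₊ + 1 with ha
  set b := ⌊X/m⌋₊ + 1 with hb
  have hset : ∑ k ∈ Finset.Icc 1 ⌊X⌋₊, (w k : ℂ) * F c x X (m*k) = ∑ k ∈ Finset.Ico a b, (w k : ℂ) * e (A * (k:ℝ)^c) := by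
    have hs : Finset.Ico a b = (Finset.Icc 1 ⌊X⌋₊).filter (fun k : ℕ => X/8 < ((m*k : ℕ):ℝ) ∧ ((m*k:ℕ):ℝ) ≤ X) := by
      ext k
      simp only [Finset.mem_filter, Finset.mem_Icc, Finset.mem_Ico, ha, hb, Nat.lt_succ_iff, Nat.succ_le_iff]
      have a1 : X/8 < ((m*k : ℕ):ℝ) ↔ ⌊Y⌋₊ < k := by
        rw [Nat.floor_lt (by positivity), hY, div_lt_iff₀ (by norm_num), div_lt_iff₀ (by positivity : (0:ℝ) < 8 * m)]; push_cast
        rw [show (m:ℝ) * k * 8 = k * (8 * m) by ring]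
      have a3 : ((m*k : ℕ):ℝ) ≤ X ↔ k ≤ ⌊X/m⌋₊ := by 
        rw [Nat.le_floor_iff (by positivity), le_div_iff₀ hm0]; push_cast; rw [mul_comm]
      rw [a1, a3]
      have : ⌊X/m⌋₊ ≤ ⌊X⌋₊ := Nat.floor_le_floor (div_le_self hX.le hm1)
      omega
    rw [hs, Finset.sum_filter]
    refine Finset.sum_congr rfl fun k _ => ?_
    unfold F
    split_ifs with h
    · congr 2; rw [hA]; push_cast; rw [mul_rpow (by positivity) (by positivity)]; ring
    · simp
  rw [hset]
  have hab : a ≤ b := by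
    rw [ha, hb, hXm]; gcongr; linarith
  have hYa : Y ≤ a := by rw [ha]; push_cast; exact (Nat.lt_floor_add_one Y).le
  have hbY : (b:ℝ) ≤ 17 * Y := by
    rw [hb]; push_cast
    have := Nat.floor_le (show 0 ≤ X/m by positivity)
    linarith
  have hw0' : ∀ n, 0 ≤ w n := fun n => hw0.trans (hw (Nat.zero_le n))
  set T := |x| * X ^ c with hT
  have hT0 : 0 < T := by positivity
  have h8 : (8:ℝ)^c ≤ 64 := by
    calc (8:ℝ) ^ c ≤ 8 ^ (2:ℝ) := rpow_le_rpow_of_exponent_le (by norm_num) hc2.le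
      _ = 64 := by norm_num
  have h8' : (1:ℝ) ≤ 8^c := one_le_rpow (by norm_num) (by linarith)
  have hAY : |A| * Y ^ c = T / 8^c := by
    rw [hA, hY, abs_mul, abs_of_nonneg (by positivity : (0:ℝ) ≤ (m:ℝ)^c), div_rpow hX.le (by positivity), mul_rpow (by norm_num) hm0.le, hT]
    field_simp
  have hE : ∀ j, a ≤ j → j ≤ b → ‖∑ n ∈ Finset.Ico j b, e (A * (n:ℝ)^c)‖ ≤ 8 * C * (√T + (X/m)/√T) := by
    intro j hj _
    have := hv A hA0 Y hY1 j b (hYa.trans (by exact_mod_cast hj)) hbY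
    refine this.trans ?_
    rw [hAY, hXm]
    have s1 : √(T/8^c) ≤ √T := sqrt_le_sqrt (div_le_self hT0.le h8')
    have s2 : √T / 8 ≤ √(T/8^c) := by
      rw [show √T/8 = √(T/64) by rw [sqrt_div' T (by norm_num : (0:ℝ) ≤ 64), show (64:ℝ) = 8^2 by norm_num, sqrt_sq (by norm_num : (0:ℝ) ≤ 8)]]
      exact sqrt_le_sqrt (by gcongr)
    have sT : 0 < √T := sqrt_pos.2 hT0
    have s3 : Y / √(T/8^c) ≤ 8 * (Y / √T) := by
      calc Y / √(T/8^c) ≤ Y / (√T/8) := by gcongr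
        _ = 8 * (Y / √T) := by field_simp
    have s4 : 0 ≤ Y / √T := by positivity
    calc C * (√(T/8^c) + Y / √(T/8^c)) ≤ C * (√T + 8 * (Y / √T)) := by gcongr
      _ ≤ C * (8 * √T + 8 * (8 * Y / √T)) := by
        have : 8 * Y / √T = 8 * (Y / √T) := by ring
        rw [this]; gcongr <;> linarith
      _ = _ := by ring
  refine (abel_bound w _ _ a b hab (fun n _ _ => hw (Nat.le_succ n)) (hw0' a) hE).trans ?_
  gcongr
end BK
end

section
open Real MeasureTheory
namespace BK

/-- savings factor -/
noncomputable def sv (X T : ℝ) : ℝ := X ^ (-(1/40) : ℝ) + T ^ (-(1/4) : ℝ)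

lemma sv_pos (X T : ℝ) (hX : 0 < X) (hT : 0 < T) : 0 < sv X T := by unfold sv; positivity

lemma typeI (c : ℝ) (hc : 1 < c) (hc2 : c < 2) : ∃ C : ℝ, 0 < C ∧ ∀ x : ℝ, x ≠ 0 → ∀ X : ℝ, 16 ≤ X → 
    1 ≤ |x| * X ^ c → |x| * X ^ c ≤ X ^ (5/4 : ℝ) → 
    ∀ a w : ℕ → ℝ, ∀ D W : ℝ, (∀ m, |a m| ≤ D) → (∀ m : ℕ, X ^ (1/8 : ℝ) < m → a m = 0) → Monotone w → 0 ≤ w 0 → 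
    (∀ n : ℕ, (n:ℝ) ≤ 2 * X → w n ≤ W) → 
    ‖∑ m ∈ Finset.Icc 1 ⌊X⌋₊, ∑ k ∈ Finset.Icc 1 ⌊X⌋₊, (a m : ℂ) * (w k : ℂ) * F c x X (m*k)‖ ≤ 
      C * D * W * (X * log X * sv X (|x| * X ^ c)) := by
  obtain ⟨C, hC, hv⟩ := typeI_inner c hc hc2
  refine ⟨2 * C, by positivity, ?_⟩
  intro x hx X hX hT1 hT2 a w D W ha ha0 hw hw0 hW
  set T := |x| * X ^ c with hT
  have hX0 : 0 < X := by linarith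
  have hX1 : 1 ≤ X := by linarith
  have hD : 0 ≤ D := (abs_nonneg _).trans (ha 0)
  have hT0 : 0 < T := by linarith
  have hW0 : 0 ≤ W := (hw0.trans (hw (Nat.zero_le 0))).trans (hW 0 (by push_cast; linarith))
  have hlog : 2 ≤ log X := by
    have : log 16 ≤ log X := log_le_log (by norm_num) hX
    have h16 : log 16 = 4 * log 2 := by rw [show (16:ℝ) = 2^(4:ℕ) by norm_num, log_pow]; norm_num
    have := log_two_gt_d9
    linarith
  have hinner : ∀ m ∈ Finset.Icc 1 ⌊X⌋₊, ‖∑ k ∈ Finset.Icc 1 ⌊X⌋₊, (a m : ℂ) * (w k : ℂ) * F c x X (m*k)‖ ≤ 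
      (if (m:ℝ) ≤ X ^ (1/8:ℝ) then D * (C * √T * W) else 0) + D * (C * W * X / √T) * (m:ℝ)⁻¹ := by
    intro m hm
    rw [Finset.mem_Icc] at hm
    have hm0 : (0:ℝ) < m := by exact_mod_cast hm.1
    have hm1 : (1:ℝ) ≤ m := by exact_mod_cast hm.1
    split_ifs with h
    · simp_rw [mul_assoc]
      rw [← Finset.mul_sum, norm_mul, Complex.norm_real, norm_eq_abs]
      have h8 : X ^ (1/8:ℝ) * 8 ≤ X := by
        have e1 : X = X ^ (1/8:ℝ) * X^(7/8:ℝ) := by rw [← rpow_add hX0]; norm_num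
        have e2 : (8:ℝ) ≤ X ^ (7/8:ℝ) := by
          calc (8:ℝ) = 16 ^ (3/4:ℝ) := by 
                rw [show (16:ℝ) = 2^(4:ℝ) by norm_num, ← rpow_mul (by norm_num)]; norm_num
            _ ≤ 16 ^ (7/8:ℝ) := rpow_le_rpow_of_exponent_le (by norm_num) (by norm_num)
            _ ≤ _ := rpow_le_rpow (by norm_num) hX (by norm_num)
        calc X ^ (1/8:ℝ) * 8 ≤ X ^ (1/8:ℝ) * X^(7/8:ℝ) := by gcongr
          _ = X := e1.symm
      have hb := hv x hx X m hm.1 (by linarith) w hw hw0 W (hW _ (by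
        push_cast
        have h1 := Nat.floor_le (show 0 ≤ X/m by positivity)
        have h2 : X/m ≤ X := div_le_self hX0.le hm1
        linarith))
      calc _ ≤ D * (C * (√T + (X/m) / √T) * W) := by gcongr; exact ha m
        _ = _ := by ring
    · rw [ha0 m (by linarith)]
      simp
      positivity
  refine (norm_sum_le _ _).trans ((Finset.sum_le_sum hinner).trans ?_)
  rw [Finset.sum_add_distrib, ← Finset.mul_sum, ← Finset.sum_filter, Finset.sum_const, nsmul_eq_mul]
  have hcard : (((Finset.Icc 1 ⌊X⌋₊).filter (fun m : ℕ => (m:ℝ) ≤ X ^ (1/8:ℝ))).card : ℝ) ≤ X ^ (1/8:ℝ) := by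
    have : (Finset.Icc 1 ⌊X⌋₊).filter (fun m : ℕ => (m:ℝ) ≤ X ^ (1/8:ℝ)) ⊆ Finset.Icc 1 ⌊X ^ (1/8:ℝ)⌋₊ := by
      intro m hm
      rw [Finset.mem_filter, Finset.mem_Icc] at hm
      rw [Finset.mem_Icc]
      exact ⟨hm.1.1, Nat.le_floor hm.2⟩
    have h1 := Finset.card_le_card this
    rw [Nat.card_Icc, Nat.add_sub_cancel] at h1
    calc _ ≤ (⌊X ^ (1/8:ℝ)⌋₊:ℝ) := by exact_mod_cast h1
      _ ≤ _ := Nat.floor_le (by positivity)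
  have hharm : ∑ m ∈ Finset.Icc 1 ⌊X⌋₊, (m:ℝ)⁻¹ ≤ 1 + log X := by
    have := harmonic_floor_le_one_add_log X hX1
    rw [harmonic_eq_sum_Icc] at this
    push_cast at this
    exact this
  have hsT : √T ≤ X ^ (5/8:ℝ) := by
    rw [sqrt_eq_rpow]
    calc T ^ (1/2:ℝ) ≤ (X ^ (5/4:ℝ)) ^ (1/2:ℝ) := rpow_le_rpow hT0.le hT2 (by norm_num)
      _ = _ := by rw [← rpow_mul hX0.le]; norm_num
  have hx1 : X ^ (1/8:ℝ) * X ^ (5/8:ℝ) ≤ X * X ^ (-(1/40):ℝ) := by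
    rw [← rpow_add hX0]; nth_rw 2 [← rpow_one X]; rw [← rpow_add hX0]
    exact rpow_le_rpow_of_exponent_le hX1 (by norm_num)
  have hx2 : 1 / √T ≤ T ^ (-(1/4):ℝ) := by
    rw [sqrt_eq_rpow, one_div, ← rpow_neg hT0.le]
    exact rpow_le_rpow_of_exponent_le hT1 (by norm_num)
  calc _ ≤ X ^ (1/8:ℝ) * (D * (C * X ^ (5/8:ℝ) * W)) + D * (C * W * X / √T) * (1 + log X) := by gcongr
    _ = C * D * W * (X ^ (1/8:ℝ) * X ^ (5/8:ℝ) + X * (1 + log X) * (1/√T)) := by ring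
    _ ≤ C * D * W * (2 * (X * log X * X ^ (-(1/40):ℝ)) + X * (2 * log X) * T ^ (-(1/4):ℝ)) := by
        have p1 : 0 ≤ X * X ^ (-(1/40):ℝ) := by positivity
        have q1 : X ^ (1/8:ℝ) * X ^ (5/8:ℝ) ≤ 2 * (X * log X * X ^ (-(1/40):ℝ)) := by nlinarith
        have q2 : X * (1 + log X) * (1/√T) ≤ X * (2 * log X) * T ^ (-(1/4):ℝ) := by
          gcongr; linarith
        have : 0 ≤ C * D * W := by positivity
        exact mul_le_mul_of_nonneg_left (add_le_add q1 q2) this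
    _ = _ := by unfold sv; ring

lemma block_bound (c : ℝ) (hc : 1 < c) (hc2 : c < 2) : ∃ C : ℝ, 0 < C ∧ ∀ x : ℝ, x ≠ 0 → ∀ X : ℝ, (32:ℝ)^(80:ℝ) ≤ X → 
    1 ≤ |x| * X ^ c → |x| * X ^ c ≤ X ^ (5/4 : ℝ) → ∀ M N : ℝ, 
    N ≤ M → X^(1/16:ℝ) ≤ 32 * N → M * N = X / 16 → ∀ α β : ℕ → ℝ, ∀ D1 D2 : ℝ, (∀ m, |α m| ≤ D1) → (∀ k, |β k| ≤ D2) →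
    ‖∑ m ∈ Finset.Icc ⌈M⌉₊ ⌊16*M⌋₊, ∑ k ∈ Finset.Icc ⌈N⌉₊ ⌊16*N⌋₊, (α m : ℂ) * (β k : ℂ) * ph c x X m k‖ ≤
     C * (D1 * D2) * (X * sv X (|x| * X ^ c)) := by
  obtain ⟨C, hC, hb⟩ := bilinear c hc hc2
  refine ⟨√(C * 66), by positivity, ?_⟩
  intro x hx X hX hT1 hT2 M N hNM hN hMN α β D1 D2 hα hβ
  have hb2 := hb x hx X M N
  set T := |x| * X ^ c with hT
  have hT0 : 0 < T := by linarith
  have h32 : (1:ℝ) ≤ (32:ℝ)^(80:ℝ) := one_le_rpow (by norm_num) (by norm_num)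
  have hX1 : 1 ≤ X := h32.trans hX
  have hX0 : 0 < X := by linarith
  have hX80 : 32 ≤ X ^ (1/80:ℝ) := by
    calc (32:ℝ) = ((32:ℝ)^(80:ℝ))^(1/80:ℝ) := by rw [← rpow_mul (by norm_num)]; norm_num
      _ ≤ _ := rpow_le_rpow (by positivity) hX (by norm_num)
  have hX20 : X ^ (1/20:ℝ) * 32 ≤ X ^ (1/16:ℝ) := by
    calc X ^ (1/20:ℝ) * 32 ≤ X ^ (1/20:ℝ) * X ^ (1/80:ℝ) := by gcongr
      _ = _ := by rw [← rpow_add hX0]; norm_num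
  have hX20' : 1 ≤ X ^ (1/20:ℝ) := one_le_rpow hX1 (by norm_num)
  have hN20 : X ^ (1/20:ℝ) ≤ N := by linarith
  have hN1 : 1 ≤ N := hX20'.trans hN20
  have hN0 : 0 < N := by linarith
  have hM1 : 1 ≤ M := hN1.trans hNM
  have hD1 : 0 ≤ D1 := (abs_nonneg _).trans (hα 0)
  have hD2 : 0 ≤ D2 := (abs_nonneg _).trans (hβ 0)
  have hNX : N ≤ X ^ (1/2:ℝ) := by
    rw [← sqrt_eq_rpow]; apply le_sqrt_of_sq_le; nlinarith
  have hsT : T ^ (-(1/2):ℝ) = 1 / √T := by rw [sqrt_eq_rpow, rpow_neg hT0.le, ← one_div]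
  -- key: a Q with good bound
  have key : ∃ Q : ℕ, 1 ≤ Q ∧ (Q:ℝ) ≤ N ∧ X^2/Q + X * √(T * Q * N) + X^2 * √(N/(T * Q)) ≤ 66 * X^2 * (X ^ (-(1/20):ℝ) + T ^ (-(1/2):ℝ)) := by
    have hhalf : ∀ y : ℝ, 1 ≤ y → y / 2 ≤ (⌊y⌋₊:ℝ) := by
      intro y hy
      have h1 := Nat.lt_floor_add_one y
      have h2 : (1:ℝ) ≤ (⌊y⌋₊:ℝ) := by exact_mod_cast Nat.one_le_floor_iff y |>.2 hy
      linarith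
    by_cases hcase : T ≤ X ^ (3/4:ℝ)
    · refine ⟨⌊N⌋₊, Nat.one_le_floor_iff N |>.2 hN1, Nat.floor_le hN0.le, ?_⟩
      have hq := hhalf N hN1
      set Q : ℝ := (⌊N⌋₊:ℝ) with hQ
      have hQN : Q ≤ N := Nat.floor_le hN0.le
      have hQ0 : 0 < Q := by linarith
      have a1 : X^2/Q ≤ 64 * X^2 * X ^ (-(1/20):ℝ) := by
        calc X^2/Q ≤ X^2/(N/2) := by gcongr
          _ ≤ X^2/(X^(1/20:ℝ)/2) := by gcongr
          _ = 2 * X^2 * X ^ (-(1/20):ℝ) := by rw [rpow_neg hX0.le]; field_simp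
          _ ≤ _ := by gcongr; norm_num
      have a2 : X * √(T * Q * N) ≤ X^2 * X ^ (-(1/20):ℝ) := by
        have : √(T * Q * N) ≤ X ^ (7/8:ℝ) := by
          calc √(T * Q * N) ≤ √(X ^ (3/4:ℝ) * X ^ (1/2:ℝ) * X ^ (1/2:ℝ)) := by
                apply sqrt_le_sqrt; gcongr; exact hQN.trans hNX
            _ = X ^ (7/8:ℝ) := by rw [← rpow_add hX0, ← rpow_add hX0, sqrt_eq_rpow, ← rpow_mul hX0.le]; norm_num
        calc X * √(T * Q * N) ≤ X * X ^ (7/8:ℝ) := by gcongr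
          _ ≤ X * X ^ (1 + -(1/20):ℝ) := by gcongr ?_ * ?_; exact rpow_le_rpow_of_exponent_le hX1 (by norm_num)
          _ = _ := by rw [rpow_add hX0, rpow_one]; ring
      have a3 : X^2 * √(N/(T * Q)) ≤ 2 * X^2 * T ^ (-(1/2):ℝ) := by
        have : √(N/(T * Q)) ≤ 2 * (1/√T) := by
          calc √(N/(T * Q)) ≤ √(4 * (1/T)) := by
                apply sqrt_le_sqrt
                rw [div_le_iff₀ (by positivity)]
                have : 4 * (1/T) * (T * Q) = 4 * Q := by field_simp
                rw [this]; linarith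
            _ = _ := by
              rw [sqrt_mul (by norm_num), show (4:ℝ) = 2^2 by norm_num, sqrt_sq (by norm_num), sqrt_div (by norm_num), sqrt_one]
        rw [hsT]
        calc X^2 * √(N/(T * Q)) ≤ X^2 * (2 * (1/√T)) := by gcongr
          _ = _ := by ring
      have : 0 ≤ X^2 * T ^ (-(1/2):ℝ) := by positivity
      have : 0 ≤ X^2 * X ^ (-(1/20):ℝ) := by positivity
      linarith
    · push Not at hcase
      refine ⟨⌊X^(1/20:ℝ)⌋₊, Nat.one_le_floor_iff _ |>.2 hX20', (Nat.floor_le (by positivity)).trans hN20, ?_⟩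
      have hq := hhalf _ hX20'
      have hQ1 : (1:ℝ) ≤ (⌊X^(1/20:ℝ)⌋₊:ℝ) := by exact_mod_cast Nat.one_le_floor_iff _ |>.2 hX20'
      have hQu : (⌊X^(1/20:ℝ)⌋₊:ℝ) ≤ X^(1/20:ℝ) := Nat.floor_le (by positivity)
      set Q : ℝ := (⌊X^(1/20:ℝ)⌋₊:ℝ) with hQ
      have hQ0 : 0 < Q := by linarith
      have a1 : X^2/Q ≤ 2 * X^2 * X ^ (-(1/20):ℝ) := by
        calc X^2/Q ≤ X^2/(X^(1/20:ℝ)/2) := by gcongr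
          _ = 2 * X^2 * X ^ (-(1/20):ℝ) := by rw [rpow_neg hX0.le]; field_simp
      have a2 : X * √(T * Q * N) ≤ X^2 * X ^ (-(1/20):ℝ) := by
        have : √(T * Q * N) ≤ X ^ (9/10:ℝ) := by
          calc √(T * Q * N) ≤ √(X ^ (5/4:ℝ) * X ^ (1/20:ℝ) * X ^ (1/2:ℝ)) := by
                apply sqrt_le_sqrt; gcongr
            _ = X ^ (9/10:ℝ) := by rw [← rpow_add hX0, ← rpow_add hX0, sqrt_eq_rpow, ← rpow_mul hX0.le]; norm_num
        calc X * √(T * Q * N) ≤ X * X ^ (9/10:ℝ) := by gcongr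
          _ ≤ X * X ^ (1 + -(1/20):ℝ) := by gcongr ?_ * ?_; exact rpow_le_rpow_of_exponent_le hX1 (by norm_num)
          _ = _ := by rw [rpow_add hX0, rpow_one]; ring
      have a3 : X^2 * √(N/(T * Q)) ≤ X^2 * X ^ (-(1/20):ℝ) := by
        gcongr
        calc √(N/(T * Q)) ≤ √(X ^ (1/2:ℝ) / (X ^ (3/4:ℝ) * 1)) := by
              apply sqrt_le_sqrt; gcongr
          _ = X ^ (-(1/8):ℝ) := by rw [mul_one, ← rpow_sub hX0, sqrt_eq_rpow, ← rpow_mul hX0.le]; norm_num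
          _ ≤ _ := rpow_le_rpow_of_exponent_le hX1 (by norm_num)
      have : 0 ≤ X^2 * T ^ (-(1/2):ℝ) := by positivity
      have : 0 ≤ X^2 * X ^ (-(1/20):ℝ) := by positivity
      linarith
  obtain ⟨Q, hQ1, hQN, hQb⟩ := key
  have hmain := hb2 hM1 hN1 hMN Q hQ1 hQN α β D1 D2 hα hβ
  apply le_of_sq_le_sq _ (by have := sv_pos X T hX0 hT0; positivity)
  refine hmain.trans ?_
  have hsq : X ^ (-(1/20):ℝ) + T ^ (-(1/2):ℝ) ≤ sv X T ^2 := by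
    unfold sv
    have e1 : X ^ (-(1/20):ℝ) = (X ^ (-(1/40):ℝ))^2 := by rw [← rpow_natCast, ← rpow_mul hX0.le]; norm_num
    have e2 : T ^ (-(1/2):ℝ) = (T ^ (-(1/4):ℝ))^2 := by rw [← rpow_natCast, ← rpow_mul hT0.le]; norm_num
    rw [e1, e2]
    have : 0 ≤ X ^ (-(1/40):ℝ) * T ^ (-(1/4):ℝ) := by positivity
    nlinarith
  calc C * (D1 * D2)^2 * _ ≤ C * (D1 * D2)^2 * (66 * X^2 * (X ^ (-(1/20):ℝ) + T ^ (-(1/2):ℝ))) := by gcongr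
    _ ≤ C * (D1 * D2)^2 * (66 * X^2 * sv X T ^2) := by gcongr
    _ = (√(C * 66))^2 * (D1 * D2)^2 * (X^2 * sv X T ^2) := by rw [sq_sqrt (by positivity)]; ring
    _ = _ := by ring
end BK
end

section
open Real MeasureTheory
namespace BK

lemma F_ne (c x X : ℝ) (n : ℕ) (h : F c x X n ≠ 0) : X/8 < (n:ℝ) ∧ (n:ℝ) ≤ X := by
  unfold F at h; by_contra h2; rw [if_neg h2] at h; exact h rfl

lemma dyadic_block (c x X : ℝ) (hX : 0 < X) (j : ℕ) (α β : ℕ → ℝ) : 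
    ∑ m ∈ (Finset.Icc 1 ⌊X⌋₊).filter (fun m => Nat.log 2 m = j), ∑ k ∈ Finset.Icc 1 ⌊X⌋₊, (α m : ℂ) * (β k : ℂ) * F c x X (m*k) = 
    ∑ m ∈ Finset.Icc ⌈(2:ℝ)^j⌉₊ ⌊16*(2:ℝ)^j⌋₊, ∑ k ∈ Finset.Icc ⌈X/(16*(2:ℝ)^j)⌉₊ ⌊16*(X/(16*(2:ℝ)^j))⌋₊, 
      ((if Nat.log 2 m = j then α m else 0 : ℝ) : ℂ) * (β k : ℂ) * ph c x X m k := by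
  have hM0 : (0:ℝ) < (2:ℝ)^j := by positivity
  have hmr : ∀ m : ℕ, 1 ≤ m → Nat.log 2 m = j → (2:ℝ)^j ≤ m ∧ (m:ℝ) < 2 * 2^j := by
    intro m hm hj
    have h1 := Nat.pow_log_le_self 2 (show m ≠ 0 by omega)
    have h2 := Nat.lt_pow_succ_log_self (b := 2) (by norm_num) m
    rw [hj] at h1 h2
    refine ⟨by exact_mod_cast h1, ?_⟩
    have : (m:ℝ) < ((2^(j+1) : ℕ):ℝ) := by exact_mod_cast h2
    push_cast at this; rw [pow_succ] at this; linarith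
  have hinner : ∀ m : ℕ, 1 ≤ m → Nat.log 2 m = j → ∀ k : ℕ, 1 ≤ k → F c x X (m*k) ≠ 0 → 
      X/(16*(2:ℝ)^j) ≤ k ∧ (k:ℝ) ≤ 16*(X/(16*(2:ℝ)^j)) ∧ (k:ℝ) ≤ X ∧ (m:ℝ) ≤ X := by
    intro m hm hj k hk hF
    obtain ⟨h1, h2⟩ := hmr m hm hj
    obtain ⟨h3, h4⟩ := F_ne _ _ _ _ hF
    push_cast at h3 h4
    have hk1 : (1:ℝ) ≤ k := by exact_mod_cast hk
    have hm1 : (1:ℝ) ≤ m := by exact_mod_cast hm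
    refine ⟨?_, ?_, by nlinarith, by nlinarith⟩
    · rw [div_le_iff₀ (by positivity)]; nlinarith
    · rw [show 16*(X/(16*(2:ℝ)^j)) = X/2^j by field_simp, le_div_iff₀ hM0]; nlinarith
  refine Finset.sum_congr_of_eq_on_inter ?_ ?_ ?_
  · intro m hm hm'
    exfalso; apply hm'
    rw [Finset.mem_filter, Finset.mem_Icc] at hm
    obtain ⟨h1, h2⟩ := hmr m hm.1.1 hm.2
    rw [Finset.mem_Icc]
    exact ⟨Nat.ceil_le.2 h1, Nat.le_floor (by linarith)⟩
  · intro m hm hm'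
    rw [Finset.mem_Icc] at hm
    have hm1 : 1 ≤ m := le_trans (Nat.one_le_ceil_iff.2 hM0) hm.1
    refine Finset.sum_eq_zero fun k hk => ?_
    split_ifs with hj
    · rw [Finset.mem_Icc] at hk
      have hk1 : 1 ≤ k := le_trans (Nat.one_le_ceil_iff.2 (by positivity)) hk.1
      rw [ph_eq]
      by_cases hF : F c x X (m*k) = 0
      · rw [hF, mul_zero]
      · exfalso; apply hm'
        rw [Finset.mem_filter, Finset.mem_Icc]
        exact ⟨⟨hm1, Nat.le_floor (hinner m hm1 hj k hk1 hF).2.2.2⟩, hj⟩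
    · simp
  · intro m hm _
    rw [Finset.mem_filter, Finset.mem_Icc] at hm
    rw [if_pos hm.2]
    refine Finset.sum_congr_of_eq_on_inter ?_ ?_ ?_
    · intro k hk hk'
      rw [Finset.mem_Icc] at hk
      by_cases hF : F c x X (m*k) = 0
      · rw [hF, mul_zero]
      · exfalso; apply hk'
        have := hinner m hm.1.1 hm.2 k hk.1 hF
        rw [Finset.mem_Icc]
        exact ⟨Nat.ceil_le.2 this.1, Nat.le_floor this.2.1⟩
    · intro k hk hk'
      rw [Finset.mem_Icc] at hk
      have hk1 : 1 ≤ k := le_trans (Nat.one_le_ceil_iff.2 (by positivity)) hk.1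
      rw [ph_eq]
      by_cases hF : F c x X (m*k) = 0
      · rw [hF, mul_zero]
      · exfalso; apply hk'
        rw [Finset.mem_Icc]
        exact ⟨hk1, Nat.le_floor (hinner m hm.1.1 hm.2 k hk1 hF).2.2.1⟩
    · intro k _ _
      rw [ph_eq]

lemma typeII (c : ℝ) (hc : 1 < c) (hc2 : c < 2) : ∃ C : ℝ, 0 < C ∧ ∀ x : ℝ, x ≠ 0 → ∀ X : ℝ, (32:ℝ)^(80:ℝ) ≤ X → 
    1 ≤ |x| * X ^ c → |x| * X ^ c ≤ X ^ (5/4 : ℝ) → ∀ α β : ℕ → ℝ, ∀ D1 D2 : ℝ, (∀ m, |α m| ≤ D1) → (∀ k, k ≤ ⌊X⌋₊ → |β k| ≤ D2) →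
    (∀ m : ℕ, (m:ℝ) ≤ X ^ (1/16:ℝ) → α m = 0) → (∀ m : ℕ, (m:ℝ) ≤ X ^ (1/16:ℝ) → β m = 0) →
    ‖∑ m ∈ Finset.Icc 1 ⌊X⌋₊, ∑ k ∈ Finset.Icc 1 ⌊X⌋₊, (α m : ℂ) * (β k : ℂ) * F c x X (m*k)‖ ≤
     C * (D1 * D2) * (X * log X * sv X (|x| * X ^ c)) := by
  obtain ⟨C, hC, hb⟩ := block_bound c hc hc2
  refine ⟨3 * C, by positivity, ?_⟩
  intro x hx X hX hT1 hT2 α β' D1 D2 hα hβ' hα0 hβ0'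
  set T := |x| * X ^ c with hT
  have hT0 : 0 < T := by linarith
  have h32 : (32:ℝ) ≤ (32:ℝ)^(80:ℝ) := by
    nth_rw 1 [← rpow_one (32:ℝ)]; exact rpow_le_rpow_of_exponent_le (by norm_num) (by norm_num)
  have hX32 : 32 ≤ X := h32.trans hX
  have hX0 : 0 < X := by linarith
  have hX1 : 1 ≤ X := by linarith
  have hsv := sv_pos X T hX0 hT0
  have hD1 : 0 ≤ D1 := (abs_nonneg _).trans (hα 0)
  have hD2 : 0 ≤ D2 := (abs_nonneg _).trans (hβ' 0 (Nat.zero_le _))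
  -- replace the sequence by its restriction
  set β : ℕ → ℝ := fun k => if k ≤ ⌊X⌋₊ then β' k else 0 with hβdef
  have hβ : ∀ k, |β k| ≤ D2 := by
    intro k; simp only [hβdef]; split_ifs with h
    · exact hβ' k h
    · simpa using hD2
  have hβ0 : ∀ m : ℕ, (m:ℝ) ≤ X ^ (1/16:ℝ) → β m = 0 := by
    intro m hm; simp only [hβdef, hβ0' m hm, ite_self]
  have hrepl : ∑ m ∈ Finset.Icc 1 ⌊X⌋₊, ∑ k ∈ Finset.Icc 1 ⌊X⌋₊, (α m : ℂ) * (β' k : ℂ) * F c x X (m*k) = 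
     ∑ m ∈ Finset.Icc 1 ⌊X⌋₊, ∑ k ∈ Finset.Icc 1 ⌊X⌋₊, (α m : ℂ) * (β k : ℂ) * F c x X (m*k) := by
    refine Finset.sum_congr rfl fun m _ => Finset.sum_congr rfl fun k hk => ?_
    simp only [hβdef]; rw [if_pos (Finset.mem_Icc.1 hk).2]
  rw [hrepl]
  have hmap : ∀ m ∈ Finset.Icc 1 ⌊X⌋₊, Nat.log 2 m ∈ Finset.range (Nat.log 2 ⌊X⌋₊ + 1) := by
    intro m hm
    rw [Finset.mem_range, Nat.lt_succ_iff]
    exact Nat.log_mono_right (Finset.mem_Icc.1 hm).2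
  rw [← Finset.sum_fiberwise_of_maps_to hmap]
  have hblk : ∀ j ∈ Finset.range (Nat.log 2 ⌊X⌋₊ + 1), ‖∑ m ∈ (Finset.Icc 1 ⌊X⌋₊).filter (fun m => Nat.log 2 m = j), ∑ k ∈ Finset.Icc 1 ⌊X⌋₊, (α m : ℂ) * (β k : ℂ) * F c x X (m*k)‖ ≤ 
      C * (D1 * D2) * (X * sv X T) := by
    intro j _
    rw [dyadic_block c x X hX0 j α β]
    set M : ℝ := (2:ℝ)^j with hM
    set N : ℝ := X/(16*M) with hN
    have hM0 : 0 < M := by positivity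
    set α' : ℕ → ℝ := fun m => if Nat.log 2 m = j then α m else 0 with hα'
    have hα'b : ∀ m, |α' m| ≤ D1 := by
      intro m; simp only [hα']; split_ifs
      · exact hα m
      · simpa using hD1
    have hMN : M * N = X / 16 := by rw [hN]; field_simp
    change ‖∑ m ∈ Finset.Icc ⌈M⌉₊ ⌊16*M⌋₊, ∑ k ∈ Finset.Icc ⌈N⌉₊ ⌊16*N⌋₊, (α' m : ℂ) * (β k : ℂ) * ph c x X m k‖ ≤ _
    have hnn : 0 ≤ C * (D1 * D2) * (X * sv X T) := by positivity
    by_cases c1 : X ^ (1/16:ℝ) ≤ 32 * M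
    · by_cases c2 : X ^ (1/16:ℝ) ≤ 32 * N
      · rcases le_total N M with h | h
        · exact hb x hx X hX hT1 hT2 M N h c2 hMN α' β D1 D2 hα'b hβ
        · have := hb x hx X hX hT1 hT2 N M h c1 (by rw [mul_comm]; exact hMN) β α' D2 D1 hβ hα'b
          rw [Finset.sum_comm] at this
          rw [mul_comm D1 D2]
          convert this using 5 with m _ k _
          · ring
          · rw [ph_eq, ph_eq, mul_comm m k]
      · refine le_trans (le_of_eq ?_) hnn
        rw [norm_eq_zero]
        refine Finset.sum_eq_zero fun m hm => Finset.sum_eq_zero fun k hk => ?_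
        rw [hβ0 k, Complex.ofReal_zero, mul_zero, zero_mul]
        push Not at c2
        have := (Nat.le_floor_iff (by positivity)).1 (Finset.mem_Icc.1 hk).2
        have : 0 < N := by positivity
        linarith
    · refine le_trans (le_of_eq ?_) hnn
      rw [norm_eq_zero]
      refine Finset.sum_eq_zero fun m hm => Finset.sum_eq_zero fun k hk => ?_
      have : α' m = 0 := by
        simp only [hα']; split_ifs with hj
        · apply hα0
          push Not at c1
          have := (Nat.le_floor_iff (by positivity)).1 (Finset.mem_Icc.1 hm).2
          linarith
        · rfl
      rw [this, Complex.ofReal_zero, zero_mul, zero_mul]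
  refine (norm_sum_le _ _).trans ((Finset.sum_le_sum hblk).trans ?_)
  rw [Finset.sum_const, Finset.card_range, nsmul_eq_mul]
  have hlog2 : ((Nat.log 2 ⌊X⌋₊ + 1 : ℕ):ℝ) ≤ 3 * log X := by
    have h1 : ((Nat.log 2 ⌊X⌋₊ : ℕ):ℝ) ≤ log X / log 2 := by
      rw [le_div_iff₀ (log_pos (by norm_num)), ← log_pow]
      apply log_le_log (by positivity)
      have := Nat.pow_log_le_self 2 (show ⌊X⌋₊ ≠ 0 from (Nat.floor_pos.2 hX1).ne')
      calc (2:ℝ)^(Nat.log 2 ⌊X⌋₊) ≤ (⌊X⌋₊:ℝ) := by exact_mod_cast this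
        _ ≤ X := Nat.floor_le hX0.le
    have h2 := log_two_gt_d9
    have hl : log 32 ≤ log X := log_le_log (by norm_num) hX32
    have h16 : log 32 = 5 * log 2 := by rw [show (32:ℝ) = 2^(5:ℕ) by norm_num, log_pow]; norm_num
    have h3 : log X / log 2 ≤ 2 * log X := by
      rw [div_le_iff₀ (by linarith)]; nlinarith
    push_cast; linarith
  calc _ ≤ (3 * log X) * (C * (D1 * D2) * (X * sv X T)) := by gcongr
    _ = _ := by ring

lemma abs_muR (n : ℕ) : |muR n| ≤ 1 := by
  unfold muR
  rw [ArithmeticFunction.intCoe_apply]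
  have := ArithmeticFunction.abs_moebius_le_one (n := n)
  exact_mod_cast this

lemma LamR_nonneg (n : ℕ) : 0 ≤ LamR n := ArithmeticFunction.vonMangoldt_nonneg

lemma conv_log (n : ℕ) : ∑ d ∈ n.divisorsAntidiagonal, LamR d.2 = log n := by
  rw [← ArithmeticFunction.vonMangoldt_sum, Nat.sum_divisorsAntidiagonal' (f := fun _ b => LamR b)]
  rfl

lemma conv_log' (n : ℕ) : ∑ d ∈ n.divisorsAntidiagonal, LamR d.1 = log n := by
  rw [← ArithmeticFunction.vonMangoldt_sum, Nat.sum_divisorsAntidiagonal (f := fun a _ => LamR a)]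
  rfl

lemma abs_trunc_le (f : ArithmeticFunction ℝ) (U : ℝ) (n : ℕ) : |trunc f U n| ≤ |f n| := by
  rw [trunc_apply]; split_ifs <;> simp

lemma abs_sub_trunc_le (f : ArithmeticFunction ℝ) (U : ℝ) (n : ℕ) : |(f - trunc f U) n| ≤ |f n| := by
  rw [show (f - trunc f U) n = f n - trunc f U n from rfl, trunc_apply]; split_ifs <;> simp

lemma sub_trunc_zero (f : ArithmeticFunction ℝ) (U : ℝ) (n : ℕ) (h : (n:ℝ) ≤ U) : (f - trunc f U) n = 0 := by
  rw [show (f - trunc f U) n = f n - trunc f U n from rfl, trunc_apply, if_pos h, sub_self]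

lemma zR_apply (n : ℕ) : zR n = if n = 0 then 0 else 1 := by
  unfold zR; rw [ArithmeticFunction.natCoe_apply, ArithmeticFunction.zeta_apply]; split_ifs <;> simp

lemma coef1 (U : ℝ) (n : ℕ) : |(trunc muR U * trunc LamR U) n| ≤ log n := by
  rw [ArithmeticFunction.mul_apply, ← conv_log n]
  refine (Finset.abs_sum_le_sum_abs _ _).trans (Finset.sum_le_sum fun d _ => ?_)
  rw [abs_mul]
  have h1 := (abs_trunc_le muR U d.1).trans (abs_muR d.1)
  have h2 := abs_trunc_le LamR U d.2
  rw [abs_of_nonneg (LamR_nonneg d.2)] at h2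
  have := LamR_nonneg d.2
  nlinarith [abs_nonneg (trunc LamR U d.2), abs_nonneg (trunc muR U d.1)]

lemma coef1_zero (U : ℝ) (hU : 0 ≤ U) (n : ℕ) (h : U * U < n) : (trunc muR U * trunc LamR U) n = 0 := by
  rw [ArithmeticFunction.mul_apply]
  refine Finset.sum_eq_zero fun d hd => ?_
  rw [Nat.mem_divisorsAntidiagonal] at hd
  rw [trunc_apply, trunc_apply]
  by_cases h1 : (d.1:ℝ) ≤ U
  · by_cases h2 : (d.2:ℝ) ≤ U
    · exfalso
      have : (n:ℝ) = d.1 * d.2 := by rw [← hd.1]; push_cast; ring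
      have : (d.1:ℝ) * d.2 ≤ U * U := by gcongr
      linarith
    · rw [if_neg h2, mul_zero]
  · rw [if_neg h1, zero_mul]

lemma coef2 (U : ℝ) (n : ℕ) : |((LamR - trunc LamR U) * zR) n| ≤ log n := by
  rw [ArithmeticFunction.mul_apply, ← conv_log' n]
  refine (Finset.abs_sum_le_sum_abs _ _).trans (Finset.sum_le_sum fun d _ => ?_)
  rw [abs_mul, zR_apply]
  have h2 := abs_sub_trunc_le LamR U d.1
  rw [abs_of_nonneg (LamR_nonneg d.1)] at h2
  have := LamR_nonneg d.1
  split_ifs <;> simp <;> linarith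

lemma coef2_zero (U : ℝ) (n : ℕ) (h : (n:ℝ) ≤ U) : ((LamR - trunc LamR U) * zR) n = 0 := by
  rw [ArithmeticFunction.mul_apply]
  refine Finset.sum_eq_zero fun d hd => ?_
  rw [Nat.mem_divisorsAntidiagonal] at hd
  have : d.1 ≤ n := Nat.divisor_le (Nat.mem_divisors.2 ⟨⟨d.2, hd.1.symm⟩, hd.2⟩)
  rw [sub_trunc_zero _ _ _ (le_trans (by exact_mod_cast this) h), zero_mul]

/-- The exponential sum over von Mangoldt. -/
lemma Lam_bound (c : ℝ) (hc : 1 < c) (hc2 : c < 2) : ∃ C : ℝ, 0 < C ∧ ∀ x : ℝ, x ≠ 0 → ∀ X : ℝ, (32:ℝ)^(80:ℝ) ≤ X → 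
    1 ≤ |x| * X ^ c → |x| * X ^ c ≤ X ^ (5/4 : ℝ) → 
    ‖∑ n ∈ Finset.Icc 1 ⌊X⌋₊, (LamR n : ℂ) * F c x X n‖ ≤ C * (X * log X ^ 2 * sv X (|x| * X ^ c)) := by
  obtain ⟨C1, hC1, h1⟩ := typeI c hc hc2
  obtain ⟨C2, hC2, h2⟩ := typeII c hc hc2
  refine ⟨2 * C1 + C1 + C2, by positivity, ?_⟩
  intro x hx X hX hT1 hT2
  have h32 : (32:ℝ) ≤ (32:ℝ)^(80:ℝ) := by
    nth_rw 1 [← rpow_one (32:ℝ)]; exact rpow_le_rpow_of_exponent_le (by norm_num) (by norm_num)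
  have hX32 : 32 ≤ X := h32.trans hX
  have hX0 : 0 < X := by linarith
  have hX1 : 1 ≤ X := by linarith
  set U := X ^ (1/16:ℝ) with hU
  have hU0 : 0 < U := by positivity
  have hUU : U * U = X ^ (1/8:ℝ) := by rw [hU, ← rpow_add hX0]; norm_num
  have hUX : U ≤ X / 8 := by
    have e1 : X = U * X^(15/16:ℝ) := by rw [hU, ← rpow_add hX0]; norm_num
    have e2 : (8:ℝ) ≤ X ^ (15/16:ℝ) := by
      calc (8:ℝ) = 32 ^ (3/5:ℝ) := by 
            rw [show (32:ℝ) = 2^(5:ℝ) by norm_num, ← rpow_mul (by norm_num)]; norm_num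
        _ ≤ 32 ^ (15/16:ℝ) := rpow_le_rpow_of_exponent_le (by norm_num) (by norm_num)
        _ ≤ _ := rpow_le_rpow (by norm_num) hX32 (by norm_num)
    nlinarith
  have hlogX : 0 ≤ log X := log_nonneg hX1
  set K := ⌊X⌋₊ with hK
  have hF0 : ∀ n, K < n → F c x X n = 0 := fun n hn => F_zero c x X n ((Nat.floor_lt hX0.le).1 hn)
  have hlogK : ∀ n : ℕ, n ≤ K → log n ≤ log X := by
    intro n hn
    rcases Nat.eq_zero_or_pos n with h | h
    · subst h; simpa using hlogX
    · apply log_le_log (by exact_mod_cast h)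
      exact (Nat.le_floor_iff hX0.le).1 hn
  have hdec : ∑ n ∈ Finset.Icc 1 K, (LamR n : ℂ) * F c x X n = 
      ∑ n ∈ Finset.Icc 1 K, ((trunc muR U * ArithmeticFunction.log) n : ℂ) * F c x X n
      - ∑ n ∈ Finset.Icc 1 K, ((trunc muR U * trunc LamR U * zR) n : ℂ) * F c x X n
      + ∑ n ∈ Finset.Icc 1 K, (((muR - trunc muR U) * ((LamR - trunc LamR U) * zR)) n : ℂ) * F c x X n := by
    rw [← Finset.sum_sub_distrib, ← Finset.sum_add_distrib]
    refine Finset.sum_congr rfl fun n _ => ?_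
    by_cases hF : F c x X n = 0
    · rw [hF]; simp
    · have hn := (F_ne _ _ _ _ hF).1
      have hv := congrArg (fun f : ArithmeticFunction ℝ => f n) (vaughan U)
      have hv' : LamR n = trunc LamR U n + (trunc muR U * ArithmeticFunction.log) n - (trunc muR U * trunc LamR U * zR) n 
          + ((muR - trunc muR U) * ((LamR - trunc LamR U) * zR)) n := hv
      have ht : trunc LamR U n = 0 := by rw [trunc_apply, if_neg (by linarith)]
      rw [ht] at hv'
      rw [hv']; push_cast; ring
  rw [hdec, conv_sum _ _ _ K hF0, conv_sum _ _ _ K hF0, conv_sum _ _ _ K hF0]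
  have b1 := h1 x hx X (by linarith) hT1 hT2 (fun m => trunc muR U m) (fun k => ArithmeticFunction.log k) 1 (2 * log X)
    (fun m => (abs_trunc_le muR U m).trans (abs_muR m)) 
    (by
      intro m hm
      have : U ≤ X ^ (1/8:ℝ) := rpow_le_rpow_of_exponent_le hX1 (by norm_num)
      rw [trunc_apply, if_neg (by linarith)])
    (by
      intro a b hab
      simp only [ArithmeticFunction.log_apply]
      rcases Nat.eq_zero_or_pos a with h | h
      · subst h; simp; exact log_natCast_nonneg b
      · apply log_le_log (by exact_mod_cast h); exact_mod_cast hab)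
    (by simp) 
    (by
      intro n hn
      simp only [ArithmeticFunction.log_apply]
      rcases Nat.eq_zero_or_pos n with h | h
      · subst h; simp; exact hlogX
      · have h3 : log n ≤ log (2 * X) := log_le_log (by exact_mod_cast h) hn
        rw [log_mul (by norm_num) (by positivity)] at h3
        have h4 : log 2 ≤ log X := log_le_log (by norm_num) (by linarith)
        linarith)
  have b2 := h1 x hx X (by linarith) hT1 hT2 (fun m => if m ≤ K then (trunc muR U * trunc LamR U) m else 0) (fun k => zR k) (log X) 1
    (by
      intro m
      split_ifs with h
      · exact (coef1 U m).trans (hlogK m h)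
      · simpa using hlogX)
    (by
      intro m hm
      rw [coef1_zero U hU0.le m (by rw [hUU]; exact hm), ite_self])
    (by
      intro a b hab
      simp only [zR_apply]
      split_ifs <;> first | omega | norm_num)
    (by simp) (by intro n _; rw [zR_apply]; split_ifs <;> norm_num)
  have b2' : ∑ m ∈ Finset.Icc 1 K, ∑ k ∈ Finset.Icc 1 K, ((if m ≤ K then (trunc muR U * trunc LamR U) m else 0 : ℝ) : ℂ) * (zR k : ℂ) * F c x X (m*k)
     = ∑ m ∈ Finset.Icc 1 K, ∑ k ∈ Finset.Icc 1 K, ((trunc muR U * trunc LamR U) m : ℂ) * (zR k : ℂ) * F c x X (m*k) := by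
    refine Finset.sum_congr rfl fun m hm => ?_
    rw [if_pos (Finset.mem_Icc.1 hm).2]
  rw [b2'] at b2
  have b3 := h2 x hx X hX hT1 hT2 (fun m => (muR - trunc muR U) m) (fun k => ((LamR - trunc LamR U) * zR) k) 1 (log X)
    (fun m => (abs_sub_trunc_le muR U m).trans (abs_muR m)) (fun k hk => (coef2 U k).trans (hlogK k hk))
    (fun m hm => sub_trunc_zero _ _ _ hm) (fun m hm => coef2_zero _ _ hm)
  refine (norm_add_le _ _).trans ((add_le_add (norm_sub_le _ _) le_rfl).trans ?_)
  refine (add_le_add (add_le_add b1 b2) b3).trans (le_of_eq ?_)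
  ring
end BK
end

section
open Real MeasureTheory
namespace BK

/-- primes in the range -/
noncomputable def PS (X : ℝ) : Finset ℕ := (Finset.Ioc 0 ⌊X⌋₊).filter (fun n => n.Prime ∧ X/8 < (n:ℝ))

noncomputable def S (c X x : ℝ) : ℂ := ∑ p ∈ PS X, (log p : ℂ) * e (x * (p:ℝ)^c)

lemma mem_PS (X : ℝ) (hX : 0 ≤ X) (p : ℕ) : p ∈ PS X ↔ p.Prime ∧ X/8 < (p:ℝ) ∧ (p:ℝ) ≤ X := by
  unfold PS
  rw [Finset.mem_filter, Finset.mem_Ioc, Nat.le_floor_iff hX]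
  constructor
  · rintro ⟨⟨_, h1⟩, h2, h3⟩; exact ⟨h2, h3, h1⟩
  · rintro ⟨h1, h2, h3⟩; exact ⟨⟨h1.pos, h3⟩, h1, h2⟩

lemma S_Lam (c X x : ℝ) (hX : 1 ≤ X) : ‖S c X x - ∑ n ∈ Finset.Icc 1 ⌊X⌋₊, (LamR n : ℂ) * F c x X n‖ ≤ 2 * √X * log X := by
  refine le_trans ?_ (Chebyshev.psi_sub_theta_le hX)
  rw [Chebyshev.psi_sub_theta_eq_sum_not_prime]
  have h1 : S c X x = ∑ n ∈ Finset.Ioc 0 ⌊X⌋₊, if n.Prime then (LamR n : ℂ) * F c x X n else 0 := by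
    unfold S PS
    rw [Finset.sum_filter]
    refine Finset.sum_congr rfl fun n hn => ?_
    by_cases hp : n.Prime
    · have : LamR n = log n := ArithmeticFunction.vonMangoldt_apply_prime hp
      rw [if_pos hp, this]
      unfold F
      rw [Finset.mem_Ioc, Nat.le_floor_iff (by linarith)] at hn
      by_cases h : X/8 < (n:ℝ)
      · rw [if_pos ⟨hp, h⟩, if_pos ⟨h, hn.2⟩]
      · rw [if_neg (fun h2 => h h2.2), if_neg (fun h2 => h h2.1), mul_zero]
    · rw [if_neg (fun h2 => hp h2.1), if_neg hp]
  have h2 : Finset.Icc 1 ⌊X⌋₊ = Finset.Ioc 0 ⌊X⌋₊ := rfl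
  rw [h1, h2, ← Finset.sum_sub_distrib, Finset.sum_filter]
  refine (norm_sum_le _ _).trans (Finset.sum_le_sum fun n _ => ?_)
  by_cases hp : n.Prime
  · simp [hp]
  · rw [if_neg hp, if_pos hp, zero_sub, norm_neg, norm_mul, Complex.norm_real, norm_of_nonneg (LamR_nonneg n)]
    have : ‖F c x X n‖ ≤ 1 := by
      unfold F; split_ifs
      · rw [norm_e]
      · simp
    have h3 := LamR_nonneg n
    calc LamR n * ‖F c x X n‖ ≤ LamR n * 1 := by gcongr
      _ = _ := mul_one _

open Filter in
lemma ev_log_pow (n : ℕ) (δ ε : ℝ) (hδ : 0 < δ) (hε : 0 < ε) : ∀ᶠ X : ℝ in atTop, (log X)^n ≤ ε * X ^ δ := by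
  have h := (isLittleO_log_rpow_rpow_atTop (n:ℝ) hδ).bound hε
  filter_upwards [h, eventually_ge_atTop 1] with X hX h1
  rw [rpow_natCast, norm_of_nonneg (pow_nonneg (log_nonneg h1) n), norm_of_nonneg (by positivity)] at hX
  exact hX

open Filter in
lemma ev_log_ge (K : ℝ) : ∀ᶠ X : ℝ in atTop, K ≤ log X := tendsto_log_atTop.eventually_ge_atTop K

open Filter in
lemma S_bound (c : ℝ) (hc : 1 < c) (hc2 : c < 2) (A : ℕ) : ∀ᶠ X : ℝ in atTop, ∀ x : ℝ, (log X)^(4*A+12) ≤ |x| * X ^ c → 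
    |x| * X ^ c ≤ X ^ (5/4 : ℝ) → ‖S c X x‖ ≤ X / (log X)^A := by
  obtain ⟨C, hC, hb⟩ := Lam_bound c hc hc2
  filter_upwards [ev_log_pow (A+2) (1/40) (1/(2*(C+2))) (by norm_num) (by positivity), ev_log_ge 1, ev_log_ge (2*C),
    eventually_ge_atTop ((32:ℝ)^(80:ℝ))] with X h1 h2 h3 h4 x hx1 hx2
  have hX1 : 1 ≤ X := (one_le_rpow (by norm_num) (by norm_num)).trans h4
  have hX0 : 0 < X := by linarith
  set L := log X with hL
  set T := |x| * X ^ c with hT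
  have hL0 : 0 < L := by linarith
  have hT1 : 1 ≤ T := (one_le_pow₀ h2).trans hx1
  have hT0 : 0 < T := by linarith
  have hx0 : x ≠ 0 := by
    intro h; rw [hT, h] at hT1; simp at hT1; linarith
  have hmain := hb x hx0 X h4 hT1 hx2
  have hdiff := S_Lam c X x hX1
  have hTs : T ^ (-(1/4):ℝ) ≤ 1 / L^(A+3) := by
    calc T ^ (-(1/4):ℝ) ≤ ((L^(4*A+12)):ℝ) ^ (-(1/4):ℝ) := rpow_le_rpow_of_nonpos (by positivity) hx1 (by norm_num)
      _ = 1 / L^(A+3) := by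
        rw [show 4*A+12 = (A+3)*4 by ring, pow_mul, rpow_neg (by positivity), one_div]
        rw [← rpow_natCast (L^(A+3)) 4, ← rpow_mul (by positivity)]; norm_num
  have hXs : X ^ (-(1/40):ℝ) * ((2*(C+2)) * L^(A+2)) ≤ 1 := by
    have e1 : (2*(C+2)) * L^(A+2) ≤ X ^ (1/40:ℝ) := by
      have := mul_le_mul_of_nonneg_left h1 (by positivity : 0 ≤ 2*(C+2))
      calc _ ≤ _ := this
        _ = _ := by field_simp
    calc X ^ (-(1/40):ℝ) * ((2*(C+2)) * L^(A+2)) ≤ X ^ (-(1/40):ℝ) * X ^ (1/40:ℝ) := by gcongr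
      _ = 1 := by rw [← rpow_add hX0]; norm_num
  have hsq : √X ≤ X * X ^ (-(1/40):ℝ) := by
    rw [sqrt_eq_rpow]; nth_rw 2 [← rpow_one X]; rw [← rpow_add hX0]
    exact rpow_le_rpow_of_exponent_le hX1 (by norm_num)
  have htri : ‖S c X x‖ ≤ 2 * √X * L + C * (X * L ^ 2 * sv X T) := by
    have := norm_add_le (S c X x - ∑ n ∈ Finset.Icc 1 ⌊X⌋₊, (LamR n : ℂ) * F c x X n) (∑ n ∈ Finset.Icc 1 ⌊X⌋₊, (LamR n : ℂ) * F c x X n)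
    rw [sub_add_cancel] at this
    linarith
  refine htri.trans ?_
  rw [le_div_iff₀ (by positivity)]
  unfold sv
  have p1 : (2 * √X * L) * L^A ≤ X * (X ^ (-(1/40):ℝ) * (2 * L^(A+2))) := by
    calc (2 * √X * L) * L^A = √X * (2 * L^(A+1)) := by ring
      _ ≤ (X * X ^ (-(1/40):ℝ)) * (2 * L^(A+2)) := by
        gcongr
        norm_num
      _ = _ := by ring
  have p2 : C * (X * L^2 * (1 / L^(A+3))) * L^A ≤ X / 2 := by
    have : C * (X * L^2 * (1 / L^(A+3))) * L^A = X * (C / L) := by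
      field_simp
      ring
    rw [this]
    have : C / L ≤ 1/2 := by rw [div_le_iff₀ hL0]; linarith
    nlinarith
  calc (2 * √X * L + C * (X * L ^ 2 * (X ^ (-(1/40):ℝ) + T ^ (-(1/4):ℝ)))) * L^A 
      ≤ (2 * √X * L + C * (X * L ^ 2 * (X ^ (-(1/40):ℝ) + 1 / L^(A+3)))) * L^A := by gcongr
    _ = (2 * √X * L) * L^A + X * (X ^ (-(1/40):ℝ) * (C * L^(A+2))) + C * (X * L^2 * (1 / L^(A+3))) * L^A := by ring
    _ ≤ X * (X ^ (-(1/40):ℝ) * (2 * L^(A+2))) + X * (X ^ (-(1/40):ℝ) * (C * L^(A+2))) + X / 2 := by gcongr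
    _ = X * (X ^ (-(1/40):ℝ) * ((2*(C+2)) * L^(A+2))) / 2 + X / 2 := by ring
    _ ≤ X * 1 / 2 + X / 2 := by gcongr
    _ = X := by ring
end BK
end

section
open Real MeasureTheory
namespace BK

noncomputable def Ts (c X u : ℝ) : ℂ := ∑ n ∈ Finset.Ioc ⌊X/8⌋₊ ⌊X⌋₊, e (u * (n:ℝ)^c)

lemma Ts_bound (c : ℝ) (hc : 1 < c) (hc2 : c < 2) : ∃ C : ℝ, 0 < C ∧ ∀ X K u : ℝ, 8 ≤ X → 1 ≤ K → |u| ≤ 2 * K → 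
    ‖Ts c X u‖ ≤ C * √(K * X^c) + C * (X^(1-c) * (1 / (X^(-c) + |u|))) := by
  obtain ⟨C1, hC1, h1⟩ := vdc c hc hc2
  set k := c * 17^(c-1) with hk
  have hk0 : 0 < k := by positivity
  refine ⟨C1 * (√2 + √(2*k)) + 2 + 4 * 8^(c-1), by positivity, ?_⟩
  intro X K u hX hK hu
  have hX0 : 0 < X := by linarith
  have hX1 : 1 ≤ X := by linarith
  set Y := X/8 with hY
  have hY1 : 1 ≤ Y := by rw [hY]; linarith
  have hY0 : 0 < Y := by linarith
  have hset : Finset.Ioc ⌊X/8⌋₊ ⌊X⌋₊ = Finset.Ico (⌊Y⌋₊+1) (⌊X⌋₊+1) := by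
    rw [← hY]; ext n; simp only [Finset.mem_Ioc, Finset.mem_Ico]; omega
  have ha : Y ≤ ((⌊Y⌋₊+1 : ℕ):ℝ) := by push_cast; exact (Nat.lt_floor_add_one Y).le
  have hb : ((⌊X⌋₊+1 : ℕ):ℝ) ≤ 17 * Y := by
    push_cast; have := Nat.floor_le hX0.le; rw [hY] at hY1 ⊢; linarith
  have hXc : X^(-c) = 1 / X^c := by rw [rpow_neg hX0.le, one_div]
  have hX1c : X^(1-c) = X * X^(-c) := by rw [sub_eq_add_neg, rpow_add hX0, rpow_one]
  have hmc : 0 < X^(-c) := by positivity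
  have hpc : 0 < X^c := by positivity
  have hcc : X^(-c) * X^c = 1 := by rw [← rpow_add hX0]; simp
  have hsK : 0 ≤ √(K * X^c) := sqrt_nonneg _
  have h8c : 0 < (8:ℝ)^(c-1) := by positivity
  have hfac : 0 ≤ X^(1-c) * (1 / (X^(-c) + |u|)) := by positivity
  by_cases c1 : |u| ≤ X^(-c)
  · have htriv : ‖Ts c X u‖ ≤ X := by
      unfold Ts
      refine (norm_sum_le _ _).trans ?_
      simp_rw [norm_e]
      rw [Finset.sum_const, Nat.card_Ioc, nsmul_eq_mul, mul_one]
      calc ((⌊X⌋₊ - ⌊X/8⌋₊ : ℕ):ℝ) ≤ (⌊X⌋₊:ℝ) := by exact_mod_cast Nat.sub_le _ _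
        _ ≤ X := Nat.floor_le hX0.le
    have h2 : X ≤ 2 * (X^(1-c) * (1 / (X^(-c) + |u|))) := by
      rw [hX1c, show 2 * (X * X^(-c) * (1 / (X^(-c) + |u|))) = X * (2 * X^(-c)) / (X^(-c) + |u|) by ring, le_div_iff₀ (by positivity)]
      gcongr; linarith
    have : 0 ≤ C1 * (√2 + √(2*k)) := by positivity
    have e1 : 0 ≤ (C1 * (√2 + √(2*k)) + 2 + 4 * 8^(c-1)) * √(K * X^c) := by positivity
    have e2 : 0 ≤ (C1 * (√2 + √(2*k)) + 4 * 8^(c-1)) * (X^(1-c) * (1 / (X^(-c) + |u|))) := by positivity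
    nlinarith
  · push Not at c1
    have hu0 : 0 < |u| := hmc.trans c1
    have hune : u ≠ 0 := abs_pos.1 hu0
    have hYc : Y^c ≤ X^c := rpow_le_rpow hY0.le (by rw [hY]; linarith) (by linarith)
    have hYc0 : 0 < Y^c := by positivity
    unfold Ts
    rw [hset]
    by_cases c2 : k * (|u| * Y^c) ≤ Y/2
    · have := vdc1 c hc u hune Y hY1 _ _ ha hb c2
      refine this.trans ?_
      have e1 : Y / (|u| * Y^c) = 8^(c-1) * (X^(1-c) * (1/|u|)) := by
        rw [hY, div_rpow hX0.le (by norm_num), rpow_sub (by norm_num), rpow_sub hX0, rpow_one, rpow_one]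
        field_simp
      have e2 : 1/|u| ≤ 2 * (1 / (X^(-c) + |u|)) := by
        rw [mul_one_div, div_le_div_iff₀ hu0 (by positivity)]; linarith
      rw [e1]
      have e3 : X^(1-c) * (1/|u|) ≤ 2 * (X^(1-c) * (1 / (X^(-c) + |u|))) := by
        have := mul_le_mul_of_nonneg_left e2 (by positivity : 0 ≤ X^(1-c))
        linarith
      have e4 := mul_le_mul_of_nonneg_left e3 h8c.le
      have : 0 ≤ C1 * (√2 + √(2*k)) := by positivity
      have f1 : 0 ≤ (C1 * (√2 + √(2*k)) + 2 + 4 * 8^(c-1)) * √(K * X^c) := by positivity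
      have f2 : 0 ≤ (C1 * (√2 + √(2*k)) + 2) * (X^(1-c) * (1 / (X^(-c) + |u|))) := by positivity
      nlinarith
    · push Not at c2
      have hm := h1 u hune Y hY1 _ _ ha hb
      refine hm.trans ?_
      have g1 : √(|u| * Y^c) ≤ √2 * √(K * X^c) := by
        rw [← sqrt_mul (by norm_num)]
        apply sqrt_le_sqrt
        calc |u| * Y^c ≤ 2 * K * X^c := by gcongr
          _ = _ := by ring
      have g2 : Y / √(|u| * Y^c) ≤ √(2*k) * √(K * X^c) := by
        have hs : 0 < √(|u| * Y^c) := sqrt_pos.2 (by positivity)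
        rw [div_le_iff₀ hs, ← sqrt_mul (by positivity), ← sqrt_mul (by positivity)]
        apply le_sqrt_of_sq_le
        have : Y ≤ 2 * (k * (|u| * Y^c)) := by linarith
        have hYX : Y ≤ K * X^c := by
          calc Y ≤ X := by rw [hY]; linarith
            _ = X^(1:ℝ) := (rpow_one X).symm
            _ ≤ X^c := rpow_le_rpow_of_exponent_le hX1 hc.le
            _ ≤ K * X^c := by nlinarith
        calc Y^2 = Y * Y := by ring
          _ ≤ (2 * (k * (|u| * Y^c))) * (K * X^c) := by gcongr
          _ = _ := by ring
      have g3 : C1 * (√(|u| * Y^c) + Y / √(|u| * Y^c)) ≤ C1 * (√2 * √(K * X^c) + √(2*k) * √(K * X^c)) := by gcongr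
      have f1 : 0 ≤ (2 + 4 * (8:ℝ)^(c-1)) * √(K * X^c) := by positivity
      have f2 : 0 ≤ (C1 * (√2 + √(2*k)) + 2 + 4 * 8^(c-1)) * (X^(1-c) * (1 / (X^(-c) + |u|))) := by positivity
      nlinarith

lemma card_Ioc_le (X : ℝ) (hX : 0 ≤ X) : ((Finset.Ioc ⌊X/8⌋₊ ⌊X⌋₊).card : ℝ) ≤ X := by
  rw [Nat.card_Ioc]
  calc ((⌊X⌋₊ - ⌊X/8⌋₊ : ℕ):ℝ) ≤ (⌊X⌋₊:ℝ) := by exact_mod_cast Nat.sub_le _ _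
        _ ≤ X := Nat.floor_le hX

lemma PS_sub (X : ℝ) : PS X ⊆ Finset.Ioc ⌊X/8⌋₊ ⌊X⌋₊ := by
  intro p hp
  unfold PS at hp
  rw [Finset.mem_filter, Finset.mem_Ioc] at hp
  rw [Finset.mem_Ioc]
  refine ⟨?_, hp.1.2⟩
  by_cases h : 0 ≤ X/8
  · exact (Nat.floor_lt h).2 hp.2.2
  · rw [Nat.floor_of_nonpos (by linarith)]; exact hp.1.1

lemma card_PS_le (X : ℝ) (hX : 0 ≤ X) : ((PS X).card : ℝ) ≤ X :=
  le_trans (by exact_mod_cast Finset.card_le_card (PS_sub X)) (card_Ioc_le X hX)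

lemma log_PS (X : ℝ) (hX : 0 ≤ X) (p : ℕ) (hp : p ∈ PS X) : 0 ≤ log p ∧ log p ≤ log X := by
  rw [mem_PS X hX] at hp
  have h1 : (1:ℝ) ≤ p := by exact_mod_cast hp.1.one_lt.le
  exact ⟨log_nonneg h1, log_le_log (by linarith) hp.2.2⟩

/-- Chebyshev trivial bound. -/
lemma S_triv (c X x : ℝ) (hX : 0 ≤ X) : ‖S c X x‖ ≤ 2 * X := by
  unfold S
  have h1 : ‖∑ p ∈ PS X, (log p : ℂ) * e (x * (p:ℝ)^c)‖ ≤ ∑ p ∈ PS X, log p := by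
    refine (norm_sum_le _ _).trans (Finset.sum_le_sum fun p hp => ?_)
    rw [norm_mul, norm_e, mul_one]
    have := (log_PS X hX p hp).1
    rw [Complex.norm_real, norm_of_nonneg this]
  refine h1.trans ?_
  have h2 : ∑ p ∈ PS X, log p ≤ Chebyshev.theta X := by
    unfold Chebyshev.theta PS
    refine Finset.sum_le_sum_of_subset_of_nonneg ?_ ?_
    · intro p hp; rw [Finset.mem_filter] at hp ⊢; exact ⟨hp.1, hp.2.1⟩
    · intro p hp _
      rw [Finset.mem_filter] at hp
      exact log_nonneg (by exact_mod_cast hp.2.one_lt.le)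
  have h3 := Chebyshev.theta_le_log4_mul_x hX
  have h4 : log 4 ≤ 2 := by
    have : log 4 = 2 * log 2 := by rw [show (4:ℝ) = 2^(2:ℕ) by norm_num, log_pow]; norm_num
    have := log_two_lt_d9
    linarith
  nlinarith
end BK
end

section
open Real MeasureTheory
namespace BK

lemma int_e_bound (K t : ℝ) (ht : t ≠ 0) : ‖∫ x in (-K)..K, e (x * t)‖ ≤ 1 / |t| := by
  have hc : ((2 * π * t : ℝ) : ℂ) * Complex.I ≠ 0 := by
    apply mul_ne_zero _ Complex.I_ne_zero
    rw [Complex.ofReal_ne_zero]; positivity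
  have h1 : ∀ x : ℝ, e (x * t) = Complex.exp (((2 * π * t : ℝ) : ℂ) * Complex.I * x) := by
    intro x; unfold e; congr 1; push_cast; ring
  have h2 : ∀ x : ℝ, ‖Complex.exp (((2 * π * t : ℝ) : ℂ) * Complex.I * x)‖ = 1 := by
    intro x; rw [← h1, norm_e]
  simp_rw [h1]
  rw [integral_exp_mul_complex hc, norm_div, norm_mul, Complex.norm_I, mul_one, Complex.norm_real, norm_eq_abs]
  have h3 : ‖Complex.exp (((2 * π * t : ℝ) : ℂ) * Complex.I * K) - Complex.exp (((2 * π * t : ℝ) : ℂ) * Complex.I * ((-K : ℝ):ℂ))‖ ≤ 2 := by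
    refine (norm_sub_le _ _).trans ?_
    rw [h2, h2]; norm_num
  have ht0 : 0 < |t| := abs_pos.2 ht
  rw [abs_mul, abs_of_pos (by positivity : 0 < 2 * π), div_le_div_iff₀ (by positivity) ht0]
  have : 2 ≤ 2 * π := by linarith [pi_gt_three]
  nlinarith

lemma continuous_S (c X : ℝ) : Continuous (S c X) := by
  unfold S
  refine continuous_finsetSum _ fun p _ => continuous_const.mul (continuous_e.comp (by fun_prop))

lemma second_moment (c : ℝ) (hc : 1 < c) (X K : ℝ) (hX : 8 ≤ X) (hK : 1 ≤ K) : 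
    ∫ x in (-K)..K, ‖S c X x‖^2 ≤ 4 * K * X * (log X)^3 := by
  have hX0 : 0 < X := by linarith
  have hcont := continuous_S c X
  have hL : 2 ≤ log X := by
    rw [le_log_iff_exp_le hX0]
    have := exp_one_lt_d9
    have h2 : exp 2 = exp 1 * exp 1 := by rw [← exp_add]; norm_num
    have := exp_pos 1
    nlinarith
  have hex : ((∫ x in (-K)..K, ‖S c X x‖^2 : ℝ) : ℂ) = ∑ p ∈ PS X, ∑ q ∈ PS X, 
      ((log p * log q : ℝ) : ℂ) * ∫ x in (-K)..K, e (x * ((p:ℝ)^c - (q:ℝ)^c)) := by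
    rw [← intervalIntegral.integral_ofReal]
    have : ∀ x : ℝ, ((‖S c X x‖^2 : ℝ) : ℂ) = ∑ p ∈ PS X, ∑ q ∈ PS X, ((log p * log q : ℝ) : ℂ) * e (x * ((p:ℝ)^c - (q:ℝ)^c)) := by
      intro x
      rw [Complex.ofReal_pow, ← Complex.mul_conj']
      unfold S
      rw [map_sum, Finset.sum_mul_sum]
      refine Finset.sum_congr rfl fun p _ => Finset.sum_congr rfl fun q _ => ?_
      rw [map_mul, Complex.conj_ofReal, mul_sub, e_sub]; push_cast; ring
    simp_rw [this]
    rw [intervalIntegral.integral_finsetSum]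
    · refine Finset.sum_congr rfl fun p _ => ?_
      rw [intervalIntegral.integral_finsetSum]
      · refine Finset.sum_congr rfl fun q _ => ?_
        rw [intervalIntegral.integral_const_mul]
      · intro q _
        exact (continuous_const.mul (continuous_e.comp (by fun_prop))).intervalIntegrable _ _
    · intro p _
      exact (continuous_finsetSum _ fun q _ => continuous_const.mul (continuous_e.comp (by fun_prop))).intervalIntegrable _ _
  have hn : ∫ x in (-K)..K, ‖S c X x‖^2 ≤ ‖((∫ x in (-K)..K, ‖S c X x‖^2 : ℝ) : ℂ)‖ := by
    rw [Complex.norm_real]; exact le_norm_self _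
  refine hn.trans ?_
  rw [hex]
  have hpq : ∀ p ∈ PS X, ∀ q ∈ PS X, q ≠ p → ‖∫ x in (-K)..K, e (x * ((p:ℝ)^c - (q:ℝ)^c))‖ ≤ 1 / (Nat.dist p q : ℝ) := by
    have key : ∀ p ∈ PS X, ∀ q ∈ PS X, p < q → (Nat.dist p q : ℝ) ≤ (q:ℝ)^c - (p:ℝ)^c := by
      intro p hp q hq hlt
      rw [mem_PS X hX0.le] at hp hq
      have hp1 : (1:ℝ) ≤ p := by exact_mod_cast hp.1.one_lt.le
      have hlt' : (p:ℝ) ≤ q := by exact_mod_cast hlt.le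
      have h := (rpow_diff c hc.le p q (by linarith) hlt').1
      have h1 : 1 ≤ (p:ℝ)^(c-1) := one_le_rpow hp1 (by linarith)
      rw [Nat.dist_eq_sub_of_le hlt.le, Nat.cast_sub hlt.le]
      have h2 : 1 ≤ c * (p:ℝ)^(c-1) := by nlinarith
      nlinarith
    intro p hp q hq hne
    have hd : 0 < (Nat.dist p q : ℝ) := by exact_mod_cast Nat.dist_pos_of_ne (Ne.symm hne)
    have habs : (Nat.dist p q : ℝ) ≤ |(p:ℝ)^c - (q:ℝ)^c| := by
      rcases lt_or_gt_of_ne hne with h | h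
      · have := key q hq p hp h
        rw [Nat.dist_comm]; exact this.trans (le_abs_self _)
      · rw [abs_sub_comm]; exact (key p hp q hq h).trans (le_abs_self _)
    refine (int_e_bound K _ (fun h => ?_)).trans (one_div_le_one_div_of_le hd habs)
    rw [h, abs_zero] at habs; linarith
  have hdiag : ∀ p ∈ PS X, ‖∫ x in (-K)..K, e (x * ((p:ℝ)^c - (p:ℝ)^c))‖ ≤ 2 * K := by
    intro p _
    simp only [sub_self, mul_zero, e_zero]
    rw [intervalIntegral.integral_const, norm_smul, norm_one, mul_one, norm_eq_abs, abs_of_nonneg (by linarith)]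
    linarith
  have hrow : ∀ p ∈ PS X, ∑ q ∈ PS X, ‖∫ x in (-K)..K, e (x * ((p:ℝ)^c - (q:ℝ)^c))‖ ≤ 2 * K + 2 * (1 + log X) := by
    intro p hp
    rw [← Finset.add_sum_erase _ _ hp]
    refine add_le_add (hdiag p hp) ?_
    have hsub : (PS X).erase p = (PS X).filter (fun q => q ≠ p ∧ Nat.dist p q < ⌊X⌋₊) := by
      ext q
      rw [Finset.mem_erase, Finset.mem_filter]
      constructor
      · rintro ⟨h1, h2⟩
        refine ⟨h2, h1, ?_⟩
        have hp' := Finset.mem_Ioc.1 (PS_sub X hp)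
        have hq' := Finset.mem_Ioc.1 (PS_sub X h2)
        unfold Nat.dist; omega
      · rintro ⟨h1, h2, _⟩; exact ⟨h2, h1⟩
    calc ∑ q ∈ (PS X).erase p, ‖∫ x in (-K)..K, e (x * ((p:ℝ)^c - (q:ℝ)^c))‖ 
        ≤ ∑ q ∈ (PS X).erase p, 1 / (Nat.dist p q : ℝ) := 
          Finset.sum_le_sum fun q hq => hpq p hp q (Finset.mem_of_mem_erase hq) (Finset.ne_of_mem_erase hq)
      _ ≤ 2 * ∑ q ∈ Finset.Icc 1 ⌊X⌋₊, 1 / (q:ℝ) := by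
          rw [hsub]; exact sum_dist _ p ⌊X⌋₊ (fun q => 1/(q:ℝ)) (fun q => by positivity)
      _ ≤ 2 * (1 + log X) := by
          have := harmonic_floor_le_one_add_log X (by linarith)
          rw [harmonic_eq_sum_Icc] at this
          push_cast at this
          simp_rw [one_div]
          linarith
  calc ‖∑ p ∈ PS X, ∑ q ∈ PS X, ((log p * log q : ℝ) : ℂ) * ∫ x in (-K)..K, e (x * ((p:ℝ)^c - (q:ℝ)^c))‖
      ≤ ∑ p ∈ PS X, ∑ q ∈ PS X, (log X)^2 * ‖∫ x in (-K)..K, e (x * ((p:ℝ)^c - (q:ℝ)^c))‖ := by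
        refine (norm_sum_le _ _).trans (Finset.sum_le_sum fun p hp => ?_)
        refine (norm_sum_le _ _).trans (Finset.sum_le_sum fun q hq => ?_)
        have hp' := log_PS X hX0.le p hp
        have hq' := log_PS X hX0.le q hq
        rw [norm_mul, Complex.norm_real, norm_of_nonneg (mul_nonneg hp'.1 hq'.1), sq]
        exact mul_le_mul_of_nonneg_right (mul_le_mul hp'.2 hq'.2 hq'.1 (by linarith)) (norm_nonneg _)
    _ ≤ ∑ p ∈ PS X, (log X)^2 * (2 * K + 2 * (1 + log X)) := by
        refine Finset.sum_le_sum fun p hp => ?_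
        rw [← Finset.mul_sum]
        gcongr
        exact hrow p hp
    _ = (PS X).card * ((log X)^2 * (2 * K + 2 * (1 + log X))) := by rw [Finset.sum_const, nsmul_eq_mul]
    _ ≤ X * ((log X)^2 * (K * (4 * log X))) := by
        gcongr
        · exact card_PS_le X hX0.le
        · nlinarith
    _ = _ := by ring
end BK
end

section
open Real MeasureTheory
namespace BK

lemma intOn1 {E : Type*} [NormedAddCommGroup E] (K : ℝ) (M : Set ℝ) (hM : M ⊆ Set.Icc (-K) K) (f : ℝ → E) (hf : Continuous f) :
    Integrable f (volume.restrict M) :=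
  (hf.continuousOn.integrableOn_compact isCompact_Icc).mono_set hM

lemma intOn2 {E : Type*} [NormedAddCommGroup E] (K : ℝ) (M : Set ℝ) (hM : M ⊆ Set.Icc (-K) K) (f : ℝ × ℝ → E) (hf : Continuous f) :
    Integrable f ((volume.restrict M).prod (volume.restrict M)) := by
  rw [Measure.prod_restrict]
  exact (hf.continuousOn.integrableOn_compact (isCompact_Icc.prod isCompact_Icc)).mono_set (Set.prod_mono hM hM)

lemma ker_int (a K : ℝ) (ha : 0 < a) (hK : 0 < K) (M : Set ℝ) (hM : M ⊆ Set.Icc (-K) K) (x : ℝ) (hx : x ∈ Set.Icc (-K) K) :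
    ∫ y in M, 1 / (a + |x - y|) ≤ 2 * log ((a + 2 * K) / a) := by
  have hk : Continuous (fun u : ℝ => 1 / (a + |u|)) := 
    continuous_const.div (by fun_prop) (fun u => by have := abs_nonneg u; positivity)
  have h1 : ∫ y in M, 1 / (a + |x - y|) ≤ ∫ y in Set.Icc (-K) K, 1 / (a + |x - y|) := by
    refine setIntegral_mono_set ?_ ?_ hM.eventuallyLE
    · exact (hk.comp (by fun_prop : Continuous fun y => x - y)).continuousOn.integrableOn_compact isCompact_Icc
    · exact Filter.Eventually.of_forall fun y => by have := abs_nonneg (x - y); positivity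
  have h2 : ∫ y in Set.Icc (-K) K, 1 / (a + |x - y|) = ∫ u in (x-K)..(x+K), 1 / (a + |u|) := by
    rw [integral_Icc_eq_integral_Ioc, ← intervalIntegral.integral_of_le (by linarith), 
      intervalIntegral.integral_comp_sub_left (fun u => 1 / (a + |u|)) x, sub_neg_eq_add]
  have h3 : ∫ u in (x-K)..(x+K), 1 / (a + |u|) ≤ ∫ u in (-(2*K))..(2*K), 1 / (a + |u|) := by
    refine intervalIntegral.integral_mono_interval (by linarith [hx.1]) (by linarith) (by linarith [hx.2]) ?_ (hk.intervalIntegrable _ _)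
    exact Filter.Eventually.of_forall fun y => by have := abs_nonneg y; simp only [Pi.zero_apply]; positivity
  have h4 : ∫ u in (0:ℝ)..(2*K), 1 / (a + |u|) = log ((a + 2 * K) / a) := by
    have hh := intervalIntegral.integral_comp_add_left (a := 0) (b := 2*K) (fun u : ℝ => 1 / u) a
    rw [add_zero] at hh
    rw [← integral_one_div_of_pos ha (by linarith), ← hh]
    refine intervalIntegral.integral_congr fun u hu => ?_
    rw [Set.uIcc_of_le (by linarith)] at hu
    simp only [abs_of_nonneg hu.1]
  have h5 : ∫ u in (-(2*K))..0, 1 / (a + |u|) = ∫ u in (0:ℝ)..(2*K), 1 / (a + |u|) := by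
    have := intervalIntegral.integral_comp_neg (a := 0) (b := 2*K) (fun u => 1 / (a + |u|))
    simp only [abs_neg, neg_zero] at this
    exact this.symm
  have h6 := intervalIntegral.integral_add_adjacent_intervals (hk.intervalIntegrable (μ := volume) (-(2*K)) 0) (hk.intervalIntegrable 0 (2*K))
  linarith

lemma dual_sum (c X K : ℝ) (M : Set ℝ) (hM : M ⊆ Set.Icc (-K) K) (G : ℝ → ℂ) (hG : Continuous G) :
    ∑ n ∈ Finset.Ioc ⌊X/8⌋₊ ⌊X⌋₊, ‖∫ x in M, e (x * (n:ℝ)^c) * G x‖^2 ≤ 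
    ∫ z, ‖Ts c X (z.1 - z.2)‖ * (‖G z.1‖ * ‖G z.2‖) ∂((volume.restrict M).prod (volume.restrict M)) := by
  set μ := volume.restrict M
  have hfn : ∀ n : ℕ, Continuous (fun x => e (x * (n:ℝ)^c) * G x) := fun n => (continuous_e.comp (by fun_prop)).mul hG
  have h1 : ((∑ n ∈ Finset.Ioc ⌊X/8⌋₊ ⌊X⌋₊, ‖∫ x, e (x * (n:ℝ)^c) * G x ∂μ‖^2 : ℝ) : ℂ) = 
      ∫ z, Ts c X (z.1 - z.2) * (G z.1 * (starRingEnd ℂ) (G z.2)) ∂(μ.prod μ) := by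
    have : ∀ z : ℝ × ℝ, Ts c X (z.1 - z.2) * (G z.1 * (starRingEnd ℂ) (G z.2)) = 
        ∑ n ∈ Finset.Ioc ⌊X/8⌋₊ ⌊X⌋₊, (e (z.1 * (n:ℝ)^c) * G z.1) * (starRingEnd ℂ) (e (z.2 * (n:ℝ)^c) * G z.2) := by
      intro z
      unfold Ts
      rw [Finset.sum_mul]
      refine Finset.sum_congr rfl fun n _ => ?_
      rw [sub_mul, e_sub, map_mul]; ring
    simp_rw [this]
    rw [integral_finsetSum]
    · push_cast
      refine Finset.sum_congr rfl fun n _ => ?_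
      rw [integral_prod_mul (fun x => e (x * (n:ℝ)^c) * G x) (fun x => (starRingEnd ℂ) (e (x * (n:ℝ)^c) * G x)), integral_conj, 
        Complex.mul_conj']
    · intro n _
      refine intOn2 K M hM _ ?_
      exact ((hfn n).comp continuous_fst).mul (Complex.continuous_conj.comp ((hfn n).comp continuous_snd))
  have h2 : ∑ n ∈ Finset.Ioc ⌊X/8⌋₊ ⌊X⌋₊, ‖∫ x, e (x * (n:ℝ)^c) * G x ∂μ‖^2 ≤ 
    ‖((∑ n ∈ Finset.Ioc ⌊X/8⌋₊ ⌊X⌋₊, ‖∫ x, e (x * (n:ℝ)^c) * G x ∂μ‖^2 : ℝ) : ℂ)‖ := by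
    rw [Complex.norm_real]; exact le_norm_self _
  refine h2.trans ?_
  rw [h1]
  refine (norm_integral_le_integral_norm _).trans (le_of_eq ?_)
  refine integral_congr_ae (Filter.Eventually.of_forall fun z => ?_)
  simp only [norm_mul, RCLike.norm_conj]

lemma continuous_Ts (c X : ℝ) : Continuous (Ts c X) := by
  unfold Ts
  exact continuous_finsetSum _ fun n _ => continuous_e.comp (by fun_prop)

lemma dual_int (c : ℝ) (hc : 1 < c) (hc2 : c < 2) : ∃ C : ℝ, 0 < C ∧ ∀ X K : ℝ, 8 ≤ X → 1 ≤ K → K ≤ X → ∀ M : Set ℝ, MeasurableSet M →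
    M ⊆ Set.Icc (-K) K → ∀ G : ℝ → ℂ, Continuous G → 
    ∫ z, ‖Ts c X (z.1 - z.2)‖ * (‖G z.1‖ * ‖G z.2‖) ∂((volume.restrict M).prod (volume.restrict M)) ≤
    C * (√(K * X^c) * (∫ x in M, ‖G x‖)^2 + X^(1-c) * log X * ∫ x in M, ‖G x‖^2) := by
  obtain ⟨C, hC, hb⟩ := Ts_bound c hc hc2
  refine ⟨8 * C, by positivity, ?_⟩
  intro X K hX hK hKX M hMm hM G hG
  have hX0 : 0 < X := by linarith
  have hX1 : 1 ≤ X := by linarith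
  set μ := volume.restrict M with hμ
  set a := X^(-c) with ha
  have ha0 : 0 < a := by positivity
  set k : ℝ → ℝ := fun u => 1 / (a + |u|) with hkdef
  have hk : Continuous k := 
    continuous_const.div (by fun_prop) (fun u => by have := abs_nonneg u; positivity)
  have hk0 : ∀ u, 0 ≤ k u := fun u => by have := abs_nonneg u; simp only [hkdef]; positivity
  have hlog : 2 * log ((a + 2 * K) / a) ≤ 8 * log X := by
    have : (a + 2 * K) / a ≤ X^(4:ℝ) := by
      have hac : a * X^c = 1 := by rw [ha, ← rpow_add hX0]; simp
      rw [div_le_iff₀ ha0]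
      have h4 : X^(4:ℝ) = X^c * X^(4-c) := by rw [← rpow_add hX0]; congr 1; ring
      rw [h4, show X^c * X^(4-c) * a = (a * X^c) * X^(4-c) by ring, hac, one_mul]
      have h5 : X^(2:ℝ) ≤ X^(4-c) := rpow_le_rpow_of_exponent_le hX1 (by linarith)
      have h6 : X^(2:ℝ) = X^2 := by norm_cast
      rw [h6] at h5
      have h7 : a ≤ 1 := rpow_le_one_of_one_le_of_nonpos hX1 (by linarith)
      nlinarith
    have := log_le_log (by positivity) this
    rw [log_rpow hX0] at this
    linarith
  have hGn : Continuous (fun x => ‖G x‖) := hG.norm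
  have hmem : ∀ᵐ z ∂(μ.prod μ), z ∈ M ×ˢ M := by
    rw [hμ, Measure.prod_restrict]
    exact ae_restrict_mem (hMm.prod hMm)
  have hstep : ∫ z, ‖Ts c X (z.1 - z.2)‖ * (‖G z.1‖ * ‖G z.2‖) ∂(μ.prod μ) ≤ 
      ∫ z, (C * √(K * X^c) * (‖G z.1‖ * ‖G z.2‖) + C * X^(1-c) / 2 * (k (z.1 - z.2) * ‖G z.1‖^2) 
        + C * X^(1-c) / 2 * (k (z.1 - z.2) * ‖G z.2‖^2)) ∂(μ.prod μ) := by
    refine integral_mono_ae ?_ ?_ ?_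
    · refine intOn2 K M hM _ ?_
      exact (((continuous_Ts c X).comp (by fun_prop)).norm).mul (by fun_prop)
    · refine intOn2 K M hM _ ?_
      fun_prop
    · filter_upwards [hmem] with z hz
      have h1 := hM hz.1
      have h2 := hM hz.2
      have h3 : |z.1 - z.2| ≤ 2 * K := by rw [abs_le]; constructor <;> linarith [h1.1, h1.2, h2.1, h2.2]
      have h4 := hb X K (z.1 - z.2) hX hK h3
      have h5 : 0 ≤ ‖G z.1‖ := norm_nonneg _
      have h6 : 0 ≤ ‖G z.2‖ := norm_nonneg _
      have h7 := mul_le_mul_of_nonneg_right h4 (mul_nonneg h5 h6)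
      refine h7.trans ?_
      have h8 : 1 / (a + |z.1 - z.2|) = k (z.1 - z.2) := rfl
      rw [h8]
      have h9 : 0 ≤ C * (X^(1-c) * k (z.1 - z.2)) := by have := hk0 (z.1 - z.2); positivity
      nlinarith [mul_nonneg h9 (sq_nonneg (‖G z.1‖ - ‖G z.2‖))]
  refine hstep.trans ?_
  have i1 : Integrable (fun z : ℝ × ℝ => C * √(K * X^c) * (‖G z.1‖ * ‖G z.2‖)) (μ.prod μ) := intOn2 K M hM _ (by fun_prop)
  have i2 : Integrable (fun z : ℝ × ℝ => C * X^(1-c) / 2 * (k (z.1 - z.2) * ‖G z.1‖^2)) (μ.prod μ) := intOn2 K M hM _ (by fun_prop)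
  have i2' : Integrable (fun z : ℝ × ℝ => k (z.1 - z.2) * ‖G z.1‖^2) (μ.prod μ) := intOn2 K M hM _ (by fun_prop)
  have i3 : Integrable (fun z : ℝ × ℝ => C * X^(1-c) / 2 * (k (z.1 - z.2) * ‖G z.2‖^2)) (μ.prod μ) := intOn2 K M hM _ (by fun_prop)
  have i12 : Integrable (fun z : ℝ × ℝ => C * √(K * X^c) * (‖G z.1‖ * ‖G z.2‖) + C * X^(1-c) / 2 * (k (z.1 - z.2) * ‖G z.1‖^2)) (μ.prod μ) := i1.add i2
  rw [integral_add i12 i3, integral_add i1 i2, integral_const_mul, integral_const_mul, integral_const_mul, 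
    integral_prod_mul (fun x => ‖G x‖) (fun x => ‖G x‖)]
  have hsw : ∫ z, k (z.1 - z.2) * ‖G z.2‖^2 ∂(μ.prod μ) = ∫ z, k (z.1 - z.2) * ‖G z.1‖^2 ∂(μ.prod μ) := by
    rw [← integral_prod_swap]
    refine integral_congr_ae (Filter.Eventually.of_forall fun z => ?_)
    simp only [Prod.fst_swap, Prod.snd_swap, hkdef, abs_sub_comm]
  rw [hsw]
  have hmain : ∫ z, k (z.1 - z.2) * ‖G z.1‖^2 ∂(μ.prod μ) ≤ 8 * log X * ∫ x, ‖G x‖^2 ∂μ := by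
    rw [integral_prod _ i2', ← integral_const_mul]
    refine integral_mono_ae i2'.integral_prod_left ((intOn1 K M hM _ (by fun_prop)).const_mul _) ?_
    filter_upwards [ae_restrict_mem hMm] with x hx
    rw [integral_mul_const]
    refine mul_le_mul_of_nonneg_right ?_ (by positivity)
    exact (ker_int a K ha0 (by linarith) M hM x (hM hx)).trans hlog
  have hCX : 0 ≤ C * X^(1-c) := by positivity
  have h1 := mul_le_mul_of_nonneg_left hmain hCX
  have h2 : 0 ≤ C * √(K * X^c) * (∫ x, ‖G x‖ ∂μ)^2 := by positivity
  nlinarith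

lemma duality (c : ℝ) (hc : 1 < c) (hc2 : c < 2) : ∃ C : ℝ, 0 < C ∧ ∀ X K : ℝ, 8 ≤ X → 1 ≤ K → K ≤ X → ∀ M : Set ℝ, MeasurableSet M →
    M ⊆ Set.Icc (-K) K → ∀ G : ℝ → ℂ, Continuous G → 
    ‖∫ x in M, S c X x * G x‖^2 ≤ 
    C * (X * (log X)^2) * (√(K * X^c) * (∫ x in M, ‖G x‖)^2 + X^(1-c) * log X * ∫ x in M, ‖G x‖^2) := by
  obtain ⟨C, hC, hb⟩ := dual_int c hc hc2
  refine ⟨C, hC, ?_⟩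
  intro X K hX hK hKX M hMm hM G hG
  have hX0 : 0 ≤ X := by linarith
  have h1 : ∫ x in M, S c X x * G x = ∑ p ∈ PS X, (log p : ℂ) * ∫ x in M, e (x * (p:ℝ)^c) * G x := by
    unfold S
    simp_rw [Finset.sum_mul]
    rw [integral_finsetSum]
    · refine Finset.sum_congr rfl fun p _ => ?_
      rw [← integral_const_mul]; simp_rw [mul_assoc]
    · intro p _
      exact intOn1 K M hM _ ((continuous_const.mul (continuous_e.comp (by fun_prop))).mul hG)
  rw [h1]
  have h2 : ‖∑ p ∈ PS X, (log p : ℂ) * ∫ x in M, e (x * (p:ℝ)^c) * G x‖ ≤ ∑ p ∈ PS X, log p * ‖∫ x in M, e (x * (p:ℝ)^c) * G x‖ := by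
    refine (norm_sum_le _ _).trans (Finset.sum_le_sum fun p hp => ?_)
    rw [norm_mul, Complex.norm_real, norm_of_nonneg (log_PS X hX0 p hp).1]
  have h3 := Finset.sum_mul_sq_le_sq_mul_sq (PS X) (fun p => log p) (fun p => ‖∫ x in M, e (x * (p:ℝ)^c) * G x‖)
  have h4 : ∑ p ∈ PS X, (log p)^2 ≤ X * (log X)^2 := by
    calc ∑ p ∈ PS X, (log p)^2 ≤ ∑ p ∈ PS X, (log X)^2 := Finset.sum_le_sum fun p hp => 
          pow_le_pow_left₀ (log_PS X hX0 p hp).1 (log_PS X hX0 p hp).2 2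
      _ = (PS X).card * (log X)^2 := by rw [Finset.sum_const, nsmul_eq_mul]
      _ ≤ X * (log X)^2 := by gcongr; exact card_PS_le X hX0
  have h5 : ∑ p ∈ PS X, ‖∫ x in M, e (x * (p:ℝ)^c) * G x‖^2 ≤ ∑ n ∈ Finset.Ioc ⌊X/8⌋₊ ⌊X⌋₊, ‖∫ x in M, e (x * (n:ℝ)^c) * G x‖^2 :=
    Finset.sum_le_sum_of_subset_of_nonneg (PS_sub X) (fun _ _ _ => by positivity)
  have h6 := (h5.trans (dual_sum c X K M hM G hG)).trans (hb X K hX hK hKX M hMm hM G hG)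
  calc ‖∑ p ∈ PS X, (log p : ℂ) * ∫ x in M, e (x * (p:ℝ)^c) * G x‖^2 ≤ (∑ p ∈ PS X, log p * ‖∫ x in M, e (x * (p:ℝ)^c) * G x‖)^2 := by gcongr
    _ ≤ _ := h3
    _ ≤ X * (log X)^2 * (C * (√(K * X^c) * (∫ x in M, ‖G x‖)^2 + X^(1-c) * log X * ∫ x in M, ‖G x‖^2)) := by
        refine mul_le_mul h4 h6 (Finset.sum_nonneg fun _ _ => by positivity) (by positivity)
    _ = _ := by ring
end BK
end

section
open Real MeasureTheory
namespace BK

lemma cs_int {α : Type*} [MeasurableSpace α] (μ : Measure α) (f g : α → ℝ) (hf : Integrable (fun x => f x^2) μ) 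
    (hg : Integrable (fun x => g x^2) μ) (hfg : Integrable (fun x => f x * g x) μ) :
    (∫ x, f x * g x ∂μ)^2 ≤ (∫ x, f x^2 ∂μ) * ∫ x, g x^2 ∂μ := by
  have h : ∀ t : ℝ, 0 ≤ (∫ x, g x^2 ∂μ) * (t * t) + (-2 * ∫ x, f x * g x ∂μ) * t + ∫ x, f x^2 ∂μ := by
    intro t
    have h1 : 0 ≤ ∫ x, (f x - t * g x)^2 ∂μ := integral_nonneg fun x => by positivity
    have h2 : ∫ x, (f x - t * g x)^2 ∂μ = ∫ x, ((f x^2 + (t * t) * g x^2) + (-2 * t) * (f x * g x)) ∂μ := by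
      refine integral_congr_ae (Filter.Eventually.of_forall fun x => ?_)
      simp only; ring
    have i1 : Integrable (fun x => (t * t) * g x^2) μ := hg.const_mul _
    have i2 : Integrable (fun x => f x^2 + (t * t) * g x^2) μ := hf.add i1
    rw [h2, integral_add i2 (hfg.const_mul _), integral_add hf i1, integral_const_mul, integral_const_mul] at h1
    linarith
  have := discrim_le_zero h
  unfold discrim at this
  nlinarith

def minor (c ν X : ℝ) : Set ℝ := {x | (log X)^28 * X^(-c) ≤ |x| ∧ |x| ≤ X^(2*ν)}

lemma minor_meas (c ν X : ℝ) : MeasurableSet (minor c ν X) := by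
  unfold minor
  exact (isClosed_le continuous_const continuous_abs).measurableSet.inter (isClosed_le continuous_abs continuous_const).measurableSet

lemma minor_sub (c ν X : ℝ) : minor c ν X ⊆ Set.Icc (-X^(2*ν)) (X^(2*ν)) := fun _ hx => abs_le.1 hx.2

/-- fourth moment and the cubic minor arc integral, with abstract parameters -/
lemma minor_abs (c : ℝ) (hc : 1 < c) (hc2 : c < 2) : ∃ C : ℝ, 0 < C ∧ ∀ X K s : ℝ, 8 ≤ X → 1 ≤ K → K ≤ X → 0 ≤ s → ∀ M : Set ℝ, MeasurableSet M →
    M ⊆ Set.Icc (-K) K → (∀ x ∈ M, ‖S c X x‖ ≤ s) → ∀ (k : ℝ → ℂ) (D : ℝ), Continuous k → (∀ x, ‖k x‖ ≤ D) →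
    ‖∫ x in M, S c X x * (S c X x * S c X x * k x)‖^2 ≤ C * (X * (log X)^2) * D^2 * (√(K * X^c) * (4 * K * X * (log X)^3)^2 
      + X^(1-c) * log X * (C * (X * (log X)^2) * (√(K * X^c) * (4 * K * X * (log X)^3) + X^(1-c) * log X * s^2))) := by
  obtain ⟨C, hC, hd⟩ := duality c hc hc2
  refine ⟨C, hC, ?_⟩
  intro X K s hX hK hKX hs M hMm hM hsup k D hk hkD
  have hX0 : 0 < X := by linarith
  have hD : 0 ≤ D := (norm_nonneg _).trans (hkD 0)
  have hL : 0 ≤ log X := log_nonneg (by linarith)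
  have hS := continuous_S c X
  have hSn : Continuous (fun x => ‖S c X x‖) := hS.norm
  set μ := volume.restrict M with hμ
  set I2 := 4 * K * X * (log X)^3 with hI2
  have hI20 : 0 ≤ I2 := by positivity
  have hm2 : ∫ x, ‖S c X x‖^2 ∂μ ≤ I2 := by
    refine le_trans ?_ (second_moment c hc X K hX hK)
    rw [intervalIntegral.integral_of_le (by linarith), ← integral_Icc_eq_integral_Ioc]
    refine setIntegral_mono_set ?_ ?_ hM.eventuallyLE
    · exact (hSn.pow 2).continuousOn.integrableOn_compact isCompact_Icc
    · exact Filter.Eventually.of_forall fun y => by simp only [Pi.zero_apply]; positivity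
  set J := ∫ x, ‖S c X x‖^4 ∂μ with hJ
  have hJ0 : 0 ≤ J := integral_nonneg fun x => by positivity
  set V := √(K * X^c) with hV
  have hV0 : 0 ≤ V := sqrt_nonneg _
  set W := X^(1-c) * log X with hW
  have hW0 : 0 ≤ W := by positivity
  set P := C * (X * (log X)^2) with hP
  have hP0 : 0 ≤ P := by positivity
  have hm3 : (∫ x, ‖S c X x‖^3 ∂μ)^2 ≤ J * I2 := by
    have h := cs_int μ (fun x => ‖S c X x‖^2) (fun x => ‖S c X x‖) (intOn1 K M hM _ (by fun_prop)) (intOn1 K M hM _ (by fun_prop))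
      (intOn1 K M hM _ (by fun_prop))
    have e1 : ∀ x, ‖S c X x‖^2 * ‖S c X x‖ = ‖S c X x‖^3 := fun x => by ring
    have e2 : ∀ x, (‖S c X x‖^2)^2 = ‖S c X x‖^4 := fun x => by ring
    simp_rw [e1, e2] at h
    exact h.trans (mul_le_mul_of_nonneg_left hm2 hJ0)
  have hm6 : ∫ x, ‖S c X x‖^6 ∂μ ≤ s^2 * J := by
    rw [hJ, ← integral_const_mul]
    refine integral_mono_ae (intOn1 K M hM _ (by fun_prop)) ((intOn1 K M hM _ (by fun_prop)).const_mul _) ?_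
    filter_upwards [ae_restrict_mem hMm] with x hx
    have := hsup x hx
    calc ‖S c X x‖^6 = ‖S c X x‖^2 * ‖S c X x‖^4 := by ring
      _ ≤ s^2 * ‖S c X x‖^4 := by gcongr
  have hJle : J ≤ P * (V * I2 + W * s^2) := by
    have h := hd X K hX hK hKX M hMm hM (fun x => (starRingEnd ℂ) (S c X x) * (‖S c X x‖^2 : ℝ)) 
      ((Complex.continuous_conj.comp hS).mul (Complex.continuous_ofReal.comp (hSn.pow 2)))
    have e1 : ∀ x, S c X x * ((starRingEnd ℂ) (S c X x) * ((‖S c X x‖^2 : ℝ) : ℂ)) = ((‖S c X x‖^4 : ℝ) : ℂ) := by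
      intro x
      rw [← mul_assoc, Complex.mul_conj']; push_cast; ring
    have e2 : ∀ x, ‖(starRingEnd ℂ) (S c X x) * ((‖S c X x‖^2 : ℝ) : ℂ)‖ = ‖S c X x‖^3 := by
      intro x
      rw [norm_mul, RCLike.norm_conj, Complex.norm_real, norm_of_nonneg (by positivity)]; ring
    have e3 : ∀ x, (‖S c X x‖^3)^2 = ‖S c X x‖^6 := fun x => by ring
    simp_rw [e1, e2, e3] at h
    rw [integral_complex_ofReal, Complex.norm_real, norm_of_nonneg hJ0] at h
    have h2 : J^2 ≤ (P * (V * I2 + W * s^2)) * J := by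
      refine h.trans ?_
      rw [show (P * (V * I2 + W * s^2)) * J = P * (V * (J * I2) + W * (s^2 * J)) by ring]
      gcongr
    rcases hJ0.eq_or_lt with h0 | h0
    · rw [← h0]; positivity
    · rw [sq] at h2; exact le_of_mul_le_mul_right h2 h0
  have h := hd X K hX hK hKX M hMm hM (fun x => S c X x * S c X x * k x) ((hS.mul hS).mul hk)
  refine h.trans ?_
  have b1 : ∫ x, ‖S c X x * S c X x * k x‖ ∂μ ≤ D * I2 := by
    refine le_trans ?_ (mul_le_mul_of_nonneg_left hm2 hD)
    rw [← integral_const_mul]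
    refine integral_mono_ae (intOn1 K M hM _ (by fun_prop)) ((intOn1 K M hM _ (by fun_prop)).const_mul _) (Filter.Eventually.of_forall fun x => ?_)
    simp only [norm_mul]
    have := hkD x
    calc ‖S c X x‖ * ‖S c X x‖ * ‖k x‖ ≤ ‖S c X x‖ * ‖S c X x‖ * D := by gcongr
      _ = _ := by ring
  have b2 : ∫ x, ‖S c X x * S c X x * k x‖^2 ∂μ ≤ D^2 * J := by
    rw [hJ, ← integral_const_mul]
    refine integral_mono_ae (intOn1 K M hM _ (by fun_prop)) ((intOn1 K M hM _ (by fun_prop)).const_mul _) (Filter.Eventually.of_forall fun x => ?_)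
    simp only [norm_mul]
    have := hkD x
    calc (‖S c X x‖ * ‖S c X x‖ * ‖k x‖)^2 ≤ (‖S c X x‖ * ‖S c X x‖ * D)^2 := by gcongr
      _ = _ := by ring
  have b0 : 0 ≤ ∫ x, ‖S c X x * S c X x * k x‖ ∂μ := integral_nonneg fun x => norm_nonneg _
  calc P * (V * (∫ x, ‖S c X x * S c X x * k x‖ ∂μ)^2 + W * ∫ x, ‖S c X x * S c X x * k x‖^2 ∂μ) 
      ≤ P * (V * (D * I2)^2 + W * (D^2 * (P * (V * I2 + W * s^2)))) := by
        gcongr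
        exact b2.trans (by gcongr)
    _ = _ := by ring

open Filter in
lemma minor_final (c : ℝ) (hc : 1 < c) (ν : ℝ) (hν : 0 < ν) (h1 : c + 2 * ν ≤ 5/4) (h2 : 5/2 * c + 5 * ν < 3) (ε : ℝ) (hε : 0 < ε) :
    ∀ᶠ X : ℝ in atTop, ∀ (k : ℝ → ℂ) (D : ℝ), Continuous k → (∀ x, ‖k x‖ ≤ D) → 
    ‖∫ x in minor c ν X, S c X x * (S c X x * S c X x * k x)‖ ≤ ε * D * X^(3-c) := by
  obtain ⟨C, hC, hm⟩ := minor_abs c hc (by linarith)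
  have hδ1 : 0 < 3 - (5/2*c + 5*ν) := by linarith
  have hδ2 : 0 < 2 - (3/2*c + 3*ν) := by linarith
  filter_upwards [S_bound c hc (by linarith) 4, eventually_ge_atTop 8, ev_log_pow 8 _ (ε^2/(32*C)) hδ1 (by positivity), 
    ev_log_pow 10 _ (1/4) hδ2 (by norm_num), ev_log_ge (2*C/ε), ev_log_ge 1] with X hSb hX hl1 hl2 hl3 hl4
  intro k D hk hkD
  have hX0 : 0 < X := by linarith
  have hX1 : 1 ≤ X := by linarith
  have hD : 0 ≤ D := (norm_nonneg _).trans (hkD 0)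
  set L := log X with hL
  have hL0 : 0 < L := by linarith
  have hK1 : 1 ≤ X^(2*ν) := one_le_rpow hX1 (by linarith)
  have hKX : X^(2*ν) ≤ X := by
    calc X^(2*ν) ≤ X^(1:ℝ) := rpow_le_rpow_of_exponent_le hX1 (by linarith)
      _ = X := rpow_one X
  have hsup : ∀ x ∈ minor c ν X, ‖S c X x‖ ≤ X / L^4 := by
    intro x hx
    have hcc : X^(-c) * X^c = 1 := by rw [← rpow_add hX0]; simp
    have hp : 0 < X^c := by positivity
    refine hSb x ?_ ?_
    · have := mul_le_mul_of_nonneg_right hx.1 hp.le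
      rw [mul_assoc, hcc, mul_one] at this
      exact this
    · calc |x| * X^c ≤ X^(2*ν) * X^c := by gcongr; exact hx.2
        _ = X^(2*ν + c) := by rw [rpow_add hX0]
        _ ≤ X^(5/4:ℝ) := rpow_le_rpow_of_exponent_le hX1 (by linarith)
  have hmm := hm X (X^(2*ν)) (X/L^4) hX hK1 hKX (by positivity) _ (minor_meas c ν X) (minor_sub c ν X) hsup k D hk hkD
  have hV : √(X^(2*ν) * X^c) = X^(c/2+ν) := by
    rw [← rpow_add hX0, sqrt_eq_rpow, ← rpow_mul hX0.le]; congr 1; ring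
  rw [hV] at hmm
  have hXn : ∀ a b : ℝ, X^a * X^b = X^(a+b) := fun a b => (rpow_add hX0 a b).symm
  -- first piece
  have q1 : C * (X * L^2) * (X^(c/2+ν) * (4 * X^(2*ν) * X * L^3)^2) ≤ ε^2/2 * X^(6-2*c) := by
    have e1 : C * (X * L^2) * (X^(c/2+ν) * (4 * X^(2*ν) * X * L^3)^2) = 16 * C * L^8 * X^(3 + c/2 + 5*ν) := by
      have : X^(3 + c/2 + 5*ν) = X^(3:ℝ) * X^(c/2+ν) * (X^(2*ν) * X^(2*ν)) := by
        rw [hXn, hXn, hXn]; congr 1; ring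
      rw [this, show X^(3:ℝ) = X^3 by norm_cast]; ring
    rw [e1]
    have e2 : X^(6-2*c) = X^(3 - (5/2*c + 5*ν)) * X^(3 + c/2 + 5*ν) := by rw [hXn]; congr 1; ring
    rw [e2]
    have hp : 0 < X^(3 + c/2 + 5*ν) := by positivity
    calc 16 * C * L^8 * X^(3 + c/2 + 5*ν) ≤ 16 * C * (ε^2/(32*C) * X^(3 - (5/2*c + 5*ν))) * X^(3 + c/2 + 5*ν) := by gcongr
      _ = _ := by field_simp; ring
  have q2 : C * (X * L^2) * (X^(c/2+ν) * (4 * X^(2*ν) * X * L^3) + X^(1-c) * L * (X/L^4)^2) ≤ 2 * C * X^(4-c) / L^5 := by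
    have e1 : C * (X * L^2) * (X^(c/2+ν) * (4 * X^(2*ν) * X * L^3)) ≤ C * X^(4-c) / L^5 := by
      rw [le_div_iff₀ (by positivity)]
      have : X^(2 + c/2 + 3*ν) = X^(2:ℝ) * X^(c/2+ν) * X^(2*ν) := by rw [hXn, hXn]; congr 1; ring
      have e3 : C * (X * L^2) * (X^(c/2+ν) * (4 * X^(2*ν) * X * L^3)) * L^5 = 4 * C * L^10 * X^(2 + c/2 + 3*ν) := by
        rw [this, show X^(2:ℝ) = X^2 by norm_cast]; ring
      have e4 : X^(4-c) = X^(2 - (3/2*c + 3*ν)) * X^(2 + c/2 + 3*ν) := by rw [hXn]; congr 1; ring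
      rw [e3, e4]
      calc 4 * C * L^10 * X^(2 + c/2 + 3*ν) ≤ 4 * C * (1/4 * X^(2 - (3/2*c + 3*ν))) * X^(2 + c/2 + 3*ν) := by gcongr
        _ = _ := by ring
    have e2 : C * (X * L^2) * (X^(1-c) * L * (X/L^4)^2) = C * X^(4-c) / L^5 := by
      have : X^(4-c) = X^(3:ℝ) * X^(1-c) := by rw [hXn]; congr 1; ring
      rw [this, show X^(3:ℝ) = X^3 by norm_cast]
      field_simp
    rw [mul_add, e2]
    have : 2 * C * X^(4-c) / L^5 = C * X^(4-c) / L^5 + C * X^(4-c) / L^5 := by ring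
    rw [this]
    linarith
  have q3 : C * (X * L^2) * (X^(1-c) * L * (2 * C * X^(4-c) / L^5)) ≤ ε^2/2 * X^(6-2*c) := by
    have e1 : X^(6-2*c) = X * X^(1-c) * X^(4-c) := by
      nth_rw 2 [← rpow_one X]; rw [hXn, hXn]; congr 1; ring
    have hp : 0 < X * X^(1-c) * X^(4-c) := by positivity
    rw [e1, show C * (X * L^2) * (X^(1-c) * L * (2 * C * X^(4-c) / L^5)) = (2 * C^2 / L^2) * (X * X^(1-c) * X^(4-c)) by field_simp]
    refine mul_le_mul_of_nonneg_right ?_ hp.le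
    rw [div_le_iff₀ (by positivity)]
    rw [div_le_iff₀ hε] at hl3
    have : (2*C)^2 ≤ (L * ε)^2 := by gcongr
    nlinarith
  have hsq : ‖∫ x in minor c ν X, S c X x * (S c X x * S c X x * k x)‖^2 ≤ (ε * D * X^(3-c))^2 := by
    refine hmm.trans ?_
    have e0 : (X^(3-c))^2 = X^(6-2*c) := by rw [sq, hXn]; congr 1; ring
    have hD2 : 0 ≤ D^2 := by positivity
    have q4 := mul_le_mul_of_nonneg_left q2 (by positivity : 0 ≤ C * (X * L^2) * (X^(1-c) * L))
    calc _ = D^2 * (C * (X * L^2) * (X^(c/2+ν) * (4 * X^(2*ν) * X * L^3)^2) + C * (X * L^2) * (X^(1-c) * L) * 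
            (C * (X * L^2) * (X^(c/2+ν) * (4 * X^(2*ν) * X * L^3) + X^(1-c) * L * (X/L^4)^2))) := by ring
      _ ≤ D^2 * (ε^2/2 * X^(6-2*c) + ε^2/2 * X^(6-2*c)) := by
          refine mul_le_mul_of_nonneg_left (add_le_add q1 (q4.trans (le_trans (le_of_eq ?_) q3))) hD2
          ring
      _ = (ε * D * X^(3-c))^2 := by rw [mul_pow, e0]; ring
  exact le_of_sq_le_sq hsq (by positivity)
end BK
end

section
open Real MeasureTheory
namespace BK

/-- the Gaussian kernel on the frequency side -/
noncomputable def gk (D x : ℝ) : ℝ := D * exp (-(π * D^2) * x^2)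

/-- the Gaussian weight -/
noncomputable def gw (D t : ℝ) : ℝ := exp (-π * (t / D)^2)

lemma gk_int (D : ℝ) (hD : 0 < D) : Integrable (gk D) := 
  (integrable_exp_neg_mul_sq (by positivity : 0 < π * D^2)).const_mul D

lemma gk_cont (D : ℝ) : Continuous (gk D) := by unfold gk; fun_prop

lemma gk_nonneg (D x : ℝ) (hD : 0 < D) : 0 ≤ gk D x := by unfold gk; positivity

lemma gk_ft (D : ℝ) (hD : 0 < D) (t : ℝ) : ∫ x : ℝ, e (x * t) * (gk D x : ℂ) = (gw D t : ℂ) := by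
  have hb : 0 < ((π * D^2 : ℝ) : ℂ).re := by rw [Complex.ofReal_re]; positivity
  have h := fourierIntegral_gaussian hb ((2 * π * t : ℝ) : ℂ)
  have h1 : ∀ x : ℝ, e (x * t) * (gk D x : ℂ) = (D:ℂ) * (Complex.exp (Complex.I * ((2 * π * t : ℝ) : ℂ) * x) * Complex.exp (-((π * D^2 : ℝ) : ℂ) * x^2)) := by
    intro x
    unfold e gk
    push_cast
    rw [show (2 * (π:ℂ) * (x * t) * Complex.I) = Complex.I * (2 * π * t) * x by ring]
    ring
  simp_rw [h1]
  rw [integral_const_mul, h]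
  have h2 : ((π:ℂ) / ((π * D^2 : ℝ) : ℂ))^(1/2:ℂ) = ((1/D : ℝ) : ℂ) := by
    have : ((π:ℂ) / ((π * D^2 : ℝ) : ℂ)) = (((1/D)^2 : ℝ) : ℂ) := by
      have := pi_pos.ne'
      push_cast; field_simp
    rw [this, show (1/2:ℂ) = ((1/2:ℝ):ℂ) by push_cast; ring, ← Complex.ofReal_cpow (by positivity), ← sqrt_eq_rpow, sqrt_sq (by positivity)]
  rw [h2]
  unfold gw
  have h3 : -((2 * π * t : ℝ) : ℂ)^2 / (4 * ((π * D^2 : ℝ) : ℂ)) = ((-π * (t/D)^2 : ℝ) : ℂ) := by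
    have := pi_pos.ne'
    push_cast; field_simp; ring
  rw [h3]
  have hD' : (D:ℂ) ≠ 0 := by exact_mod_cast hD.ne'
  push_cast
  field_simp

/-- the smoothed weighted count -/
noncomputable def Nw (c X R D : ℝ) : ℝ := ∑ p ∈ PS X, ∑ q ∈ PS X, ∑ r ∈ PS X, 
  log p * log q * log r * gw D ((p:ℝ)^c + (q:ℝ)^c + (r:ℝ)^c - R)

lemma Nw_eq (c X R D : ℝ) (hD : 0 < D) : (Nw c X R D : ℂ) = ∫ x : ℝ, S c X x * (S c X x * S c X x * (e (x * (-R)) * (gk D x : ℂ))) := by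
  have h1 : ∀ x : ℝ, S c X x * (S c X x * S c X x * (e (x * (-R)) * (gk D x : ℂ))) = 
      ∑ p ∈ PS X, ∑ q ∈ PS X, ∑ r ∈ PS X, ((log p * log q * log r : ℝ) : ℂ) * (e (x * ((p:ℝ)^c + (q:ℝ)^c + (r:ℝ)^c - R)) * (gk D x : ℂ)) := by
    intro x
    rw [show S c X x * (S c X x * S c X x * (e (x * (-R)) * (gk D x : ℂ))) = (S c X x * (S c X x * S c X x)) * (e (x * (-R)) * (gk D x : ℂ)) by ring]
    unfold S
    rw [Finset.sum_mul_sum, Finset.sum_mul_sum, Finset.sum_mul]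
    refine Finset.sum_congr rfl fun p _ => ?_
    rw [Finset.sum_mul]
    refine Finset.sum_congr rfl fun q _ => ?_
    rw [Finset.mul_sum, Finset.sum_mul]
    refine Finset.sum_congr rfl fun r _ => ?_
    rw [show x * ((p:ℝ)^c + (q:ℝ)^c + (r:ℝ)^c - R) = x * (p:ℝ)^c + x * (q:ℝ)^c + x * (r:ℝ)^c + x * (-R) by ring, e_add, e_add, e_add]
    push_cast; ring
  have hi : ∀ t : ℝ, Integrable (fun x : ℝ => e (x * t) * (gk D x : ℂ)) := by
    intro t
    refine (gk_int D hD).mono' ((continuous_e.comp (by fun_prop)).mul (Complex.continuous_ofReal.comp (gk_cont D))).aestronglyMeasurable ?_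
    refine Filter.Eventually.of_forall fun x => ?_
    rw [norm_mul, norm_e, one_mul, Complex.norm_real, norm_of_nonneg (gk_nonneg D x hD)]
  simp_rw [h1]
  rw [integral_finsetSum]
  · unfold Nw
    push_cast
    refine Finset.sum_congr rfl fun p _ => ?_
    rw [integral_finsetSum]
    · refine Finset.sum_congr rfl fun q _ => ?_
      rw [integral_finsetSum]
      · refine Finset.sum_congr rfl fun r _ => ?_
        rw [integral_const_mul, gk_ft D hD]
      · intro r _; exact (hi _).const_mul _
    · intro q _; exact integrable_finsetSum _ fun r _ => (hi _).const_mul _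
  · intro p _; exact integrable_finsetSum _ fun q _ => integrable_finsetSum _ fun r _ => (hi _).const_mul _

lemma exp_diff_le (a b : ℝ) (ha : 0 ≤ a) (hab : a ≤ b) : |exp (-a) - exp (-b)| ≤ b := by
  have h1 : exp (-b) ≤ exp (-a) := exp_le_exp.2 (by linarith)
  have h2 : exp (-a) ≤ 1 := exp_le_one_iff.2 (by linarith)
  have h3 := add_one_le_exp (-b)
  rw [abs_of_nonneg (by linarith)]
  linarith

set_option maxHeartbeats 1000000 in
open Filter in
lemma kernel_cmp (c : ℝ) (hc : 1 < c) (ν : ℝ) (hν : 0 < ν) (h1 : c + 2 * ν ≤ 5/4) (h2 : 5/2 * c + 5 * ν < 3) (ε : ℝ) (hε : 0 < ε) :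
    ∀ᶠ X : ℝ in atTop, ∀ R D : ℝ, X^(-ν) ≤ D → D ≤ 2 * X^(-ν) → 
    |Nw c X R D - D / (X^c / (log X)^56) * Nw c X R (X^c / (log X)^56)| ≤ ε * D * X^(3-c) := by
  filter_upwards [minor_final c hc ν hν h1 h2 (ε/3) (by positivity), eventually_ge_atTop 8, ev_log_ge 4, ev_log_ge (153/ε), 
    ev_log_pow 2 (2*ν) 1 (by positivity) one_pos, ev_log_pow 56 c (1/2) (by linarith) (by norm_num), eventually_ge_atTop (72/ε)] 
    with X hmin hX hL4 hLε hL2 hL56 hXε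
  intro R D hD1 hD2
  have hX0 : 0 < X := by linarith
  have hX1 : 1 ≤ X := by linarith
  set L := log X with hL
  have hL0 : 0 < L := by linarith
  set H := X^c / L^56 with hH
  have hH0 : 0 < H := by positivity
  have hXν : 0 < X^(-ν) := by positivity
  have hD0 : 0 < D := by linarith
  have hDH : D ≤ H := by
    have : X^(-ν) ≤ 1 := rpow_le_one_of_one_le_of_nonpos hX1 (by linarith)
    have h3 : 2 ≤ H := by rw [hH, le_div_iff₀ (by positivity)]; linarith
    linarith
  set k : ℝ → ℝ := fun x => gk D x - D / H * gk H x with hk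
  have hkc : Continuous k := by have := gk_cont D; have := gk_cont H; fun_prop
  have hkf : ∀ x, k x = D * (exp (-((π * D^2) * x^2)) - exp (-((π * H^2) * x^2))) := by
    intro x; simp only [hk, gk]; field_simp
  have hki : Integrable k := (gk_int D hD0).sub ((gk_int H hH0).const_mul _)
  set kc : ℝ → ℂ := fun x => e (x * (-R)) * (k x : ℂ) with hkc'
  have hkcc : Continuous kc := (continuous_e.comp (by fun_prop)).mul (Complex.continuous_ofReal.comp hkc)
  have hnorm : ∀ x, ‖kc x‖ = |k x| := by
    intro x; simp only [hkc', norm_mul, norm_e, one_mul, Complex.norm_real, norm_eq_abs]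
  have hkD : ∀ x, ‖kc x‖ ≤ D := by
    intro x
    rw [hnorm, hkf, abs_mul, abs_of_pos hD0]
    have e1 : exp (-((π * D^2) * x^2)) ≤ 1 := exp_le_one_iff.2 (by have := pi_pos; simp only [Left.neg_nonpos_iff]; positivity)
    have e2 : exp (-((π * H^2) * x^2)) ≤ 1 := exp_le_one_iff.2 (by have := pi_pos; simp only [Left.neg_nonpos_iff]; positivity)
    have e3 := exp_pos (-((π * D^2) * x^2))
    have e4 := exp_pos (-((π * H^2) * x^2))
    have : |exp (-((π * D^2) * x^2)) - exp (-((π * H^2) * x^2))| ≤ 1 := by rw [abs_le]; constructor <;> linarith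
    nlinarith
  set f : ℝ → ℂ := fun x => S c X x * (S c X x * S c X x * kc x) with hf
  have hfc : Continuous f := by have := continuous_S c X; fun_prop
  have hS3 : ∀ x, ‖f x‖ ≤ 8 * X^3 * |k x| := by
    intro x
    simp only [hf, norm_mul, hnorm]
    have := S_triv c X x hX0.le
    calc ‖S c X x‖ * (‖S c X x‖ * ‖S c X x‖ * |k x|) ≤ (2 * X) * ((2 * X) * (2 * X) * |k x|) := by gcongr
      _ = _ := by ring
  have hfi : Integrable f := by
    refine (hki.abs.const_mul (8 * X^3)).mono' hfc.aestronglyMeasurable (Eventually.of_forall hS3)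
  have heq : ((Nw c X R D - D / H * Nw c X R H : ℝ) : ℂ) = ∫ x, f x := by
    have i1 : ∀ D' : ℝ, 0 < D' → Integrable (fun x : ℝ => S c X x * (S c X x * S c X x * (e (x * (-R)) * (gk D' x : ℂ)))) := by
      intro D' hD'
      refine ((gk_int D' hD').const_mul (8 * X^3)).mono' ?_ (Eventually.of_forall fun x => ?_)
      · have := continuous_S c X
        have h3 := gk_cont D'
        have h4 : Continuous (fun x : ℝ => e (x * (-R))) := continuous_e.comp (by fun_prop)
        exact (this.mul ((this.mul this).mul (h4.mul (Complex.continuous_ofReal.comp h3)))).aestronglyMeasurable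
      · simp only [norm_mul, norm_e, one_mul, Complex.norm_real, norm_of_nonneg (gk_nonneg D' x hD')]
        have := S_triv c X x hX0.le
        have h3 := gk_nonneg D' x hD'
        calc ‖S c X x‖ * (‖S c X x‖ * ‖S c X x‖ * gk D' x) ≤ (2 * X) * ((2 * X) * (2 * X) * gk D' x) := by gcongr
          _ = _ := by ring
    rw [Complex.ofReal_sub, Complex.ofReal_mul, Nw_eq c X R D hD0, Nw_eq c X R H hH0, ← integral_const_mul, 
      ← integral_sub (i1 D hD0) ((i1 H hH0).const_mul _)]
    refine integral_congr_ae (Eventually.of_forall fun x => ?_)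
    simp only [hf, hkc', hk]; push_cast; ring
  have hnn : |Nw c X R D - D / H * Nw c X R H| = ‖∫ x, f x‖ := by rw [← heq, Complex.norm_real, norm_eq_abs]
  rw [hnn]
  set K := X^(2*ν) with hK
  set τ := L^28 * X^(-c) with hτ
  have hτ0 : 0 < τ := by positivity
  have hK0 : 0 < K := by positivity
  set M := minor c ν X with hM
  set M0 : Set ℝ := {x | |x| < τ} with hM0
  set M1 : Set ℝ := {x | K < |x|} with hM1
  have hM0m : MeasurableSet M0 := (isOpen_lt continuous_abs continuous_const).measurableSet
  have hM1m : MeasurableSet M1 := (isOpen_lt continuous_const continuous_abs).measurableSet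
  have hτK : τ ≤ K := by
    have a1 : 1 ≤ K := one_le_rpow hX1 (by linarith)
    have a2 : L^28 ≤ L^56 := pow_le_pow_right₀ (by linarith) (by norm_num)
    have a3 : X^(-c) * X^c = 1 := by rw [← rpow_add hX0]; simp
    have a4 : τ ≤ 1 := by
      rw [hτ, ← a3, mul_comm]
      gcongr
      have : 0 < X^c := by positivity
      linarith
    linarith
  have hsplit : ∫ x, f x = (∫ x in M0, f x) + (∫ x in M, f x) + ∫ x in M1, f x := by
    have hc1 : M0ᶜ = M ∪ M1 := by
      ext x
      simp only [hM0, hM, hM1, minor, Set.mem_compl_iff, Set.mem_ofPred_eq, Set.mem_union, not_lt]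
      constructor
      · intro h; rcases le_or_gt |x| K with h' | h'
        · exact Or.inl ⟨h, h'⟩
        · exact Or.inr h'
      · rintro (h | h)
        · exact h.1
        · linarith
    rw [← integral_add_compl hM0m hfi, hc1, setIntegral_union ?_ hM1m hfi.integrableOn hfi.integrableOn]
    · ring
    · rw [Set.disjoint_left]; intro x hx hx'
      have := hx.2
      simp only [hM1, Set.mem_ofPred_eq] at hx'
      linarith
  rw [hsplit]
  have p1 : ‖∫ x in M, f x‖ ≤ ε/3 * D * X^(3-c) := hmin kc D hkcc hkD
  have hX3c : X^(3-c) = X^3 * X^(-c) := by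
    rw [sub_eq_add_neg, rpow_add hX0, show X^(3:ℝ) = X^3 by norm_cast]
  have p0 : ‖∫ x in M0, f x‖ ≤ ε/3 * D * X^(3-c) := by
    have hM0v : volume M0 ≤ ENNReal.ofReal (2 * τ) := by
      have : M0 = Set.Ioo (-τ) τ := by ext x; simp only [hM0, Set.mem_ofPred_eq, abs_lt, Set.mem_Ioo]
      rw [this, Real.volume_Ioo]; apply ENNReal.ofReal_le_ofReal; linarith
    have hb : ∀ x ∈ M0, ‖f x‖ ≤ 8 * X^3 * (D * (π * (1 / L^56))) := by
      intro x hx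
      refine (hS3 x).trans ?_
      gcongr
      rw [hkf, abs_mul, abs_of_pos hD0]
      gcongr
      have hx2 : x^2 ≤ τ^2 := by
        rw [← sq_abs x]; have : |x| < τ := hx; gcongr
      have a3 : X^(-c) * X^c = 1 := by rw [← rpow_add hX0]; simp
      refine (exp_diff_le _ _ (by have := pi_pos; positivity) (by have := pi_pos; gcongr)).trans ?_
      rw [mul_assoc]
      refine mul_le_mul_of_nonneg_left ?_ pi_pos.le
      calc H^2 * x^2 ≤ H^2 * τ^2 := by gcongr
        _ = (X^(-c) * X^c)^2 * (1 / L^56) := by rw [hH, hτ]; field_simp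
        _ = 1 / L^56 := by rw [a3]; ring
    have hb2 := norm_setIntegral_le_of_norm_le_const (lt_of_le_of_lt hM0v ENNReal.ofReal_lt_top) hb
    have hvr : volume.real M0 ≤ 2 * τ := ENNReal.toReal_le_of_le_ofReal (by positivity) hM0v
    have hpi := pi_lt_d2
    calc ‖∫ x in M0, f x‖ ≤ 8 * X^3 * (D * (π * (1 / L^56))) * volume.real M0 := hb2
      _ ≤ 8 * X^3 * (D * (π * (1 / L^56))) * (2 * τ) := by gcongr
      _ = (16 * π / L^28) * D * (X^3 * X^(-c)) := by rw [hτ]; field_simp; ring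
      _ ≤ ε/3 * D * X^(3-c) := by
        rw [hX3c]
        refine mul_le_mul_of_nonneg_right (mul_le_mul_of_nonneg_right ?_ hD0.le) (by positivity)
        rw [div_le_iff₀ (by positivity)]
        rw [div_le_iff₀ hε] at hLε
        have : L ≤ L^28 := le_self_pow₀ (by linarith) (by norm_num)
        nlinarith
  have p2 : ‖∫ x in M1, f x‖ ≤ ε/3 * D * X^(3-c) := by
    have hb : ∀ x ∈ M1, ‖f x‖ ≤ 16 * X^3 * D * X^(-4:ℝ) * exp (-(π * D^2 / 2) * x^2) := by
      intro x hx
      have hx' : K < |x| := hx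
      refine (hS3 x).trans ?_
      have e1 : |k x| ≤ D * (2 * exp (-((π * D^2) * x^2))) := by
        rw [hkf, abs_mul, abs_of_pos hD0]
        gcongr
        have a1 : exp (-((π * H^2) * x^2)) ≤ exp (-((π * D^2) * x^2)) := by
          apply exp_le_exp.2
          have : (π * D^2) * x^2 ≤ (π * H^2) * x^2 := by gcongr
          linarith
        have a2 := exp_pos (-((π * H^2) * x^2))
        rw [abs_le]; constructor <;> linarith
      have e2 : exp (-((π * D^2) * x^2)) ≤ X^(-4:ℝ) * exp (-(π * D^2 / 2) * x^2) := by
        have a1 : X^(-4:ℝ) = exp (-4 * L) := by rw [rpow_def_of_pos hX0, ← hL]; congr 1; ring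
        rw [a1, ← exp_add]
        apply exp_le_exp.2
        have a2 : K^2 ≤ x^2 := by rw [← sq_abs x]; gcongr
        have a3 : X^(-ν) * K = X^ν := by rw [hK, ← rpow_add hX0]; congr 1; ring
        have a4 : (X^ν)^2 = X^(2*ν) := by rw [sq, ← rpow_add hX0]; congr 1; ring
        have a5 : L^2 ≤ D^2 * x^2 := by
          calc L^2 ≤ X^(2*ν) := by linarith
            _ = (X^(-ν) * K)^2 := by rw [a3, a4]
            _ = (X^(-ν))^2 * K^2 := by ring
            _ ≤ D^2 * x^2 := by gcongr
        have a6 := pi_gt_three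
        have a7 : 0 ≤ D^2 * x^2 := by positivity
        have a8 : 4 * L ≤ L^2 := by rw [sq]; exact mul_le_mul_of_nonneg_right hL4 hL0.le
        have a9 : 1 * (D^2 * x^2) ≤ π / 2 * (D^2 * x^2) := mul_le_mul_of_nonneg_right (by linarith) a7
        have a10 : π * D^2 * x^2 = π / 2 * (D^2 * x^2) + π * D^2 / 2 * x^2 := by ring
        linarith
      have hx3 : 0 ≤ 8 * X^3 := by positivity
      calc 8 * X^3 * |k x| ≤ 8 * X^3 * (D * (2 * (X^(-4:ℝ) * exp (-(π * D^2 / 2) * x^2)))) := by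
            gcongr; exact e1.trans (by gcongr)
        _ = _ := by ring
    have hgi : Integrable (fun x : ℝ => 16 * X^3 * D * X^(-4:ℝ) * exp (-(π * D^2 / 2) * x^2)) := 
      (integrable_exp_neg_mul_sq (by have := pi_pos; positivity)).const_mul _
    calc ‖∫ x in M1, f x‖ ≤ ∫ x in M1, 16 * X^3 * D * X^(-4:ℝ) * exp (-(π * D^2 / 2) * x^2) := 
          norm_integral_le_of_norm_le hgi.integrableOn ((ae_restrict_iff' hM1m).2 (Eventually.of_forall hb))
      _ ≤ ∫ x, 16 * X^3 * D * X^(-4:ℝ) * exp (-(π * D^2 / 2) * x^2) := 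
          setIntegral_le_integral hgi (Eventually.of_forall fun x => by simp only [Pi.zero_apply]; positivity)
      _ = 16 * X^3 * D * X^(-4:ℝ) * √(π / (π * D^2 / 2)) := by rw [integral_const_mul, integral_gaussian]
      _ ≤ 16 * X^3 * D * X^(-4:ℝ) * (1.5 / D) := by
          gcongr
          apply sqrt_le_iff.2 ⟨by positivity, ?_⟩
          have := pi_pos
          rw [show π / (π * D^2 / 2) = 2 / D^2 by field_simp, div_pow]
          gcongr; norm_num
      _ = 24 / X := by
          rw [rpow_neg hX0.le, show X^(4:ℝ) = X^4 by norm_cast]; field_simp; norm_num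
      _ ≤ ε/3 * 1 := by
          rw [div_le_iff₀ hX0]; rw [div_le_iff₀ hε] at hXε; linarith
      _ ≤ ε/3 * (D * X^(3-c)) := by
          gcongr
          calc 1 ≤ X^(3-c-ν) := one_le_rpow hX1 (by linarith)
            _ = X^(-ν) * X^(3-c) := by rw [← rpow_add hX0]; congr 1; ring
            _ ≤ D * X^(3-c) := by gcongr
      _ = _ := by ring
  calc _ ≤ ‖∫ x in M0, f x‖ + ‖∫ x in M, f x‖ + ‖∫ x in M1, f x‖ := norm_add₃_le
    _ ≤ ε/3 * D * X^(3-c) + ε/3 * D * X^(3-c) + ε/3 * D * X^(3-c) := by gcongr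
    _ = _ := by ring
end BK
end

section
open Real MeasureTheory
namespace BK

noncomputable def En (n : ℕ) (s : ℂ) : ℂ :=
  (s - 1) * (n : ℂ) ^ (-s) + ((n + 1 : ℕ) : ℂ) ^ (1 - s) - (n : ℂ) ^ (1 - s)

theorem En_bound (n : ℕ) (hn : 1 ≤ n) (s : ℂ) (hs : 0 < s.re) :
    ‖En n s‖ ≤ ‖s‖ * ‖s - 1‖ * (n : ℝ) ^ (-s.re - 1) := by
  have hn0 : (0 : ℝ) < n := by exact_mod_cast hn
  by_cases h1 : s = 1
  · subst h1; simp [En]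
  have hs0 : -s ≠ 0 := by
    intro h; have : s = 0 := by simpa using h
    simp [this] at hs
  have h1s : (1 : ℂ) - s ≠ 0 := sub_ne_zero.2 (Ne.symm h1)
  have key1 : ∀ x ∈ Set.Icc (n : ℝ) (n + 1),
      ‖(x : ℂ) ^ (-s) - ((n : ℝ) : ℂ) ^ (-s)‖ ≤ ‖s‖ * (n : ℝ) ^ (-s.re - 1) * (x - n) := by
    refine norm_image_sub_le_of_norm_deriv_le_segment' (f := fun x : ℝ => (x : ℂ) ^ (-s))
      (f' := fun x : ℝ => -s * (x : ℂ) ^ (-s - 1)) ?_ ?_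
    · intro x hx
      exact (hasDerivAt_ofReal_cpow_const (by linarith [hx.1]) hs0).hasDerivWithinAt
    · intro x hx
      have hx0 : 0 < x := by linarith [hx.1]
      rw [norm_mul, norm_neg, Complex.norm_cpow_eq_rpow_re_of_pos hx0]
      refine mul_le_mul_of_nonneg_left ?_ (norm_nonneg _)
      have : (-s - 1).re = -s.re - 1 := by simp
      rw [this]
      exact Real.rpow_le_rpow_of_nonpos hn0 hx.1 (by linarith)
  have key2 := norm_image_sub_le_of_norm_deriv_le_segment' (a := (n : ℝ)) (b := n + 1)
      (f := fun x : ℝ => (s - 1) * ((n : ℝ) : ℂ) ^ (-s) * (x : ℂ) + (x : ℂ) ^ (1 - s))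
      (f' := fun x : ℝ => (s - 1) * ((n : ℝ) : ℂ) ^ (-s) * 1 + (1 - s) * (x : ℂ) ^ (1 - s - 1))
      (C := ‖s‖ * ‖s - 1‖ * (n : ℝ) ^ (-s.re - 1)) ?_ ?_ (n + 1) (by simp)
  · have e1 : En n s = (fun x : ℝ => (s - 1) * ((n : ℝ) : ℂ) ^ (-s) * (x : ℂ) + (x : ℂ) ^ (1 - s)) (n + 1)
      - (fun x : ℝ => (s - 1) * ((n : ℝ) : ℂ) ^ (-s) * (x : ℂ) + (x : ℂ) ^ (1 - s)) n := by
      simp only [En]; push_cast; ring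
    rw [e1]
    refine key2.trans (le_of_eq ?_); ring
  · intro x hx
    have hx0 : x ≠ 0 := by linarith [hx.1]
    exact ((Complex.ofRealCLM.hasDerivAt (x := x)).const_mul _ |>.add
      (hasDerivAt_ofReal_cpow_const hx0 h1s)).hasDerivWithinAt
  · intro x hx
    have e2 : (s - 1) * ((n : ℝ) : ℂ) ^ (-s) * 1 + (1 - s) * (x : ℂ) ^ (1 - s - 1)
        = -((s - 1) * ((x : ℂ) ^ (-s) - ((n : ℝ) : ℂ) ^ (-s))) := by
      have : (1 : ℂ) - s - 1 = -s := by ring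
      rw [this]; ring
    rw [e2, norm_neg, norm_mul]
    have := key1 x ⟨hx.1, hx.2.le⟩
    have h3 : ‖s‖ * (n : ℝ) ^ (-s.re - 1) * (x - n) ≤ ‖s‖ * (n : ℝ) ^ (-s.re - 1) * 1 := by
      refine mul_le_mul_of_nonneg_left (by linarith [hx.2]) (by positivity)
    calc ‖s - 1‖ * _ ≤ ‖s - 1‖ * (‖s‖ * (n : ℝ) ^ (-s.re - 1) * 1) :=
          mul_le_mul_of_nonneg_left (this.trans h3) (norm_nonneg _)
      _ = _ := by ring

/-- The approximating expression for `(s-1) ζ(s)`. -/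
noncomputable def ZN (N : ℕ) (s : ℂ) : ℂ :=
  (s - 1) * (∑ n ∈ Finset.range N, ((n + 1 : ℕ) : ℂ) ^ (-s)) + ((N + 1 : ℕ) : ℂ) ^ (1 - s)
    + ∑' k : ℕ, En (N + 1 + k) s

theorem En_diff (n : ℕ) (hn : 1 ≤ n) : Differentiable ℂ (En n) := by
  have h0 : (n : ℂ) ≠ 0 := by exact_mod_cast (by lia : n ≠ 0)
  have h1 : ((n + 1 : ℕ) : ℂ) ≠ 0 := by exact_mod_cast (by lia : n + 1 ≠ 0)
  unfold En
  intro s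
  refine ((((differentiableAt_id).sub_const 1).mul ?_).add ?_).sub ?_
  · exact (differentiableAt_id.neg).const_cpow (Or.inl h0)
  · exact (differentiableAt_id.const_sub 1).const_cpow (Or.inl h1)
  · exact (differentiableAt_id.const_sub 1).const_cpow (Or.inl h0)

theorem En_summ (N : ℕ) (s : ℂ) (hs : 0 < s.re) : Summable (fun k => En (N + 1 + k) s) := by
  have hsum : Summable (fun k : ℕ => ((N + 1 + k : ℕ) : ℝ) ^ (-s.re - 1)) := by
    have := (Real.summable_nat_rpow (p := -s.re - 1)).2 (by linarith)
    have h2 := (summable_nat_add_iff (N + 1)).2 this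
    refine h2.congr (fun k => ?_)
    congr 1; push_cast; ring
  exact Summable.of_norm_bounded (hsum.mul_left (‖s‖ * ‖s - 1‖))
    (fun k => En_bound _ (by lia) s hs)

theorem ZN_diff (N : ℕ) : DifferentiableOn ℂ (ZN N) {s | 0 < s.re} := by
  have hopen : IsOpen {s : ℂ | 0 < s.re} := isOpen_lt continuous_const Complex.continuous_re
  intro s hs
  unfold ZN
  have hN : ((N + 1 : ℕ) : ℂ) ≠ 0 := by exact_mod_cast (by lia : N + 1 ≠ 0)
  refine DifferentiableAt.differentiableWithinAt ?_
  refine ((((differentiableAt_id).sub_const 1).mul ?_).add ?_).add ?_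
  · refine DifferentiableAt.fun_sum (fun n _ => ?_)
    have h1 : ((n + 1 : ℕ) : ℂ) ≠ 0 := by exact_mod_cast (by lia : n + 1 ≠ 0)
    exact (differentiableAt_id.neg).const_cpow (Or.inl h1)
  · exact (differentiableAt_id.const_sub 1).const_cpow (Or.inl hN)
  · have hs' : 0 < s.re := hs
    set a := s.re / 2 with ha
    set A := ‖s‖ + 2 with hA
    have hU : IsOpen ({z : ℂ | a < z.re} ∩ Metric.ball 0 A) :=
      (isOpen_lt continuous_const Complex.continuous_re).inter Metric.isOpen_ball
    have hsum : Summable (fun k : ℕ => A * (A + 1) * ((N + 1 + k : ℕ) : ℝ) ^ (-a - 1)) := by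
      have := (Real.summable_nat_rpow (p := -a - 1)).2 (by linarith)
      have h2 := (summable_nat_add_iff (N + 1)).2 this
      refine Summable.mul_left _ (h2.congr (fun k => ?_))
      congr 1; push_cast; ring
    have := Complex.differentiableOn_tsum_of_summable_norm (F := fun k => En (N + 1 + k)) hsum
      (fun k => (En_diff _ (by lia)).differentiableOn) hU ?_
    · refine (this s ⟨?_, ?_⟩).differentiableAt (hU.mem_nhds ⟨?_, ?_⟩)
      all_goals first
        | (change a < s.re; linarith)
        | (rw [mem_ball_zero_iff]; linarith)
    · rintro k z ⟨hz1, hz2⟩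
      have hz1' : a < z.re := hz1
      rw [mem_ball_zero_iff] at hz2
      refine (En_bound _ (by lia) z (by linarith)).trans ?_
      have h3 : ‖z - 1‖ ≤ A + 1 := (norm_sub_le _ _).trans (by simp; linarith)
      have h4 : ((N + 1 + k : ℕ) : ℝ) ^ (-z.re - 1) ≤ ((N + 1 + k : ℕ) : ℝ) ^ (-a - 1) :=
        Real.rpow_le_rpow_of_exponent_le (by norm_cast; lia) (by linarith)
      gcongr

theorem ZN_eq_re (N : ℕ) (s : ℂ) (hs : 1 < s.re) : ZN N s = riemannZeta₁ s := by
  have hs1 : s ≠ 1 := by rintro rfl; simp at hs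
  have hz : riemannZeta₁ s = (s - 1) * riemannZeta s := by
    rw [riemannZeta_eq_inv_sub_mul hs1, mul_inv_cancel_left₀ (sub_ne_zero.2 hs1)]
  have hsm : Summable (fun n : ℕ => ((n + 1 : ℕ) : ℂ) ^ (-s)) := by
    have := (Complex.summable_one_div_nat_cpow (p := s)).2 hs
    have h2 := (summable_nat_add_iff 1).2 this
    refine h2.congr (fun k => ?_)
    rw [Complex.cpow_neg, one_div]
  have hzs : riemannZeta s = ∑' n : ℕ, ((n + 1 : ℕ) : ℂ) ^ (-s) := by
    rw [zeta_eq_tsum_one_div_nat_add_one_cpow hs]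
    refine tsum_congr (fun n => ?_)
    rw [Complex.cpow_neg, one_div]; push_cast; rfl
  have htel : HasSum (fun k : ℕ => ((N + 1 + k + 1 : ℕ) : ℂ) ^ (1 - s) - ((N + 1 + k : ℕ) : ℂ) ^ (1 - s))
      (0 - ((N + 1 : ℕ) : ℂ) ^ (1 - s)) := by
    have hs2 : Summable (fun k : ℕ => ((N + 1 + k + 1 : ℕ) : ℂ) ^ (1 - s) - ((N + 1 + k : ℕ) : ℂ) ^ (1 - s)) := by
      have h1 := En_summ N s (by linarith)
      have h2 := ((summable_nat_add_iff N).2 hsm).mul_left (s - 1)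
      refine (h1.sub h2).congr (fun k => ?_)
      have : k + N + 1 = N + 1 + k := by lia
      rw [this]; simp only [En]; ring
    refine (hs2.hasSum_iff_tendsto_nat).2 ?_
    have e1 : ∀ n, ∑ k ∈ Finset.range n, (((N + 1 + k + 1 : ℕ) : ℂ) ^ (1 - s) - ((N + 1 + k : ℕ) : ℂ) ^ (1 - s))
        = ((N + 1 + n : ℕ) : ℂ) ^ (1 - s) - ((N + 1 : ℕ) : ℂ) ^ (1 - s) := by
      intro n
      have := Finset.sum_range_sub (fun k => ((N + 1 + k : ℕ) : ℂ) ^ (1 - s)) n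
      simpa [add_assoc] using this
    simp_rw [e1]
    refine Filter.Tendsto.sub_const ?_ _
    rw [tendsto_zero_iff_norm_tendsto_zero]
    have e2 : ∀ n, ‖((N + 1 + n : ℕ) : ℂ) ^ (1 - s)‖ = ((N + 1 + n : ℕ) : ℝ) ^ (-(s.re - 1)) := by
      intro n
      rw [Complex.norm_natCast_cpow_of_pos (by lia)]; simp
    simp_rw [e2]
    have h3 := (tendsto_rpow_neg_atTop (y := s.re - 1) (by linarith)).comp tendsto_natCast_atTop_atTop
    have h4 := h3.comp (Filter.tendsto_add_atTop_nat (N + 1))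
    refine h4.congr (fun n => ?_)
    simp only [Function.comp]; congr 2; lia
  have hsplit := (hsm.sum_add_tsum_nat_add N)
  have htail : ∑' k, En (N + 1 + k) s = (s - 1) * ∑' k : ℕ, ((k + N + 1 : ℕ) : ℂ) ^ (-s)
      + (0 - ((N + 1 : ℕ) : ℂ) ^ (1 - s)) := by
    rw [← tsum_mul_left, ← htel.tsum_eq,
      ← (((summable_nat_add_iff N).2 hsm).mul_left (s - 1)).tsum_add htel.summable]
    refine tsum_congr (fun k => ?_)
    have : k + N + 1 = N + 1 + k := by lia
    rw [this]; simp only [En]; ring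
  rw [ZN, htail, hz, hzs, ← hsplit]; ring

theorem ZN_eq (N : ℕ) (s : ℂ) (hs : 0 < s.re) : ZN N s = riemannZeta₁ s := by
  have hopen : IsOpen {s : ℂ | 0 < s.re} := isOpen_lt continuous_const Complex.continuous_re
  have h1 : AnalyticOnNhd ℂ (ZN N) {s | 0 < s.re} := (ZN_diff N).analyticOnNhd hopen
  have h2 : AnalyticOnNhd ℂ riemannZeta₁ {s | 0 < s.re} :=
    differentiable_riemannZeta₁.differentiableOn.analyticOnNhd hopen
  have hpre : IsPreconnected {s : ℂ | 0 < s.re} := (convex_halfSpace_re_gt 0).isPreconnected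
  refine h1.eqOn_of_preconnected_of_eventuallyEq h2 hpre (z₀ := 2) (by simp) ?_ hs
  have : {s : ℂ | 1 < s.re} ∈ nhds (2 : ℂ) :=
    (isOpen_lt continuous_const Complex.continuous_re).mem_nhds (by simp)
  filter_upwards [this] with z hz
  exact ZN_eq_re N z hz

end BK
end

section
open Real MeasureTheory
namespace BK

set_option maxHeartbeats 1000000 in
theorem zeta1_bound (ε : ℝ) (hε : 0 < ε) (hε2 : ε ≤ 1/4) : ∃ C > 0, ∀ T : ℝ, 1 ≤ T → ∀ s : ℂ,
    1 - ε ≤ s.re → s.re ≤ 3 → |s.im| ≤ T → ‖riemannZeta₁ s‖ ≤ C * T ^ (1 + 4 * ε) := by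
  have hS1 : Summable (fun n : ℕ => ((n + 1 : ℕ) : ℝ) ^ (-1 - ε)) :=
    (summable_nat_add_iff 1).2 ((Real.summable_nat_rpow (p := -1 - ε)).2 (by linarith))
  have hS2 : Summable (fun n : ℕ => (n : ℝ) ^ (-(5/4) : ℝ)) :=
    (Real.summable_nat_rpow (p := -(5/4))).2 (by norm_num)
  set Z1 := ∑' n : ℕ, ((n + 1 : ℕ) : ℝ) ^ (-1 - ε) with hZ1
  set Z2 := ∑' n : ℕ, (n : ℝ) ^ (-(5/4) : ℝ) with hZ2
  have hZ1n : 0 ≤ Z1 := tsum_nonneg (fun n => by positivity)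
  have hZ2n : 0 ≤ Z2 := tsum_nonneg (fun n => by positivity)
  refine ⟨4 * Z1 + 2 + 20 * Z2, by positivity, ?_⟩
  intro T hT s hs1 hs3 hst
  have hs0 : 0 < s.re := by linarith
  have hT0 : 0 < T := by linarith
  set N := ⌊T ^ 2⌋₊ with hN
  have hN1 : (N : ℝ) ≤ T ^ 2 := Nat.floor_le (by positivity)
  have hN2 : T ^ 2 < N + 1 := Nat.lt_floor_add_one _
  have hT2 : 1 ≤ T ^ 2 := one_le_pow₀ hT
  have hnb : ‖s‖ ≤ 4 * T := by
    refine (Complex.norm_le_abs_re_add_abs_im s).trans ?_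
    rw [abs_of_pos hs0]; linarith
  have hnb1 : ‖s - 1‖ ≤ 4 * T := by
    refine (Complex.norm_le_abs_re_add_abs_im _).trans ?_
    have : |(s - 1).re| ≤ 2 := by
      rw [abs_le]; simp; constructor <;> linarith
    have h2 : (s - 1).im = s.im := by simp
    rw [h2]; linarith
  rw [← ZN_eq N s hs0, ZN]
  have p1 : ‖∑ n ∈ Finset.range N, ((n + 1 : ℕ) : ℂ) ^ (-s)‖ ≤ T ^ (4 * ε) * Z1 := by
    refine (norm_sum_le _ _).trans ?_
    have : ∀ n ∈ Finset.range N, ‖((n + 1 : ℕ) : ℂ) ^ (-s)‖ ≤ T ^ (4 * ε) * ((n + 1 : ℕ) : ℝ) ^ (-1 - ε) := by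
      intro n hn
      have hn' : n + 1 ≤ N := by simpa using hn
      have hpos : (0 : ℝ) < ((n + 1 : ℕ) : ℝ) := by positivity
      have h1 : (1 : ℝ) ≤ ((n + 1 : ℕ) : ℝ) := by norm_cast; lia
      rw [Complex.norm_natCast_cpow_of_pos (by lia)]
      have h2 : ((n + 1 : ℕ) : ℝ) ^ (-s).re ≤ ((n + 1 : ℕ) : ℝ) ^ (2 * ε + (-1 - ε)) := by
        refine Real.rpow_le_rpow_of_exponent_le h1 ?_
        simp; linarith
      rw [Real.rpow_add hpos] at h2
      refine h2.trans (mul_le_mul_of_nonneg_right ?_ (by positivity))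
      have h3 : ((n + 1 : ℕ) : ℝ) ≤ T ^ (2 : ℝ) := by
        have : ((n + 1 : ℕ) : ℝ) ≤ N := by exact_mod_cast hn'
        rw [Real.rpow_two]; linarith
      calc ((n + 1 : ℕ) : ℝ) ^ (2 * ε) ≤ (T ^ (2 : ℝ)) ^ (2 * ε) :=
            Real.rpow_le_rpow hpos.le h3 (by linarith)
        _ = T ^ (4 * ε) := by rw [← Real.rpow_mul hT0.le]; congr 1; ring
    refine (Finset.sum_le_sum this).trans ?_
    rw [← Finset.mul_sum]
    refine mul_le_mul_of_nonneg_left ?_ (by positivity)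
    exact hS1.sum_le_tsum _ (fun n _ => by positivity)
  have p2 : ‖((N + 1 : ℕ) : ℂ) ^ (1 - s)‖ ≤ 2 * T ^ (2 * ε) := by
    rw [Complex.norm_natCast_cpow_of_pos (by lia)]
    have h1 : (1 : ℝ) ≤ ((N + 1 : ℕ) : ℝ) := by norm_cast; lia
    have h2 : ((N + 1 : ℕ) : ℝ) ^ (1 - s).re ≤ ((N + 1 : ℕ) : ℝ) ^ ε :=
      Real.rpow_le_rpow_of_exponent_le h1 (by simp; linarith)
    refine h2.trans ?_
    have h3 : ((N + 1 : ℕ) : ℝ) ≤ 2 * T ^ (2 : ℝ) := by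
      rw [Real.rpow_two]; push_cast; linarith
    calc ((N + 1 : ℕ) : ℝ) ^ ε ≤ (2 * T ^ (2 : ℝ)) ^ ε := Real.rpow_le_rpow (by positivity) h3 hε.le
      _ = 2 ^ ε * T ^ (2 * ε) := by
          rw [Real.mul_rpow (by norm_num) (by positivity), ← Real.rpow_mul hT0.le]
      _ ≤ 2 * T ^ (2 * ε) := by
          refine mul_le_mul_of_nonneg_right ?_ (by positivity)
          calc (2 : ℝ) ^ ε ≤ 2 ^ (1 : ℝ) := Real.rpow_le_rpow_of_exponent_le (by norm_num) (by linarith)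
            _ = 2 := Real.rpow_one 2
  have p3 : ‖∑' k : ℕ, En (N + 1 + k) s‖ ≤ 16 * T * Z2 := by
    have hb : ∀ k, ‖En (N + 1 + k) s‖ ≤ 16 * T * ((k + (N + 1) : ℕ) : ℝ) ^ (-(5/4) : ℝ) := by
      intro k
      have e1 : k + (N + 1) = N + 1 + k := by lia
      rw [e1]
      set m := N + 1 + k with hm
      have hm1 : (1 : ℝ) ≤ (m : ℝ) := by norm_cast; lia
      have hmT : T ^ 2 ≤ m := by rw [hm]; push_cast; linarith [(Nat.cast_nonneg k : (0:ℝ) ≤ k)]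
      refine (En_bound m (by lia) s hs0).trans ?_
      have h1 : (m : ℝ) ^ (-s.re - 1) ≤ (m : ℝ) ^ (-(1/2) + -(5/4) : ℝ) :=
        Real.rpow_le_rpow_of_exponent_le hm1 (by linarith)
      rw [Real.rpow_add (by linarith)] at h1
      have h2 : (m : ℝ) ^ (-(1/2) : ℝ) ≤ T⁻¹ := by
        calc (m : ℝ) ^ (-(1/2) : ℝ) ≤ (T ^ 2) ^ (-(1/2) : ℝ) :=
              Real.rpow_le_rpow_of_nonpos (by positivity) hmT (by norm_num)
          _ = T⁻¹ := by
              rw [← Real.rpow_two, ← Real.rpow_mul hT0.le]; norm_num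
              rw [Real.rpow_neg_one]
      calc ‖s‖ * ‖s - 1‖ * (m : ℝ) ^ (-s.re - 1) ≤ (4 * T) * (4 * T) * (T⁻¹ * (m : ℝ) ^ (-(5/4) : ℝ)) := by
            refine mul_le_mul ?_ (h1.trans ?_) (by positivity) (by positivity)
            · exact mul_le_mul hnb hnb1 (norm_nonneg _) (by positivity)
            · exact mul_le_mul_of_nonneg_right h2 (by positivity)
        _ = _ := by field_simp; ring
    have hs2' := (summable_nat_add_iff (N + 1)).2 hS2
    refine (tsum_of_norm_bounded ((hs2'.mul_left (16 * T)).hasSum) hb).trans ?_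
    rw [tsum_mul_left]
    refine mul_le_mul_of_nonneg_left ?_ (by positivity)
    have := hS2.sum_add_tsum_nat_add (N + 1)
    rw [hZ2, ← this]
    have : 0 ≤ ∑ i ∈ Finset.range (N + 1), (i : ℝ) ^ (-(5/4) : ℝ) := Finset.sum_nonneg (fun i _ => by positivity)
    linarith
  have q1 : T ^ (2 * ε) ≤ T ^ (1 + 4 * ε) := Real.rpow_le_rpow_of_exponent_le hT (by linarith)
  have q2 : T ≤ T ^ (1 + 4 * ε) := by
    conv_lhs => rw [← Real.rpow_one T]
    exact Real.rpow_le_rpow_of_exponent_le hT (by linarith)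
  have q3 : T * T ^ (4 * ε) = T ^ (1 + 4 * ε) := by rw [Real.rpow_add hT0, Real.rpow_one]
  have f1 : ‖(s - 1) * (∑ n ∈ Finset.range N, ((n + 1 : ℕ) : ℂ) ^ (-s))‖ ≤ 4 * Z1 * T ^ (1 + 4 * ε) := by
    rw [norm_mul, ← q3]
    calc _ ≤ (4 * T) * (T ^ (4 * ε) * Z1) := mul_le_mul hnb1 p1 (norm_nonneg _) (by positivity)
      _ = _ := by ring
  have f3 : 16 * T * Z2 ≤ 20 * Z2 * T ^ (1 + 4 * ε) := by
    have := mul_le_mul_of_nonneg_left q2 hZ2n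
    have h2 : 0 ≤ Z2 * T ^ (1 + 4 * ε) := by positivity
    nlinarith
  refine (norm_add_le _ _).trans ?_
  have := norm_add_le ((s - 1) * (∑ n ∈ Finset.range N, ((n + 1 : ℕ) : ℂ) ^ (-s))) (((N + 1 : ℕ) : ℂ) ^ (1 - s))
  have e : (4 * Z1 + 2 + 20 * Z2) * T ^ (1 + 4 * ε) = 4 * Z1 * T ^ (1 + 4 * ε) + 2 * T ^ (1 + 4 * ε) + 20 * Z2 * T ^ (1 + 4 * ε) := by ring
  rw [e]
  linarith

theorem zeta1_deriv_bound (ε : ℝ) (hε : 0 < ε) (hε2 : ε ≤ 1/4) : ∃ C > 0, ∀ T : ℝ, 1 ≤ T → ∀ s : ℂ,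
    1 - ε / 2 ≤ s.re → s.re ≤ 2 → |s.im| ≤ T → ‖deriv riemannZeta₁ s‖ ≤ C * T ^ (1 + 4 * ε) := by
  obtain ⟨C, hC, h⟩ := zeta1_bound ε hε hε2
  refine ⟨C * 2 ^ (1 + 4 * ε) / (ε / 2), by positivity, ?_⟩
  intro T hT s h1 h2 h3
  have hT0 : 0 < T := by linarith
  have := Complex.norm_deriv_le_of_forall_mem_sphere_norm_le (f := riemannZeta₁) (c := s) (R := ε / 2)
    (C := C * (2 * T) ^ (1 + 4 * ε)) (by positivity) differentiable_riemannZeta₁.diffContOnCl ?_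
  · refine this.trans (le_of_eq ?_)
    rw [Real.mul_rpow (by norm_num) hT0.le]; ring
  · intro z hz
    rw [mem_sphere_iff_norm] at hz
    have a1 := (Complex.abs_re_le_norm (z - s)); have a2 := (Complex.abs_im_le_norm (z - s))
    rw [hz, Complex.sub_re, abs_le] at a1
    rw [hz, Complex.sub_im, abs_le] at a2
    rw [abs_le] at h3
    refine h (2 * T) (by linarith) z (by linarith) (by linarith) ?_
    rw [abs_le]; constructor <;> linarith

theorem zeta_341 (x : ℝ) (hx : 0 < x) (y : ℝ) (hy : y ≠ 0) :
    x ^ 3 * |y| ^ 5 ≤ ‖riemannZeta₁ (1 + x)‖ ^ 3 * ‖riemannZeta₁ (1 + x + Complex.I * y)‖ ^ 4 *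
      ‖riemannZeta₁ (1 + x + 2 * Complex.I * y)‖ := by
  have h := DirichletCharacter.norm_LFunction_product_ge_one (1 : DirichletCharacter ℂ 1) hx y
  rw [DirichletCharacter.LFunctionTrivChar] at h
  simp only [one_pow, DirichletCharacter.LFunction_modOne_eq] at h
  have n1 : (1 + x : ℂ) ≠ 1 := by simp [hx.ne']
  have n2 : (1 + x + Complex.I * y : ℂ) ≠ 1 := by
    intro h; have := congrArg Complex.im h; simp at this; exact hy this
  have n3 : (1 + x + 2 * Complex.I * y : ℂ) ≠ 1 := by
    intro h; have := congrArg Complex.im h; simp at this; exact hy this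
  have z : ∀ s : ℂ, s ≠ 1 → ‖riemannZeta₁ s‖ = ‖s - 1‖ * ‖riemannZeta s‖ := by
    intro s hs
    rw [← norm_mul, riemannZeta_eq_inv_sub_mul hs, mul_inv_cancel_left₀ (sub_ne_zero.2 hs)]
  rw [z _ n1, z _ n2, z _ n3]
  have m1 : ‖(1 + x : ℂ) - 1‖ = x := by simp [abs_of_pos hx]
  have m2 : |y| ≤ ‖(1 + x + Complex.I * y : ℂ) - 1‖ := by
    have := Complex.abs_im_le_norm ((1 + x + Complex.I * y : ℂ) - 1); simpa using this
  have m3 : |y| ≤ ‖(1 + x + 2 * Complex.I * y : ℂ) - 1‖ := by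
    have := Complex.abs_im_le_norm ((1 + x + 2 * Complex.I * y : ℂ) - 1)
    simp [abs_mul] at this ⊢
    linarith [abs_nonneg y]
  rw [m1]
  rw [norm_mul, norm_mul, norm_pow, norm_pow] at h
  set a := ‖riemannZeta (1 + x)‖
  set b := ‖riemannZeta (1 + x + Complex.I * y)‖
  set d := ‖riemannZeta (1 + x + 2 * Complex.I * y)‖
  set u := ‖(1 + x + Complex.I * y : ℂ) - 1‖
  set v := ‖(1 + x + 2 * Complex.I * y : ℂ) - 1‖
  have hh : |y| ^ 5 ≤ u ^ 4 * v := by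
    calc |y| ^ 5 = |y| ^ 4 * |y| := by ring
      _ ≤ u ^ 4 * v := by gcongr
  have e : (x * a) ^ 3 * (u * b) ^ 4 * (v * d) = x ^ 3 * (u ^ 4 * v) * (a ^ 3 * b ^ 4 * d) := by ring
  rw [e]
  calc x ^ 3 * |y| ^ 5 ≤ x ^ 3 * (u ^ 4 * v) := by gcongr
    _ = x ^ 3 * (u ^ 4 * v) * 1 := by ring
    _ ≤ _ := by
      refine mul_le_mul_of_nonneg_left h (by positivity)

end BK
end

section
open Real MeasureTheory
namespace BK

theorem zeta1_lower (ε : ℝ) (hε : 0 < ε) (hε2 : ε ≤ 1/4) : ∃ c > 0, ∀ q : ℝ, 0 < q → q ≤ 1 →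
    ∀ y : ℝ, 1 ≤ |y| → c * q ^ 3 * |y| ^ (1 - ε) ≤ ‖riemannZeta₁ (1 + ((q ^ 4 : ℝ) : ℂ) + Complex.I * y)‖ := by
  obtain ⟨C, hC, hb⟩ := zeta1_bound ε hε hε2
  set K := C ^ 4 * 4 with hK
  have hK0 : 0 < K := by positivity
  refine ⟨K ^ (-(1/4) : ℝ), by positivity, ?_⟩
  intro q hq hq1 y hy
  have hy0 : y ≠ 0 := by rintro rfl; simp at hy; linarith
  have hY0 : 0 < |y| := by linarith
  have hq4 : q ^ 4 ≤ 1 := pow_le_one₀ hq.le hq1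
  have hq40 : 0 < q ^ 4 := by positivity
  have h341 := zeta_341 (q ^ 4) hq40 y hy0
  have b1 : ‖riemannZeta₁ (1 + ((q ^ 4 : ℝ) : ℂ))‖ ≤ C := by
    have := hb 1 le_rfl (1 + ((q ^ 4 : ℝ) : ℂ)) (by rw [Complex.add_re, Complex.ofReal_re]; simp; linarith)
      (by rw [Complex.add_re, Complex.ofReal_re]; simp; linarith)
      (by rw [Complex.add_im, Complex.ofReal_im]; simp)
    simpa using this
  have b2 : ‖riemannZeta₁ (1 + ((q ^ 4 : ℝ) : ℂ) + 2 * Complex.I * y)‖ ≤ C * 4 * |y| ^ (1 + 4 * ε) := by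
    have := hb (2 * |y|) (by linarith) (1 + ((q ^ 4 : ℝ) : ℂ) + 2 * Complex.I * y)
      (by rw [Complex.add_re, Complex.add_re, Complex.ofReal_re]; simp; linarith)
      (by rw [Complex.add_re, Complex.add_re, Complex.ofReal_re]; simp; linarith)
      (by rw [Complex.add_im, Complex.add_im, Complex.ofReal_im]; simp [abs_mul])
    refine this.trans ?_
    rw [Real.mul_rpow (by norm_num) hY0.le, ← mul_assoc]
    refine mul_le_mul_of_nonneg_right (mul_le_mul_of_nonneg_left ?_ hC.le) (by positivity)
    calc (2 : ℝ) ^ (1 + 4 * ε) ≤ 2 ^ (2 : ℝ) := Real.rpow_le_rpow_of_exponent_le (by norm_num) (by linarith)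
      _ = 4 := by norm_num
  set b := ‖riemannZeta₁ (1 + ((q ^ 4 : ℝ) : ℂ) + Complex.I * y)‖ with hbdef
  have hbn : 0 ≤ b := norm_nonneg _
  have h2 : (q ^ 4) ^ 3 * |y| ^ 5 ≤ C ^ 3 * b ^ 4 * (C * 4 * |y| ^ (1 + 4 * ε)) := by
    refine h341.trans ?_
    gcongr
  have h3 : |y| ^ 5 = |y| ^ (4 - 4 * ε) * |y| ^ (1 + 4 * ε) := by
    rw [← Real.rpow_add hY0, ← Real.rpow_natCast]; congr 1; push_cast; ring
  have hp : 0 < |y| ^ (1 + 4 * ε) := by positivity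
  have h4 : (q ^ 4) ^ 3 * |y| ^ (4 - 4 * ε) ≤ K * b ^ 4 := by
    rw [h3] at h2
    refine le_of_mul_le_mul_right ?_ hp
    calc _ = (q ^ 4) ^ 3 * (|y| ^ (4 - 4 * ε) * |y| ^ (1 + 4 * ε)) := by ring
      _ ≤ _ := h2
      _ = _ := by rw [hK]; ring
  refine le_of_pow_le_pow_left₀ (n := 4) (by norm_num) hbn ?_
  have e1 : (K ^ (-(1/4) : ℝ)) ^ 4 = K⁻¹ := by
    rw [← Real.rpow_natCast, ← Real.rpow_mul hK0.le, ← Real.rpow_neg_one]; norm_num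
  have e2 : (|y| ^ (1 - ε)) ^ 4 = |y| ^ (4 - 4 * ε) := by
    rw [← Real.rpow_natCast, ← Real.rpow_mul hY0.le]; congr 1; push_cast; ring
  rw [mul_pow, mul_pow, e1, e2]
  rw [mul_assoc, inv_mul_le_iff₀ hK0]
  calc _ = (q ^ 4) ^ 3 * |y| ^ (4 - 4 * ε) := by ring
    _ ≤ _ := h4

theorem zeta_region_large (ε : ℝ) (hε : 0 < ε) (hε2 : ε ≤ 1/4) : ∃ C > 0, ∃ κ > 0, ∀ s : ℂ,
    1 ≤ |s.im| → 1 - κ * |s.im| ^ (-(20 * ε)) ≤ s.re → s.re ≤ 2 →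
    riemannZeta₁ s ≠ 0 ∧ ‖deriv riemannZeta₁ s / riemannZeta₁ s‖ ≤ C * |s.im| ^ (20 * ε) := by
  obtain ⟨c, hc, hlow⟩ := zeta1_lower ε hε hε2
  obtain ⟨D, hD, hder⟩ := zeta1_deriv_bound ε hε hε2
  set k := min (ε / 2) (c / (4 * D)) with hk
  have hk0 : 0 < k := by positivity
  have hk1 : k ≤ ε / 2 := min_le_left _ _
  have hk2 : k * (4 * D) ≤ c := by
    rw [← le_div_iff₀ (by positivity)]; exact min_le_right _ _
  refine ⟨2 * D / c / k ^ 3, by positivity, k ^ 4, by positivity, ?_⟩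
  intro s hy hs1 hs2
  set y := |s.im| with hydef
  have hY0 : 0 < y := by linarith
  set q := k * y ^ (-(5 * ε)) with hq
  have hq0 : 0 < q := by positivity
  have hyle : y ^ (-(5 * ε)) ≤ 1 := Real.rpow_le_one_of_one_le_of_nonpos hy (by linarith)
  have hqk : q ≤ k := mul_le_of_le_one_right hk0.le hyle
  have hq1 : q ≤ 1 := by linarith
  have hq4 : q ^ 4 = k ^ 4 * y ^ (-(20 * ε)) := by
    rw [hq, mul_pow, ← Real.rpow_natCast (y ^ (-(5 * ε))), ← Real.rpow_mul hY0.le]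
    congr 2; push_cast; ring
  rw [← hq4] at hs1
  have hq4k : q ^ 4 ≤ q := by
    calc q ^ 4 ≤ q ^ 1 := pow_le_pow_of_le_one hq0.le hq1 (by norm_num)
      _ = q := pow_one q
  have hqe : q ^ 4 ≤ ε / 2 := by linarith
  have hse : s = ((s.re : ℝ) : ℂ) + Complex.I * (s.im : ℝ) := by
    rw [mul_comm]; exact (Complex.re_add_im s).symm
  have hdy : ∀ z : ℂ, 1 - ε / 2 ≤ z.re → z.re ≤ 2 → |z.im| ≤ y → ‖deriv riemannZeta₁ z‖ ≤ D * y ^ (1 + 4 * ε) :=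
    fun z => hder y hy z
  have hlower : c / 2 * q ^ 3 * y ^ (1 - ε) ≤ ‖riemannZeta₁ s‖ := by
    by_cases hcase : 1 + q ^ 4 ≤ s.re
    · set r := (s.re - 1) ^ (1/4 : ℝ) with hr
      have hsr : 0 < s.re - 1 := by nlinarith [pow_pos hq0 4]
      have hr4 : r ^ 4 = s.re - 1 := by
        rw [hr, ← Real.rpow_natCast, ← Real.rpow_mul hsr.le]; norm_num
      have hr0 : 0 < r := by positivity
      have hr1 : r ≤ 1 := Real.rpow_le_one hsr.le (by linarith) (by norm_num)
      have hqr : q ≤ r := le_of_pow_le_pow_left₀ (n := 4) (by norm_num) hr0.le (by linarith)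
      have := hlow r hr0 hr1 s.im hy
      rw [hr4] at this
      have e : (1 : ℂ) + ((s.re - 1 : ℝ) : ℂ) + Complex.I * (s.im : ℝ) = s := by
        conv_rhs => rw [hse]
        push_cast; ring
      rw [e] at this
      refine le_trans ?_ this
      have h3 : q ^ 3 ≤ r ^ 3 := by gcongr
      have : c / 2 * q ^ 3 ≤ c * r ^ 3 := by
        have := mul_le_mul_of_nonneg_left h3 hc.le
        have : 0 < c * q ^ 3 := by positivity
        linarith
      exact mul_le_mul_of_nonneg_right this (by positivity)
    · push Not at hcase
      set z : ℂ := 1 + ((q ^ 4 : ℝ) : ℂ) + Complex.I * (s.im : ℝ) with hz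
      have hzre : z.re = 1 + q ^ 4 := by
        rw [hz, Complex.add_re, Complex.add_re, Complex.ofReal_re]; simp
      have hzim : z.im = s.im := by
        rw [hz, Complex.add_im, Complex.add_im, Complex.ofReal_im]; simp
      have hzl := hlow q hq0 hq1 s.im hy
      have hconv : Convex ℝ {w : ℂ | 1 - ε / 2 ≤ w.re ∧ w.re ≤ 2 ∧ w.im = s.im} := by
        refine (convex_halfSpace_re_ge _).inter ((convex_halfSpace_re_le _).inter ?_)
        exact convex_hyperplane (IsLinearMap.mk Complex.add_im Complex.smul_im) _
      have hmv := hconv.norm_image_sub_le_of_norm_deriv_le (f := riemannZeta₁) (x := s) (y := z)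
        (C := D * y ^ (1 + 4 * ε)) (fun w _ => differentiable_riemannZeta₁ w)
        (fun w hw => hdy w hw.1 hw.2.1 (by rw [hw.2.2])) ⟨by linarith, hs2, rfl⟩
        ⟨by rw [hzre]; linarith [pow_pos hq0 4], by rw [hzre]; linarith, hzim⟩
      have hdist : ‖z - s‖ ≤ 2 * q ^ 4 := by
        refine (Complex.norm_le_abs_re_add_abs_im _).trans ?_
        rw [Complex.sub_re, Complex.sub_im, hzre, hzim, sub_self, abs_zero, add_zero, abs_le]
        constructor <;> linarith
      have hsmall : ‖riemannZeta₁ z - riemannZeta₁ s‖ ≤ c / 2 * q ^ 3 * y ^ (1 - ε) := by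
        refine hmv.trans ?_
        calc D * y ^ (1 + 4 * ε) * ‖z - s‖ ≤ D * y ^ (1 + 4 * ε) * (2 * q ^ 4) := by gcongr
          _ = 2 * D * q ^ 3 * (k * (y ^ (-(5 * ε)) * y ^ (1 + 4 * ε))) := by
              have : q ^ 4 = q ^ 3 * (k * y ^ (-(5 * ε))) := by rw [← hq]; ring
              rw [this]; ring
          _ = 2 * D * q ^ 3 * (k * y ^ (1 - ε)) := by
              rw [← Real.rpow_add hY0]; congr 3; ring
          _ = (k * (4 * D)) * (q ^ 3 * y ^ (1 - ε)) / 2 := by ring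
          _ ≤ c * (q ^ 3 * y ^ (1 - ε)) / 2 := by gcongr
          _ = _ := by ring
      have h5 := norm_sub_norm_le (riemannZeta₁ z) (riemannZeta₁ s)
      have h6 : c * q ^ 3 * y ^ (1 - ε) = 2 * (c / 2 * q ^ 3 * y ^ (1 - ε)) := by ring
      linarith
  have hpos : 0 < c / 2 * q ^ 3 * y ^ (1 - ε) := by positivity
  refine ⟨norm_pos_iff.1 (by linarith), ?_⟩
  rw [norm_div, div_le_iff₀ (by linarith)]
  refine (hdy s (by linarith) hs2 le_rfl).trans ?_
  refine le_trans ?_ (mul_le_mul_of_nonneg_left hlower (by positivity))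
  refine le_of_eq ?_
  have e3 : q ^ 3 = k ^ 3 * y ^ (-(15 * ε)) := by
    rw [hq, mul_pow, ← Real.rpow_natCast (y ^ (-(5 * ε))), ← Real.rpow_mul hY0.le]
    congr 2; push_cast; ring
  have e4 : y ^ (1 + 4 * ε) = y ^ (20 * ε) * y ^ (-(15 * ε)) * y ^ (1 - ε) := by
    rw [← Real.rpow_add hY0, ← Real.rpow_add hY0]; congr 1; ring
  rw [e3, e4]; field_simp

theorem zeta1_ne (s : ℂ) (hs : 1 ≤ s.re) : riemannZeta₁ s ≠ 0 := by
  by_cases h : s = 1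
  · rw [h]; simp
  · have := riemannZeta_ne_zero_of_one_le_re hs
    rw [riemannZeta_eq_inv_sub_mul h] at this
    exact right_ne_zero_of_mul this

theorem zeta_region_small : ∃ C > 0, ∃ κ > 0, ∀ s : ℂ,
    |s.im| ≤ 1 → 1 - κ ≤ s.re → s.re ≤ 2 →
    riemannZeta₁ s ≠ 0 ∧ ‖deriv riemannZeta₁ s / riemannZeta₁ s‖ ≤ C := by
  set K : Set ℂ := Set.Icc 1 2 ×ℂ Set.Icc (-1) 1 with hK
  have hKc : IsCompact K := isCompact_Icc.reProdIm isCompact_Icc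
  have hU : IsOpen {s : ℂ | riemannZeta₁ s ≠ 0} :=
    isOpen_ne_fun differentiable_riemannZeta₁.continuous continuous_const
  have hKU : K ⊆ {s : ℂ | riemannZeta₁ s ≠ 0} := by
    intro s hs
    rw [hK, Complex.mem_reProdIm] at hs
    exact zeta1_ne s hs.1.1
  obtain ⟨δ, hδ, hsub⟩ := hKc.exists_cthickening_subset_open hU hKU
  have hcc := hKc.cthickening (r := δ)
  obtain ⟨C, hC⟩ := hcc.exists_bound_of_continuousOn (f := fun s => deriv riemannZeta₁ s / riemannZeta₁ s)
    (differentiable_riemannZeta₁.deriv.continuous.continuousOn.div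
      differentiable_riemannZeta₁.continuous.continuousOn (fun s hs => hsub hs))
  refine ⟨max C 1, by positivity, δ, hδ, ?_⟩
  intro s h1 h2 h3
  have hmem : s ∈ Metric.cthickening δ K := by
    refine Metric.mem_cthickening_of_dist_le s (⟨max s.re 1, s.im⟩ : ℂ) δ K ?_ ?_
    · rw [hK, Complex.mem_reProdIm]
      exact ⟨⟨le_max_right _ _, max_le h3 (by norm_num)⟩, abs_le.1 h1⟩
    · rw [Complex.dist_eq]
      refine (Complex.norm_le_abs_re_add_abs_im _).trans ?_
      simp only [Complex.sub_re, Complex.sub_im, sub_self, abs_zero, add_zero]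
      rw [abs_le]
      rcases max_cases s.re 1 with ⟨h, _⟩ | ⟨h, _⟩ <;> rw [h] <;> constructor <;> linarith
  exact ⟨hsub hmem, (hC s hmem).trans (le_max_left _ _)⟩

theorem zeta_region (ε : ℝ) (hε : 0 < ε) (hε2 : ε ≤ 1) : ∃ C > 0, ∃ κ > 0, ∀ T : ℝ, 1 ≤ T → ∀ s : ℂ,
    |s.im| ≤ T → 1 - κ * T ^ (-ε) ≤ s.re → s.re ≤ 2 →
    riemannZeta₁ s ≠ 0 ∧ ‖deriv riemannZeta₁ s / riemannZeta₁ s‖ ≤ C * T ^ ε := by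
  obtain ⟨C1, hC1, κ1, hκ1, h1⟩ := zeta_region_large (ε / 20) (by positivity) (by linarith)
  obtain ⟨C2, hC2, κ2, hκ2, h2⟩ := zeta_region_small
  have e20 : 20 * (ε / 20) = ε := by ring
  rw [e20] at h1
  refine ⟨max C1 C2, by positivity, min κ1 κ2, by positivity, ?_⟩
  intro T hT s hs1 hs2 hs3
  have hT0 : 0 < T := by linarith
  by_cases hc : 1 ≤ |s.im|
  · have hh : 1 - κ1 * |s.im| ^ (-ε) ≤ s.re := by
      have : T ^ (-ε) ≤ |s.im| ^ (-ε) := Real.rpow_le_rpow_of_nonpos (by linarith) hs1 (by linarith)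
      have h3 : min κ1 κ2 * T ^ (-ε) ≤ κ1 * |s.im| ^ (-ε) :=
        mul_le_mul (min_le_left _ _) this (by positivity) hκ1.le
      linarith
    obtain ⟨a, b⟩ := h1 s hc hh hs3
    refine ⟨a, b.trans ?_⟩
    exact mul_le_mul (le_max_left _ _) (Real.rpow_le_rpow (by positivity) hs1 hε.le)
      (by positivity) (by positivity)
  · push Not at hc
    have hT1 : T ^ (-ε) ≤ 1 := Real.rpow_le_one_of_one_le_of_nonpos hT (by linarith)
    have h3 : min κ1 κ2 * T ^ (-ε) ≤ κ2 * 1 :=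
      mul_le_mul (min_le_right _ _) hT1 (by positivity) hκ2.le
    obtain ⟨a, b⟩ := h2 s hc.le (by linarith) hs3
    refine ⟨a, b.trans ?_⟩
    have : 1 ≤ T ^ ε := Real.one_le_rpow hT hε.le
    calc C2 ≤ max C1 C2 := le_max_right _ _
      _ = max C1 C2 * 1 := (mul_one _).symm
      _ ≤ _ := by gcongr

end BK
end

section
open Real MeasureTheory
namespace BK

noncomputable def Qz (s : ℂ) : ℂ := deriv riemannZeta₁ s / riemannZeta₁ s

noncomputable def Ff (δ l σ : ℝ) (z : ℂ) : ℂ :=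
  (δ : ℂ) * Complex.exp (-((π * δ ^ 2 : ℝ) : ℂ) * z ^ 2) * Complex.exp (((2 * π * l : ℝ) : ℂ) * Complex.I * z)
    * Qz ((σ : ℂ) + ((2 * π : ℝ) : ℂ) * Complex.I * z)

theorem Ff_norm (δ l σ : ℝ) (hδ : 0 < δ) (v w : ℝ) :
    ‖Ff δ l σ ((v : ℂ) + (w : ℂ) * Complex.I)‖ = δ * Real.exp (-(π * δ ^ 2) * (v ^ 2 - w ^ 2))
      * Real.exp (-(2 * π * l) * w) * ‖Qz (⟨σ - 2 * π * w, 2 * π * v⟩ : ℂ)‖ := by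
  unfold Ff
  rw [norm_mul, norm_mul, norm_mul, Complex.norm_exp, Complex.norm_exp, Complex.norm_real,
    Real.norm_eq_abs, abs_of_pos hδ]
  have e1 : (-((π * δ ^ 2 : ℝ) : ℂ) * ((v : ℂ) + (w : ℂ) * Complex.I) ^ 2).re = -(π * δ ^ 2) * (v ^ 2 - w ^ 2) := by
    rw [← Complex.ofReal_neg, Complex.re_ofReal_mul]; simp [pow_two]
  have e2 : (((2 * π * l : ℝ) : ℂ) * Complex.I * ((v : ℂ) + (w : ℂ) * Complex.I)).re = -(2 * π * l) * w := by
    rw [mul_assoc, Complex.re_ofReal_mul]; simp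
  have e3 : (σ : ℂ) + ((2 * π : ℝ) : ℂ) * Complex.I * ((v : ℂ) + (w : ℂ) * Complex.I) = ⟨σ - 2 * π * w, 2 * π * v⟩ := by
    apply Complex.ext
    · rw [Complex.add_re, mul_assoc, Complex.re_ofReal_mul]; simp; ring
    · rw [Complex.add_im, mul_assoc, Complex.im_ofReal_mul]; simp
  rw [e1, e2, e3]

theorem gk_one (D : ℝ) (hD : 0 < D) : ∫ x, gk D x = 1 := by
  have := gk_ft D hD 0
  simp only [mul_zero, e_zero, one_mul, gw] at this
  rw [integral_complex_ofReal] at this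
  have h2 := Complex.ofReal_inj.1 this
  simpa using h2

theorem gk_sqrt (δ x : ℝ) : δ * Real.exp (-(π * δ ^ 2 / 2) * x ^ 2) = √2 * gk (δ / √2) x := by
  unfold gk
  have h2 : √2 ≠ 0 := by positivity
  have : (δ / √2) ^ 2 = δ ^ 2 / 2 := by rw [div_pow, Real.sq_sqrt (by norm_num)]
  rw [this]
  have e : -(π * (δ ^ 2 / 2)) = -(π * δ ^ 2 / 2) := by ring
  rw [e]; field_simp

theorem Qz_cont (σ : ℝ) (hσ : 1 ≤ σ) : Continuous (fun v : ℝ => Qz ((σ : ℂ) + ((2 * π : ℝ) : ℂ) * Complex.I * v)) := by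
  unfold Qz
  refine Continuous.div ?_ ?_ ?_
  · exact differentiable_riemannZeta₁.deriv.continuous.comp (by fun_prop)
  · exact differentiable_riemannZeta₁.continuous.comp (by fun_prop)
  · intro v
    refine zeta1_ne _ ?_
    rw [Complex.add_re, mul_assoc, Complex.re_ofReal_mul]; simpa using hσ

theorem Ff_cont (δ l σ : ℝ) (hσ : 1 ≤ σ) : Continuous (fun v : ℝ => Ff δ l σ v) := by
  unfold Ff
  exact Continuous.mul (by fun_prop) (Qz_cont σ hσ)

theorem Ff_norm_real (δ l σ : ℝ) (hδ : 0 < δ) (v : ℝ) :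
    ‖Ff δ l σ v‖ = gk δ v * ‖Qz (⟨σ, 2 * π * v⟩ : ℂ)‖ := by
  have := Ff_norm δ l σ hδ v 0
  simp only [Complex.ofReal_zero, zero_mul, add_zero] at this
  rw [this]; simp [gk]

set_option maxHeartbeats 1000000 in
theorem contour (δ l σ V B a M : ℝ) (hδ : 0 < δ) (hδ1 : δ ≤ 1/2) (hσ : 1 < σ) (hσ2 : σ + a ≤ 2) (ha : 0 ≤ a)
    (hV : 0 < V) (hB : 0 ≤ B) (hM : 0 ≤ M) (hl : 0 < l)
    (h1 : ∀ s : ℂ, |s.im| ≤ 2 * π * V → 1 - a ≤ s.re → s.re ≤ σ → riemannZeta₁ s ≠ 0 ∧ ‖Qz s‖ ≤ B)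
    (h2 : ∀ t : ℝ, ‖Qz (⟨σ, t⟩ : ℂ)‖ ≤ M) :
    ‖∫ v : ℝ, Ff δ l σ v‖ ≤ 2 * B * Real.exp (-(a * l)) + 4 * B * Real.exp (-(π * (δ * V) ^ 2))
      + 2 * M * Real.exp (-(π * (δ * V) ^ 2 / 2)) := by
  have hπ := Real.pi_pos
  have hπ3 := Real.pi_gt_three
  set w0 := (σ - 1 + a) / (2 * π) with hw0
  have hw0e : 2 * π * w0 = σ - 1 + a := by rw [hw0]; field_simp
  have hw0p : 0 < w0 := by rw [hw0]; apply div_pos <;> linarith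
  have hw01 : w0 ≤ 1/6 := by
    by_contra hc
    push Not at hc
    have : 2 * π * w0 ≤ 1 := by linarith
    nlinarith
  have hexp2 : ∀ w, 0 ≤ w → w ≤ w0 → Real.exp (π * δ ^ 2 * w ^ 2) ≤ 2 := by
    intro w hw hw'
    have hd2 : δ ^ 2 ≤ 1/4 := by nlinarith
    have hw2 : w ^ 2 ≤ 1/36 := by nlinarith
    have : π * δ ^ 2 * w ^ 2 ≤ 4 * (1/4) * (1/36) := by
      gcongr; exact Real.pi_le_four
    have h3 : Real.exp (π * δ ^ 2 * w ^ 2) ≤ Real.exp (1/36) := Real.exp_le_exp.2 (by linarith)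
    have h4 : Real.exp (1/36) ≤ 2 := by
      have := Real.exp_bound_div_one_sub_of_interval (x := 1/36) (by norm_num) (by norm_num)
      linarith [this, (by norm_num : (1:ℝ) / (1 - 1/36) ≤ 2)]
    linarith
  have hintg : Integrable (fun v : ℝ => Ff δ l σ v) := by
    refine ((gk_int δ hδ).mul_const M).mono' (Ff_cont δ l σ hσ.le).aestronglyMeasurable ?_
    refine Filter.Eventually.of_forall (fun v => ?_)
    rw [Ff_norm_real δ l σ hδ]
    exact mul_le_mul_of_nonneg_left (h2 _) (gk_nonneg δ v hδ)
  -- rectangle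
  have hrect := Complex.integral_boundary_rect_eq_zero_of_differentiableOn (Ff δ l σ)
    (⟨-V, 0⟩ : ℂ) (⟨V, w0⟩ : ℂ) ?_
  swap
  · intro z hz
    rw [Complex.mem_reProdIm, Set.uIcc_of_le (by simp; linarith), Set.uIcc_of_le (by simpa using hw0p.le)] at hz
    obtain ⟨hz1, hz2⟩ := hz
    simp only at hz1 hz2
    have hne : riemannZeta₁ ((σ : ℂ) + ((2 * π : ℝ) : ℂ) * Complex.I * z) ≠ 0 := by
      refine (h1 _ ?_ ?_ ?_).1
      · rw [Complex.add_im, mul_assoc, Complex.im_ofReal_mul]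
        simp only [Complex.ofReal_im, zero_add, Complex.I_mul_im]
        rw [abs_mul, abs_of_pos (by positivity : 0 < 2 * π)]
        exact mul_le_mul_of_nonneg_left (abs_le.2 hz1) (by positivity)
      · rw [Complex.add_re, mul_assoc, Complex.re_ofReal_mul]
        simp only [Complex.ofReal_re, Complex.I_mul_re]
        have := mul_le_mul_of_nonneg_left hz2.2 (by positivity : 0 ≤ 2 * π)
        linarith
      · rw [Complex.add_re, mul_assoc, Complex.re_ofReal_mul]
        simp only [Complex.ofReal_re, Complex.I_mul_re]
        have := mul_nonneg (by positivity : 0 ≤ 2 * π) hz2.1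
        linarith
    refine DifferentiableAt.differentiableWithinAt ?_
    unfold Ff Qz
    refine DifferentiableAt.mul (by fun_prop) (DifferentiableAt.div ?_ ?_ hne)
    · exact (differentiable_riemannZeta₁.deriv _).comp z (by fun_prop)
    · exact (differentiable_riemannZeta₁ _).comp z (by fun_prop)
  simp only [Complex.ofReal_zero, zero_mul, add_zero] at hrect
  -- Qz bound in the rectangle
  have hQ : ∀ v w : ℝ, |v| ≤ V → 0 ≤ w → w ≤ w0 → ‖Qz (⟨σ - 2 * π * w, 2 * π * v⟩ : ℂ)‖ ≤ B := by
    intro v w hv hw hw'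
    refine (h1 _ ?_ ?_ ?_).2
    · simp only; rw [abs_mul, abs_of_pos (by positivity : 0 < 2 * π)]
      exact mul_le_mul_of_nonneg_left hv (by positivity)
    · simp only
      have := mul_le_mul_of_nonneg_left hw' (by positivity : 0 ≤ 2 * π)
      linarith
    · simp only
      have := mul_nonneg (by positivity : 0 ≤ 2 * π) hw
      linarith
  have hside : ∀ v : ℝ, |v| = V → ‖∫ y in (0 : ℝ)..w0, Ff δ l σ ((v : ℂ) + y * Complex.I)‖ ≤
      2 * B * Real.exp (-(π * (δ * V) ^ 2)) := by
    intro v hv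
    have hv2 : v ^ 2 = V ^ 2 := by rw [← sq_abs, hv]
    have := intervalIntegral.norm_integral_le_of_norm_le_const (a := 0) (b := w0)
      (f := fun y : ℝ => Ff δ l σ ((v : ℂ) + y * Complex.I)) (C := 2 * B * Real.exp (-(π * (δ * V) ^ 2))) ?_
    · refine this.trans ?_
      rw [sub_zero, abs_of_pos hw0p]
      exact mul_le_of_le_one_right (by positivity) (by linarith)
    · intro y hy
      rw [Set.uIoc_of_le hw0p.le] at hy
      rw [Ff_norm δ l σ hδ, hv2]
      have e1 : Real.exp (-(π * δ ^ 2) * (V ^ 2 - y ^ 2)) = Real.exp (-(π * (δ * V) ^ 2)) * Real.exp (π * δ ^ 2 * y ^ 2) := by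
        rw [← Real.exp_add]; congr 1; ring
      have e2 : Real.exp (-(2 * π * l) * y) ≤ 1 := by
        rw [Real.exp_le_one_iff]
        have := mul_nonneg (by positivity : 0 ≤ 2 * π * l) hy.1.le
        linarith
      rw [e1]
      calc δ * (Real.exp (-(π * (δ * V) ^ 2)) * Real.exp (π * δ ^ 2 * y ^ 2)) * Real.exp (-(2 * π * l) * y)
            * ‖Qz (⟨σ - 2 * π * y, 2 * π * v⟩ : ℂ)‖
          ≤ 1 * (Real.exp (-(π * (δ * V) ^ 2)) * 2) * 1 * B := by
            gcongr
            · linarith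
            · exact hexp2 y hy.1.le hy.2
            · exact hQ v y hv.le hy.1.le hy.2
        _ = _ := by ring
  have htop : ‖∫ x in (-V)..V, Ff δ l σ ((x : ℂ) + w0 * Complex.I)‖ ≤ 2 * B * Real.exp (-(a * l)) := by
    have hb : ∀ x ∈ Set.Ioc (-V) V, ‖Ff δ l σ ((x : ℂ) + w0 * Complex.I)‖ ≤ (2 * B * Real.exp (-(a * l))) * gk δ x := by
      intro x hx
      rw [Ff_norm δ l σ hδ]
      have e1 : Real.exp (-(π * δ ^ 2) * (x ^ 2 - w0 ^ 2)) = Real.exp (-(π * δ ^ 2) * x ^ 2) * Real.exp (π * δ ^ 2 * w0 ^ 2) := by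
        rw [← Real.exp_add]; congr 1; ring
      have e2 : Real.exp (-(2 * π * l) * w0) ≤ Real.exp (-(a * l)) := by
        refine Real.exp_le_exp.2 ?_
        have : -(2 * π * l) * w0 = -((σ - 1 + a) * l) := by rw [← hw0e]; ring
        rw [this]
        have := mul_pos (by linarith : 0 < σ - 1) hl
        linarith
      rw [e1, gk]
      calc δ * (Real.exp (-(π * δ ^ 2) * x ^ 2) * Real.exp (π * δ ^ 2 * w0 ^ 2)) * Real.exp (-(2 * π * l) * w0)
            * ‖Qz (⟨σ - 2 * π * w0, 2 * π * x⟩ : ℂ)‖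
          ≤ δ * (Real.exp (-(π * δ ^ 2) * x ^ 2) * 2) * Real.exp (-(a * l)) * B := by
            gcongr
            · exact hexp2 w0 hw0p.le le_rfl
            · exact hQ x w0 (abs_le.2 ⟨hx.1.le, hx.2⟩) hw0p.le le_rfl
        _ = _ := by ring
    have := intervalIntegral.norm_integral_le_of_norm_le (μ := volume) (a := -V) (b := V) (by linarith)
      (Filter.Eventually.of_forall hb) (((gk_int δ hδ).const_mul _).intervalIntegrable)
    refine this.trans ?_
    rw [intervalIntegral.integral_const_mul]
    refine mul_le_of_le_one_right (by positivity) ?_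
    rw [intervalIntegral.integral_of_le (by linarith), ← gk_one δ hδ]
    exact setIntegral_le_integral (gk_int δ hδ) (Filter.Eventually.of_forall (fun x => gk_nonneg δ x hδ))
  have hmid : ‖∫ x in (-V)..V, Ff δ l σ (x : ℂ)‖ ≤ 2 * B * Real.exp (-(a * l)) + 4 * B * Real.exp (-(π * (δ * V) ^ 2)) := by
    have s1 := hside V (abs_of_pos hV)
    have s2 := hside (-V) (by rw [abs_neg, abs_of_pos hV])
    have e : (∫ x in (-V)..V, Ff δ l σ (x : ℂ)) = (∫ x in (-V)..V, Ff δ l σ ((x : ℂ) + w0 * Complex.I))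
        - Complex.I * (∫ y in (0 : ℝ)..w0, Ff δ l σ ((V : ℂ) + y * Complex.I))
        + Complex.I * (∫ y in (0 : ℝ)..w0, Ff δ l σ (((-V : ℝ) : ℂ) + y * Complex.I)) := by
      simp only [smul_eq_mul] at hrect
      linear_combination hrect
    rw [e]
    refine (norm_add_le _ _).trans ?_
    have t1 := norm_sub_le (∫ x in (-V)..V, Ff δ l σ ((x : ℂ) + w0 * Complex.I))
      (Complex.I * (∫ y in (0 : ℝ)..w0, Ff δ l σ ((V : ℂ) + y * Complex.I)))
    rw [norm_mul, Complex.norm_I, one_mul] at t1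
    rw [norm_mul, Complex.norm_I, one_mul]
    linarith
  have htail : ‖∫ x in (Set.Ioc (-V) V)ᶜ, Ff δ l σ (x : ℂ)‖ ≤ 2 * M * Real.exp (-(π * (δ * V) ^ 2 / 2)) := by
    have hδs : 0 < δ / √2 := by positivity
    have hb : ∀ x ∈ (Set.Ioc (-V) V)ᶜ, ‖Ff δ l σ (x : ℂ)‖ ≤ (√2 * M * Real.exp (-(π * (δ * V) ^ 2 / 2))) * gk (δ / √2) x := by
      intro x hx
      have hx2 : V ^ 2 ≤ x ^ 2 := by
        rw [Set.mem_compl_iff, Set.mem_Ioc, not_and_or] at hx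
        rw [sq_le_sq, abs_of_pos hV]
        rcases hx with hx | hx
        · push Not at hx; rw [abs_of_nonpos (by linarith)]; linarith
        · push Not at hx; rw [abs_of_pos (by linarith)]; linarith
      rw [Ff_norm_real δ l σ hδ]
      have e1 : gk δ x ≤ Real.exp (-(π * (δ * V) ^ 2 / 2)) * (√2 * gk (δ / √2) x) := by
        rw [← gk_sqrt, gk]
        have : Real.exp (-(π * δ ^ 2) * x ^ 2) ≤ Real.exp (-(π * (δ * V) ^ 2 / 2)) * Real.exp (-(π * δ ^ 2 / 2) * x ^ 2) := by
          rw [← Real.exp_add]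
          refine Real.exp_le_exp.2 ?_
          have := mul_le_mul_of_nonneg_left hx2 (by positivity : 0 ≤ π * δ ^ 2 / 2)
          nlinarith
        have := mul_le_mul_of_nonneg_left this hδ.le
        linarith
      calc gk δ x * ‖Qz (⟨σ, 2 * π * x⟩ : ℂ)‖ ≤ (Real.exp (-(π * (δ * V) ^ 2 / 2)) * (√2 * gk (δ / √2) x)) * M :=
            mul_le_mul e1 (h2 _) (norm_nonneg _) (by have := gk_nonneg (δ / √2) x hδs; positivity)
        _ = _ := by ring
    have hi := (gk_int (δ / √2) hδs).const_mul (√2 * M * Real.exp (-(π * (δ * V) ^ 2 / 2)))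
    have hmeas : MeasurableSet (Set.Ioc (-V) V)ᶜ := measurableSet_Ioc.compl
    have := norm_integral_le_of_norm_le (μ := volume.restrict (Set.Ioc (-V) V)ᶜ) hi.integrableOn
      ((ae_restrict_iff' hmeas).2 (Filter.Eventually.of_forall hb))
    refine this.trans ?_
    refine (setIntegral_le_integral hi (Filter.Eventually.of_forall (fun x => by
      have := gk_nonneg (δ / √2) x hδs
      simp only [Pi.zero_apply]; positivity))).trans ?_
    rw [integral_const_mul, gk_one _ hδs, mul_one]
    have : √2 ≤ 2 := by rw [Real.sqrt_le_left (by norm_num)]; norm_num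
    gcongr
  rw [← integral_add_compl (measurableSet_Ioc (a := -V) (b := V)) hintg,
    ← intervalIntegral.integral_of_le (by linarith : -V ≤ V)]
  refine (norm_add_le _ _).trans ?_
  linarith

end BK
end

section
open Real MeasureTheory
open ArithmeticFunction (vonMangoldt)
namespace BK

noncomputable def lam (σ : ℝ) (n : ℕ) : ℝ := vonMangoldt n * (n : ℝ) ^ (-σ)

theorem lam_nonneg (σ : ℝ) (n : ℕ) : 0 ≤ lam σ n :=
  mul_nonneg ArithmeticFunction.vonMangoldt_nonneg (by positivity)

theorem lam_term (σ t : ℝ) (n : ℕ) :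
    LSeries.term (fun n => ((vonMangoldt n : ℝ) : ℂ)) (⟨σ, t⟩ : ℂ) n = (lam σ n : ℂ) * e (-(t / (2 * π) * Real.log n)) := by
  rcases Nat.eq_zero_or_pos n with rfl | hn
  · simp [lam]
  · rw [LSeries.term_of_ne_zero (by lia), lam]
    have hn0 : (n : ℂ) ≠ 0 := by exact_mod_cast hn.ne'
    have hnr : (0 : ℝ) < n := by exact_mod_cast hn
    have e1 : (⟨σ, t⟩ : ℂ) = (σ : ℂ) + (t : ℂ) * Complex.I := by apply Complex.ext <;> simp
    have e2 : ((n : ℂ)) ^ (-((t : ℂ) * Complex.I)) = e (-(t / (2 * π) * Real.log n)) := by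
      rw [Complex.cpow_def_of_ne_zero hn0, e, ← Complex.natCast_log]
      congr 1
      have : 2 * π * -(t / (2 * π) * Real.log n) = - (t * Real.log n) := by
        have := Real.pi_pos; field_simp
      rw [this]; push_cast; ring
    rw [div_eq_mul_inv, ← Complex.cpow_neg, e1, neg_add, Complex.cpow_add _ _ hn0, e2,
      Complex.ofReal_mul, Complex.ofReal_cpow hnr.le]
    push_cast; ring

theorem lam_summable (σ : ℝ) (hσ : 1 < σ) : Summable (lam σ) := by
  have h := ArithmeticFunction.LSeriesSummable_vonMangoldt (s := (⟨σ, 0⟩ : ℂ)) hσ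
  rw [LSeriesSummable, ← summable_norm_iff] at h
  refine h.congr (fun n => ?_)
  rw [lam_term, norm_mul, norm_e, mul_one, Complex.norm_real, Real.norm_of_nonneg (lam_nonneg σ n)]

theorem Qz_eq (s : ℂ) (hs : 1 < s.re) :
    Qz s = (s - 1)⁻¹ - LSeries (fun n => ((vonMangoldt n : ℝ) : ℂ)) s := by
  have h1 : s ≠ 1 := by rintro rfl; simp at hs
  have h2 : s - 1 ≠ 0 := sub_ne_zero.2 h1
  have hz : riemannZeta₁ s ≠ 0 := zeta1_ne s hs.le
  rw [ArithmeticFunction.LSeries_vonMangoldt_eq_deriv_riemannZeta_div hs,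
    deriv_riemannZeta_eq_neg_inv_sub_sq_mul_add h1, riemannZeta_eq_inv_sub_mul h1, Qz]
  field_simp
  ring

theorem Ls_line (σ t : ℝ) : LSeries (fun n => ((vonMangoldt n : ℝ) : ℂ)) (⟨σ, t⟩ : ℂ)
    = ∑' n, (lam σ n : ℂ) * e (-(t / (2 * π) * Real.log n)) := by
  rw [LSeries]; exact tsum_congr (fun n => lam_term σ t n)

theorem Ls_bound (σ t : ℝ) (hσ : 1 < σ) : ‖LSeries (fun n => ((vonMangoldt n : ℝ) : ℂ)) (⟨σ, t⟩ : ℂ)‖ ≤ ∑' n, lam σ n := by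
  rw [Ls_line]
  refine tsum_of_norm_bounded (lam_summable σ hσ).hasSum (fun n => ?_)
  rw [norm_mul, norm_e, mul_one, Complex.norm_real, Real.norm_of_nonneg (lam_nonneg σ n)]

theorem inv_bound (σ t : ℝ) (hσ : 1 < σ) : ‖((⟨σ, t⟩ : ℂ) - 1)⁻¹‖ ≤ (σ - 1)⁻¹ := by
  rw [norm_inv]
  refine inv_anti₀ (by linarith) ?_
  have := Complex.abs_re_le_norm ((⟨σ, t⟩ : ℂ) - 1)
  simp only [Complex.sub_re, Complex.one_re] at this
  exact (le_abs_self _).trans this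

theorem Qz_bound (σ t B : ℝ) (hσ : 1 < σ) (hB : ‖Qz (⟨σ, 0⟩ : ℂ)‖ ≤ B) :
    ‖Qz (⟨σ, t⟩ : ℂ)‖ ≤ B + 2 * (σ - 1)⁻¹ := by
  have h0 : ∑' n, lam σ n ≤ B + (σ - 1)⁻¹ := by
    have e1 : ((∑' n, lam σ n : ℝ) : ℂ) = ((⟨σ, 0⟩ : ℂ) - 1)⁻¹ - Qz (⟨σ, 0⟩ : ℂ) := by
      rw [Qz_eq _ hσ, sub_sub_cancel, Ls_line, Complex.ofReal_tsum]
      refine tsum_congr (fun n => ?_)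
      simp [e_zero]
    have e2 : ‖((∑' n, lam σ n : ℝ) : ℂ)‖ ≤ B + (σ - 1)⁻¹ := by
      rw [e1]
      refine (norm_sub_le _ _).trans ?_
      linarith [inv_bound σ 0 hσ]
    rw [Complex.norm_real] at e2
    exact (Real.le_norm_self _).trans e2
  rw [Qz_eq _ hσ]
  refine (norm_sub_le _ _).trans ?_
  linarith [inv_bound σ t hσ, Ls_bound σ t hσ]

theorem gw_even (D t : ℝ) : gw D (-t) = gw D t := by unfold gw; congr 1; ring

theorem lam_formula (σ δ l : ℝ) (hσ : 1 < σ) (hδ : 0 < δ) :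
    HasSum (fun n : ℕ => ((lam σ n * gw δ (Real.log n - l) : ℝ) : ℂ))
      (∫ v : ℝ, e (v * l) * (gk δ v : ℂ) * LSeries (fun n => ((vonMangoldt n : ℝ) : ℂ)) (⟨σ, 2 * π * v⟩ : ℂ)) := by
  have key := hasSum_integral_of_summable_integral_norm (μ := volume)
    (F := fun (n : ℕ) (v : ℝ) => (lam σ n : ℂ) * (e (v * (l - Real.log n)) * (gk δ v : ℂ))) ?_ ?_
  · have e1 : ∀ n : ℕ, ∫ v : ℝ, (lam σ n : ℂ) * (e (v * (l - Real.log n)) * (gk δ v : ℂ))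
        = ((lam σ n * gw δ (Real.log n - l) : ℝ) : ℂ) := by
      intro n
      rw [integral_const_mul, gk_ft δ hδ, ← gw_even]
      push_cast; congr 3; ring
    have e2 : ∀ v : ℝ, ∑' n : ℕ, (lam σ n : ℂ) * (e (v * (l - Real.log n)) * (gk δ v : ℂ))
        = e (v * l) * (gk δ v : ℂ) * LSeries (fun n => ((vonMangoldt n : ℝ) : ℂ)) (⟨σ, 2 * π * v⟩ : ℂ) := by
      intro v
      rw [Ls_line, ← tsum_mul_left]
      refine tsum_congr (fun n => ?_)
      have : 2 * π * v / (2 * π) = v := by have := Real.pi_pos; field_simp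
      rw [this, mul_sub, sub_eq_add_neg, e_add]; ring
    simp only [e1, e2] at key
    exact key
  · intro n
    refine Integrable.const_mul ?_ _
    refine (gk_int δ hδ).ofReal.bdd_mul (c := 1) ?_ ?_
    · exact (continuous_e.comp (by fun_prop)).aestronglyMeasurable
    · exact Filter.Eventually.of_forall (fun v => by rw [norm_e])
  · refine (lam_summable σ hσ).congr (fun n => ?_)
    have : ∀ v : ℝ, ‖(lam σ n : ℂ) * (e (v * (l - Real.log n)) * (gk δ v : ℂ))‖ = lam σ n * gk δ v := by
      intro v
      rw [norm_mul, norm_mul, norm_e, one_mul, Complex.norm_real, Complex.norm_real,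
        Real.norm_of_nonneg (lam_nonneg σ n), Real.norm_of_nonneg (gk_nonneg δ v hδ)]
    simp only [this]
    rw [integral_const_mul, gk_one δ hδ, mul_one]

theorem laplace (σ v : ℝ) (hσ : 1 < σ) :
    ∫ u : ℝ in Set.Ioi 0, ((Real.exp (-(σ - 1) * u) : ℝ) : ℂ) * e (-(v * u)) = ((⟨σ, 2 * π * v⟩ : ℂ) - 1)⁻¹ := by
  have h := integral_exp_mul_complex_Ioi (a := -((⟨σ, 2 * π * v⟩ : ℂ) - 1)) (by simp; linarith) 0
  have e1 : ∀ u : ℝ, ((Real.exp (-(σ - 1) * u) : ℝ) : ℂ) * e (-(v * u)) = Complex.exp (-((⟨σ, 2 * π * v⟩ : ℂ) - 1) * u) := by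
    intro u
    rw [e, Complex.ofReal_exp, ← Complex.exp_add]
    congr 1
    apply Complex.ext
    · simp
    · simp; ring
  simp only [e1]
  rw [h]
  simp only [Complex.ofReal_zero, mul_zero, Complex.exp_zero]
  rw [neg_div_neg_eq, one_div]

set_option maxHeartbeats 1000000 in
theorem main_formula (σ δ l : ℝ) (hσ : 1 < σ) (hδ : 0 < δ) :
    ((∫ u : ℝ in Set.Ioi 0, Real.exp (-(σ - 1) * u) * gw δ (u - l) : ℝ) : ℂ)
      = ∫ v : ℝ, e (v * l) * (gk δ v : ℂ) * ((⟨σ, 2 * π * v⟩ : ℂ) - 1)⁻¹ := by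
  have hI1 : Integrable (fun u : ℝ => ((Real.exp (-(σ - 1) * u) : ℝ) : ℂ)) (volume.restrict (Set.Ioi 0)) := by
    exact (exp_neg_integrableOn_Ioi 0 (by linarith : 0 < σ - 1)).ofReal
  have hI2 : Integrable (fun v : ℝ => (gk δ v : ℂ)) := (gk_int δ hδ).ofReal
  have hprod := (hI1.mul_prod hI2)
  have hintg : Integrable (Function.uncurry (fun u v : ℝ => ((Real.exp (-(σ - 1) * u) : ℝ) : ℂ) * (e (v * (l - u)) * (gk δ v : ℂ))))
      ((volume.restrict (Set.Ioi 0)).prod volume) := by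
    have := hprod.bdd_mul (c := 1) (f := fun z : ℝ × ℝ => e (z.2 * (l - z.1))) ?_ ?_
    · refine this.congr (Filter.Eventually.of_forall (fun z => ?_))
      simp only [Function.uncurry]; ring
    · exact (continuous_e.comp (by fun_prop)).aestronglyMeasurable
    · exact Filter.Eventually.of_forall (fun v => by rw [norm_e])
  have hsw := integral_integral_swap hintg
  have e1 : ∀ u : ℝ, ∫ v : ℝ, ((Real.exp (-(σ - 1) * u) : ℝ) : ℂ) * (e (v * (l - u)) * (gk δ v : ℂ))
      = ((Real.exp (-(σ - 1) * u) * gw δ (u - l) : ℝ) : ℂ) := by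
    intro u
    rw [integral_const_mul, gk_ft δ hδ, ← gw_even]
    push_cast; congr 3; ring
  have e2 : ∀ v : ℝ, ∫ u : ℝ in Set.Ioi 0, ((Real.exp (-(σ - 1) * u) : ℝ) : ℂ) * (e (v * (l - u)) * (gk δ v : ℂ))
      = e (v * l) * (gk δ v : ℂ) * ((⟨σ, 2 * π * v⟩ : ℂ) - 1)⁻¹ := by
    intro v
    rw [← laplace σ v hσ, ← integral_const_mul]
    refine integral_congr_ae (Filter.Eventually.of_forall (fun u => ?_))
    simp only
    rw [mul_sub v l u, sub_eq_add_neg (v * l), e_add]; ring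
  simp only [e1, e2] at hsw
  rw [← hsw, integral_complex_ofReal]

theorem Ff_eq (δ l σ v : ℝ) : Ff δ l σ v = e (v * l) * (gk δ v : ℂ) * Qz (⟨σ, 2 * π * v⟩ : ℂ) := by
  have e3 : (σ : ℂ) + ((2 * π : ℝ) : ℂ) * Complex.I * (v : ℂ) = ⟨σ, 2 * π * v⟩ := by
    apply Complex.ext
    · rw [Complex.add_re, mul_assoc, Complex.re_ofReal_mul]; simp
    · rw [Complex.add_im, mul_assoc, Complex.im_ofReal_mul]; simp
  unfold Ff gk e
  rw [e3]
  push_cast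
  congr 1
  rw [mul_comm]
  congr 2
  ring

theorem explicit (σ δ l M : ℝ) (hσ : 1 < σ) (hδ : 0 < δ) (hM : ∀ t : ℝ, ‖Qz (⟨σ, t⟩ : ℂ)‖ ≤ M) :
    Summable (fun n : ℕ => lam σ n * gw δ (Real.log n - l)) ∧
    |∑' n : ℕ, lam σ n * gw δ (Real.log n - l) - ∫ u : ℝ in Set.Ioi 0, Real.exp (-(σ - 1) * u) * gw δ (u - l)|
      ≤ ‖∫ v : ℝ, Ff δ l σ v‖ := by
  have h1 := lam_formula σ δ l hσ hδ
  refine ⟨Complex.summable_ofReal.1 h1.summable, ?_⟩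
  have hintg : Integrable (fun v : ℝ => Ff δ l σ v) := by
    refine ((gk_int δ hδ).mul_const M).mono' (Ff_cont δ l σ hσ.le).aestronglyMeasurable ?_
    refine Filter.Eventually.of_forall (fun v => ?_)
    rw [Ff_norm_real δ l σ hδ]
    exact mul_le_mul_of_nonneg_left (hM _) (gk_nonneg δ v hδ)
  have hintg2 : Integrable (fun v : ℝ => e (v * l) * (gk δ v : ℂ) * ((⟨σ, 2 * π * v⟩ : ℂ) - 1)⁻¹) := by
    refine ((gk_int δ hδ).mul_const (σ - 1)⁻¹).mono' ?_ ?_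
    · refine Continuous.aestronglyMeasurable ?_
      refine ((continuous_e.comp (by fun_prop)).mul (Complex.continuous_ofReal.comp (gk_cont δ))).mul ?_
      refine Continuous.inv₀ ?_ ?_
      · have : (fun v : ℝ => (⟨σ, 2 * π * v⟩ : ℂ) - 1) = fun v : ℝ => ((σ : ℂ) + ((2 * π * v : ℝ) : ℂ) * Complex.I) - 1 := by
          funext v; congr 1; apply Complex.ext <;> simp
        rw [this]; fun_prop
      · intro v h
        have := congrArg Complex.re h
        simp at this; linarith
    · refine Filter.Eventually.of_forall (fun v => ?_)
      rw [norm_mul, norm_mul, norm_e, one_mul, Complex.norm_real, Real.norm_of_nonneg (gk_nonneg δ v hδ)]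
      exact mul_le_mul_of_nonneg_left (inv_bound σ _ hσ) (gk_nonneg δ v hδ)
  have h2 : ((∑' n : ℕ, lam σ n * gw δ (Real.log n - l) - ∫ u : ℝ in Set.Ioi 0, Real.exp (-(σ - 1) * u) * gw δ (u - l) : ℝ) : ℂ)
      = - ∫ v : ℝ, Ff δ l σ v := by
    rw [Complex.ofReal_sub, main_formula σ δ l hσ hδ, Complex.ofReal_tsum, h1.tsum_eq]
    have : ∀ v : ℝ, e (v * l) * (gk δ v : ℂ) * LSeries (fun n => ((vonMangoldt n : ℝ) : ℂ)) (⟨σ, 2 * π * v⟩ : ℂ)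
        = e (v * l) * (gk δ v : ℂ) * ((⟨σ, 2 * π * v⟩ : ℂ) - 1)⁻¹ - Ff δ l σ v := by
      intro v
      rw [Ff_eq, Qz_eq _ hσ]; ring
    simp only [this]
    rw [integral_sub hintg2 hintg]; ring
  rw [← Real.norm_eq_abs, ← Complex.norm_real, h2, norm_neg]

end BK
end

section
open Real MeasureTheory
open ArithmeticFunction (vonMangoldt)
namespace BK

theorem gw_pos (D t : ℝ) : 0 < gw D t := Real.exp_pos _

theorem gw_le_one (D t : ℝ) : gw D t ≤ 1 := by
  unfold gw; rw [Real.exp_le_one_iff]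
  have : 0 ≤ π * (t / D) ^ 2 := by positivity
  linarith

theorem w_nonpos (δ t : ℝ) (hδ : 0 < δ) (h : δ ≤ |t|) : 3 * gw δ t - gw (2 * δ) t ≤ 0 := by
  have hx : 1 ≤ (t / δ) ^ 2 := by
    rw [← sq_abs, abs_div, abs_of_pos hδ]
    exact one_le_pow₀ ((one_le_div hδ).2 h)
  have e1 : gw (2 * δ) t = Real.exp (3 * π / 4 * (t / δ) ^ 2) * gw δ t := by
    unfold gw; rw [← Real.exp_add]; congr 1
    field_simp; ring
  have h3 : 3 ≤ Real.exp (3 * π / 4 * (t / δ) ^ 2) := by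
    have := Real.add_one_le_exp (3 * π / 4 * (t / δ) ^ 2)
    have hp := Real.pi_gt_three
    have : 3 * 3 / 4 * 1 ≤ 3 * π / 4 * (t / δ) ^ 2 := by gcongr
    linarith
  rw [e1]
  have := mul_le_mul_of_nonneg_right h3 (gw_pos δ t).le
  linarith

theorem w_le (δ t : ℝ) (hδ : 0 < δ) : 3 * gw δ t - gw (2 * δ) t ≤ if |t| < δ then 3 else 0 := by
  split_ifs with h
  · linarith [gw_le_one δ t, gw_pos (2 * δ) t]
  · exact w_nonpos δ t hδ (not_lt.1 h)

theorem gw_integral (δ : ℝ) (hδ : 0 < δ) : Integrable (gw δ) ∧ ∫ t, gw δ t = δ := by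
  have e1 : gw δ = fun t => Real.exp (-(π / δ ^ 2) * t ^ 2) := by
    funext t; unfold gw; congr 1; field_simp
  rw [e1]
  refine ⟨integrable_exp_neg_mul_sq (by positivity), ?_⟩
  rw [integral_gaussian]
  have : π / (π / δ ^ 2) = δ ^ 2 := by field_simp
  rw [this, Real.sqrt_sq hδ.le]

theorem Jfull (l δ : ℝ) (hl : 0 < l) (hδ : 0 < δ) :
    Integrable (fun u => Real.exp (-(1 / l) * u) * gw δ (u - l)) ∧
    ∫ u, Real.exp (-(1 / l) * u) * gw δ (u - l) = Real.exp (-1 + δ ^ 2 / (4 * π * l ^ 2)) * δ := by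
  have e1 : (fun u => Real.exp (-(1 / l) * u) * gw δ (u - l)) =
      fun u => Real.exp (-1 + δ ^ 2 / (4 * π * l ^ 2)) * gw δ (u + (δ ^ 2 / (2 * π * l) - l)) := by
    funext u
    unfold gw
    rw [← Real.exp_add, ← Real.exp_add]; congr 1
    field_simp; ring
  rw [e1]
  obtain ⟨h1, h2⟩ := gw_integral δ hδ
  refine ⟨(h1.comp_add_right _).const_mul _, ?_⟩
  rw [integral_const_mul, integral_add_right_eq_self (fun u => gw δ u), h2]

theorem main_lower (l δ : ℝ) (hl : 1 ≤ l) (hδ : 0 < δ) (hδ1 : δ ≤ 1/2) :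
    δ / 4 ≤ 3 * (∫ u : ℝ in Set.Ioi 0, Real.exp (-(1 / l) * u) * gw δ (u - l))
      - ∫ u : ℝ in Set.Ioi 0, Real.exp (-(1 / l) * u) * gw (2 * δ) (u - l) := by
  have hl0 : 0 < l := by linarith
  obtain ⟨i1, v1⟩ := Jfull l δ hl0 hδ
  obtain ⟨i2, v2⟩ := Jfull l (2 * δ) hl0 (by linarith)
  have s1 := integral_add_compl (measurableSet_Ioi (a := (0:ℝ))) i1
  have s2 := integral_add_compl (measurableSet_Ioi (a := (0:ℝ))) i2
  have hneg : 3 * (∫ u : ℝ in (Set.Ioi 0)ᶜ, Real.exp (-(1 / l) * u) * gw δ (u - l))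
      - ∫ u : ℝ in (Set.Ioi 0)ᶜ, Real.exp (-(1 / l) * u) * gw (2 * δ) (u - l) ≤ 0 := by
    rw [← integral_const_mul, ← integral_sub (i1.integrableOn.const_mul 3) i2.integrableOn]
    refine setIntegral_nonpos measurableSet_Ioi.compl (fun u hu => ?_)
    have hu' : u ≤ 0 := by simpa using hu
    have := w_nonpos δ (u - l) hδ (by rw [abs_of_nonpos (by linarith)]; linarith)
    have h2 := mul_nonneg (Real.exp_pos (-(1 / l) * u)).le (neg_nonneg.2 this)
    linarith
  have hx : (2 * δ) ^ 2 / (4 * π * l ^ 2) ≤ 1/12 := by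
    rw [div_le_iff₀ (by positivity)]
    have hp := Real.pi_gt_three
    have : 4 * 3 * 1 ^ 2 ≤ 4 * π * l ^ 2 := by gcongr
    nlinarith
  have hx2 : Real.exp ((2 * δ) ^ 2 / (4 * π * l ^ 2)) ≤ 12/11 := by
    refine (Real.exp_le_exp.2 hx).trans ?_
    have := Real.exp_bound_div_one_sub_of_interval (x := 1/12) (by norm_num) (by norm_num)
    linarith [this, (by norm_num : (1:ℝ) / (1 - 1/12) = 12/11)]
  have hx1 : 1 ≤ Real.exp (δ ^ 2 / (4 * π * l ^ 2)) := Real.one_le_exp (by positivity)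
  have he : 1/3 ≤ Real.exp (-1) := by
    rw [Real.exp_neg, ← one_div]
    exact one_div_le_one_div_of_le (Real.exp_pos _) (by linarith [Real.exp_one_lt_d9])
  have key : δ / 4 ≤ 3 * (Real.exp (-1 + δ ^ 2 / (4 * π * l ^ 2)) * δ)
      - Real.exp (-1 + (2 * δ) ^ 2 / (4 * π * l ^ 2)) * (2 * δ) := by
    rw [Real.exp_add, Real.exp_add]
    set E := Real.exp (-1)
    set p := Real.exp (δ ^ 2 / (4 * π * l ^ 2))
    set q := Real.exp ((2 * δ) ^ 2 / (4 * π * l ^ 2))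
    have : 3 * (E * p * δ) - E * q * (2 * δ) = δ * (E * (3 * p - 2 * q)) := by ring
    rw [this]
    have h1 : 9/11 ≤ 3 * p - 2 * q := by linarith
    have h2 : 1/4 ≤ E * (3 * p - 2 * q) := by
      calc (1:ℝ)/4 ≤ 1/3 * (9/11) := by norm_num
        _ ≤ _ := by gcongr
    have := mul_le_mul_of_nonneg_left h2 hδ.le
    linarith
  rw [← v1, ← v2, ← s1, ← s2] at key
  linarith

theorem ev_exp_small (K κ : ℝ) (hκ : 0 < κ) (n : ℕ) :
    ∀ᶠ l : ℝ in Filter.atTop, K * l ^ n * Real.exp (-(κ * l ^ (1/2 : ℝ))) ≤ 1 := by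
  have h1 := tendsto_rpow_mul_exp_neg_mul_atTop_nhds_zero (2 * n : ℝ) κ hκ
  have h2 := h1.comp (tendsto_rpow_atTop (y := 1/2) (by norm_num))
  have h3 := h2.const_mul K
  rw [mul_zero] at h3
  filter_upwards [h3.eventually (Iic_mem_nhds (zero_lt_one)), Filter.eventually_gt_atTop 0] with l hl hl0
  simp only [Function.comp, Set.mem_Iic] at hl
  have : (l ^ (1/2 : ℝ)) ^ (2 * n : ℝ) = l ^ n := by
    rw [← Real.rpow_mul hl0.le, ← Real.rpow_natCast]; congr 1; ring
  rw [this] at hl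
  rw [mul_assoc]
  simpa using hl

end BK
end

section
open Real MeasureTheory
open ArithmeticFunction (vonMangoldt)
namespace BK

theorem Ff_small (A : ℕ) : ∃ K > 0, ∃ κ > 0, ∀ l : ℝ, 7 ≤ l → ∃ M : ℝ,
    (∀ t : ℝ, ‖Qz (⟨1 + 1 / l, t⟩ : ℂ)‖ ≤ M) ∧
    ∀ δ : ℝ, 0 < δ → 1 ≤ δ * l ^ A → δ ≤ 1/2 →
    ‖∫ v : ℝ, Ff δ l (1 + 1 / l) v‖ ≤ K * l * Real.exp (-(κ * l ^ (1/2 : ℝ))) := by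
  have hA : (0:ℝ) < A + 2 := by positivity
  obtain ⟨C, hC, κ, hκ, hz⟩ := zeta_region (1 / (2 * (A + 2))) (by positivity)
    (by rw [div_le_one (by positivity)]; linarith)
  refine ⟨8 * C + 4, by positivity, min κ (1/2), lt_min hκ (by norm_num), fun l hl => ?_⟩
  have hl0 : 0 < l := by linarith
  have hl1 : 1 ≤ l := by linarith
  set T := l ^ (A + 2) with hT
  have hT1 : 1 ≤ T := one_le_pow₀ hl1
  have hTe : T ^ (1 / (2 * (A + 2)) : ℝ) = l ^ (1/2 : ℝ) := by
    rw [hT, ← Real.rpow_natCast, ← Real.rpow_mul hl0.le]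
    congr 1; push_cast; field_simp
  have hTe' : T ^ (-(1 / (2 * (A + 2))) : ℝ) = l ^ (-(1/2) : ℝ) := by
    rw [Real.rpow_neg (by positivity), hTe, Real.rpow_neg hl0.le]
  have hz1 := hz T hT1
  rw [hTe, hTe'] at hz1
  set B := C * l ^ (1/2 : ℝ) with hB
  have hB0 : 0 ≤ B := by positivity
  have hs1 : l ^ (1/2 : ℝ) ≤ l := by
    calc l ^ (1/2 : ℝ) ≤ l ^ (1:ℝ) := Real.rpow_le_rpow_of_exponent_le hl1 (by norm_num)
      _ = l := Real.rpow_one l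
  have hBl : B ≤ C * l := mul_le_mul_of_nonneg_left hs1 hC.le
  have hinv : 1 / l ≤ 1/2 := one_div_le_one_div_of_le (by norm_num) (by linarith)
  have hinv0 : 0 < 1 / l := by positivity
  have hσ : 1 < 1 + 1 / l := by linarith
  have hneg0 : 0 < l ^ (-(1/2) : ℝ) := Real.rpow_pos_of_pos hl0 _
  have hneg1 : l ^ (-(1/2) : ℝ) ≤ 1 := Real.rpow_le_one_of_one_le_of_nonpos hl1 (by norm_num)
  have hq0 : ‖Qz (⟨1 + 1 / l, 0⟩ : ℂ)‖ ≤ B :=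
    (hz1 ⟨1 + 1 / l, 0⟩ (by simp; linarith) (by
      have : 0 < κ * l ^ (-(1/2) : ℝ) := by positivity
      simp only; linarith) (by simp only; linarith)).2
  have hM : ∀ t : ℝ, ‖Qz (⟨1 + 1 / l, t⟩ : ℂ)‖ ≤ B + 2 * l := by
    intro t
    have := Qz_bound (1 + 1 / l) t B hσ hq0
    have e1 : (1 + 1 / l - 1)⁻¹ = l := by field_simp; ring
    rwa [e1] at this
  refine ⟨B + 2 * l, hM, fun δ hδ hδA hδ1 => ?_⟩
  set κ' := min κ (1/2) with hκ'
  have hκ0 : 0 < κ' := lt_min hκ (by norm_num)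
  have hκ1 : κ' ≤ κ := min_le_left _ _
  have hκ2 : κ' ≤ 1/2 := min_le_right _ _
  have ha1 : κ' * l ^ (-(1/2) : ℝ) ≤ 1/2 := by
    calc κ' * l ^ (-(1/2) : ℝ) ≤ 1/2 * 1 := mul_le_mul hκ2 hneg1 hneg0.le (by norm_num)
      _ = 1/2 := by norm_num
  have hpi := Real.pi_lt_d2
  have hpi3 := Real.pi_gt_three
  have hV : 2 * π * l ^ (A + 1) ≤ T := by
    rw [hT, pow_succ l (A+1), mul_comm]
    exact mul_le_mul_of_nonneg_left (by linarith) (by positivity)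
  have hc := contour δ l (1 + 1 / l) (l ^ (A + 1)) B (κ' * l ^ (-(1/2) : ℝ)) (B + 2 * l) hδ hδ1 hσ
    (by linarith) (by positivity) (by positivity) hB0 (by positivity) hl0
    (fun s h1 h2 h3 => hz1 s (h1.trans hV)
      (by
        have := mul_le_mul_of_nonneg_right hκ1 hneg0.le
        linarith) (by linarith)) hM
  refine hc.trans ?_
  have hal : κ' * l ^ (-(1/2) : ℝ) * l = κ' * l ^ (1/2 : ℝ) := by
    rw [mul_assoc]; congr 1
    nth_rewrite 2 [← Real.rpow_one l]
    rw [← Real.rpow_add hl0]; norm_num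
  rw [hal]
  have hdV : l ≤ δ * l ^ (A + 1) := by
    rw [pow_succ, ← mul_assoc]
    nlinarith
  have hsq : l ≤ (δ * l ^ (A + 1)) ^ 2 := by
    have := mul_le_mul hdV hdV hl0.le (by positivity)
    nlinarith
  set W := (δ * l ^ (A + 1)) ^ 2 with hW
  have hk : κ' * l ^ (1/2 : ℝ) ≤ l := by
    have := mul_le_mul hκ2 hs1 (by positivity) (by norm_num)
    linarith
  have hw2 : l ≤ π * W / 2 := by nlinarith
  have hw1 : l ≤ π * W := by nlinarith
  have e1 : Real.exp (-(π * W)) ≤ Real.exp (-(κ' * l ^ (1/2 : ℝ))) := Real.exp_le_exp.2 (by linarith)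
  have e2 : Real.exp (-(π * W / 2)) ≤ Real.exp (-(κ' * l ^ (1/2 : ℝ))) := Real.exp_le_exp.2 (by linarith)
  set E := Real.exp (-(κ' * l ^ (1/2 : ℝ))) with hE
  have hE0 : 0 < E := Real.exp_pos _
  have f1 := mul_le_mul_of_nonneg_left e1 (by positivity : 0 ≤ 4 * B)
  have f2 := mul_le_mul_of_nonneg_left e2 (by positivity : 0 ≤ 2 * (B + 2 * l))
  have f3 := mul_le_mul_of_nonneg_right hBl hE0.le
  linarith

theorem lam_lower (A : ℕ) : ∀ᶠ l : ℝ in Filter.atTop, ∀ δ : ℝ, 0 < δ → 1 ≤ δ * l ^ A → δ ≤ 1/4 →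
    Summable (fun n : ℕ => lam (1 + 1 / l) n * (3 * gw δ (Real.log n - l) - gw (2 * δ) (Real.log n - l))) ∧
    δ / 8 ≤ ∑' n : ℕ, lam (1 + 1 / l) n * (3 * gw δ (Real.log n - l) - gw (2 * δ) (Real.log n - l)) := by
  obtain ⟨K, hK, κ, hκ, hF⟩ := Ff_small A
  filter_upwards [Filter.eventually_ge_atTop 7, ev_exp_small (32 * K) κ hκ (A + 1)] with l hl hsm δ hδ hδA hδ1
  obtain ⟨M, hM, hb⟩ := hF l hl
  have hl0 : 0 < l := by linarith
  have hσ : 1 < 1 + 1 / l := by have : 0 < 1 / l := by positivity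
                                linarith
  obtain ⟨s1, b1⟩ := explicit (1 + 1 / l) δ l M hσ hδ hM
  obtain ⟨s2, b2⟩ := explicit (1 + 1 / l) (2 * δ) l M hσ (by linarith) hM
  have c1 := b1.trans (hb δ hδ hδA (by linarith))
  have c2 := b2.trans (hb (2 * δ) (by linarith) (by
    have : 0 < δ * l ^ A := by positivity
    linarith) (by linarith))
  have hfun : (fun n : ℕ => lam (1 + 1 / l) n * (3 * gw δ (Real.log n - l) - gw (2 * δ) (Real.log n - l)))
      = fun n : ℕ => 3 * (lam (1 + 1 / l) n * gw δ (Real.log n - l)) - lam (1 + 1 / l) n * gw (2 * δ) (Real.log n - l) := by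
    funext n; ring
  rw [hfun]
  refine ⟨(s1.mul_left 3).sub s2, ?_⟩
  rw [(s1.mul_left 3).tsum_sub s2, tsum_mul_left]
  have hm := main_lower l δ (by linarith) hδ (by linarith)
  have es : -(1 + 1 / l - 1) = -(1 / l) := by ring
  rw [es] at c1 c2
  have hE : 4 * (K * l * Real.exp (-(κ * l ^ (1/2 : ℝ)))) ≤ δ / 8 := by
    have h1 : 32 * K * l ^ (A + 1) * Real.exp (-(κ * l ^ (1/2 : ℝ))) ≤ δ * l ^ A := hsm.trans hδA
    have hp : 0 < l ^ A := by positivity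
    have h2 : (32 * K * l * Real.exp (-(κ * l ^ (1/2 : ℝ)))) * l ^ A ≤ δ * l ^ A := by
      refine le_trans (le_of_eq ?_) h1
      rw [pow_succ]; ring
    have := le_of_mul_le_mul_right h2 hp
    linarith
  have d1 := abs_le.1 c1
  have d2 := abs_le.1 c2
  linarith [d1.1, d2.2]

theorem psi_lower (A : ℕ) : ∀ᶠ l : ℝ in Filter.atTop, ∀ δ : ℝ, 0 < δ → 1 ≤ δ * l ^ A → δ ≤ 1/4 →
    δ * Real.exp l / 32 ≤ ∑ n ∈ (Finset.Ioc 0 ⌊Real.exp (l + 1)⌋₊).filter (fun n : ℕ => |Real.log n - l| < δ), vonMangoldt n := by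
  filter_upwards [lam_lower A, Filter.eventually_ge_atTop 7] with l hl hl7 δ hδ hδA hδ1
  obtain ⟨hs, hlow⟩ := hl δ hδ hδA hδ1
  set S := (Finset.Ioc 0 ⌊Real.exp (l + 1)⌋₊).filter (fun n : ℕ => |Real.log n - l| < δ) with hS
  have hl0 : 0 < l := by linarith
  have hup : ∑' n : ℕ, lam (1 + 1 / l) n * (3 * gw δ (Real.log n - l) - gw (2 * δ) (Real.log n - l))
      ≤ ∑' n : ℕ, (if n ∈ S then 3 * lam (1 + 1 / l) n else 0) := by
    refine hs.tsum_le_tsum (fun n => ?_) (summable_of_ne_finset_zero (s := S) (fun n hn => by simp [hn]))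
    have hw := mul_le_mul_of_nonneg_left (w_le δ (Real.log n - l) hδ) (lam_nonneg (1 + 1 / l) n)
    refine hw.trans ?_
    by_cases h : |Real.log n - l| < δ
    · rw [if_pos h]
      rcases Nat.eq_zero_or_pos n with h0 | h0
      · subst h0
        have : lam (1 + 1 / l) 0 = 0 := by simp [lam]
        rw [this]; simp
      · have hn : n ∈ S := by
          rw [hS, Finset.mem_filter, Finset.mem_Ioc]
          refine ⟨⟨h0, Nat.le_floor ?_⟩, h⟩
          have hn0 : (0:ℝ) < n := by exact_mod_cast h0
          rw [← Real.exp_log hn0]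
          exact Real.exp_le_exp.2 (by linarith [(abs_lt.1 h).2])
        rw [if_pos hn, mul_comm]
    · rw [if_neg h, mul_zero]
      split_ifs
      · exact mul_nonneg (by norm_num) (lam_nonneg _ _)
      · exact le_rfl
  rw [tsum_eq_sum (f := fun n : ℕ => if n ∈ S then 3 * lam (1 + 1 / l) n else 0) (s := S) (fun n hn => by simp [hn])] at hup
  have hsum : ∑ n ∈ S, (if n ∈ S then 3 * lam (1 + 1 / l) n else 0) ≤ ∑ n ∈ S, 4 * Real.exp (-l) * vonMangoldt n := by
    refine Finset.sum_le_sum (fun n hn => ?_)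
    rw [if_pos hn]
    rw [hS, Finset.mem_filter, Finset.mem_Ioc] at hn
    have hn0 : (0:ℝ) < n := by exact_mod_cast hn.1.1
    have hL : l - δ ≤ Real.log n := by linarith [(abs_lt.1 hn.2).1]
    have : (n:ℝ) ^ (-(1 + 1 / l)) ≤ Real.exp (-l) * (4/3) := by
      rw [Real.rpow_def_of_pos hn0]
      have h1 : Real.log n * -(1 + 1 / l) ≤ -l + 1/4 := by
        by_cases hc : l ≤ Real.log n
        · have : 0 ≤ Real.log n * (1 / l) := by positivity
          linarith
        · have h3 : 3/4 ≤ Real.log n * (1 / l) := by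
            rw [mul_one_div, le_div_iff₀ hl0]; linarith
          linarith
      refine (Real.exp_le_exp.2 h1).trans ?_
      rw [Real.exp_add]
      have h4 := Real.exp_bound_div_one_sub_of_interval (x := 1/4) (by norm_num) (by norm_num)
      exact mul_le_mul_of_nonneg_left (by linarith [h4, (by norm_num : (1:ℝ) / (1 - 1/4) = 4/3)]) (Real.exp_pos _).le
    unfold lam
    have hv : 0 ≤ vonMangoldt n := ArithmeticFunction.vonMangoldt_nonneg
    have := mul_le_mul_of_nonneg_left this hv
    linarith
  rw [← Finset.mul_sum] at hsum
  have hfin := hlow.trans (hup.trans hsum)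
  have h5 := mul_le_mul_of_nonneg_right hfin (Real.exp_pos l).le
  have h6 : Real.exp (-l) * Real.exp l = 1 := by rw [← Real.exp_add]; simp
  have h7 : 4 * Real.exp (-l) * (∑ n ∈ S, vonMangoldt n) * Real.exp l = 4 * (∑ n ∈ S, vonMangoldt n) := by
    linear_combination 4 * (∑ n ∈ S, vonMangoldt n) * h6
  rw [h7] at h5
  linarith

theorem short_primes (A : ℕ) : ∀ᶠ l : ℝ in Filter.atTop, ∀ δ : ℝ, 0 < δ → 1 ≤ δ * l ^ A → δ ≤ 1/4 →
    δ * Real.exp l / 64 ≤ ∑ n ∈ (Finset.Ioc 0 ⌊Real.exp (l + 1)⌋₊).filter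
      (fun n : ℕ => n.Prime ∧ |Real.log n - l| < δ), Real.log n := by
  have hsm := ev_exp_small (1024) (1/2) (by norm_num) (A + 1)
  filter_upwards [psi_lower A, hsm, Filter.eventually_ge_atTop 7] with l hl hsm hl7 δ hδ hδA hδ1
  have h1 := hl δ hδ hδA hδ1
  have hl0 : 0 < l := by linarith
  set x := Real.exp (l + 1) with hx
  have hx1 : 1 ≤ x := Real.one_le_exp (by linarith)
  have h2 := Chebyshev.psi_sub_theta_le hx1
  rw [Chebyshev.psi_sub_theta_eq_sum_not_prime] at h2
  have h3 : ∑ n ∈ (Finset.Ioc 0 ⌊x⌋₊).filter (fun n : ℕ => |Real.log n - l| < δ), vonMangoldt n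
      ≤ ∑ n ∈ (Finset.Ioc 0 ⌊x⌋₊).filter (fun n : ℕ => n.Prime ∧ |Real.log n - l| < δ), Real.log n
        + ∑ n ∈ (Finset.Ioc 0 ⌊x⌋₊).filter (fun n : ℕ => ¬ n.Prime), vonMangoldt n := by
    rw [Finset.sum_filter, Finset.sum_filter, Finset.sum_filter, ← Finset.sum_add_distrib]
    refine Finset.sum_le_sum (fun n hn => ?_)
    have hv : 0 ≤ vonMangoldt n := ArithmeticFunction.vonMangoldt_nonneg
    by_cases hp : n.Prime
    · by_cases hd : |Real.log n - l| < δ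
      · simp [hp, hd, ArithmeticFunction.vonMangoldt_apply_prime hp]
      · simp [hp, hd]
    · by_cases hd : |Real.log n - l| < δ
      · simp [hp, hd]
      · simp [hp, hd, hv]
  have h4 : 2 * √x * Real.log x ≤ δ * Real.exp l / 64 := by
    have hlog : Real.log x = l + 1 := Real.log_exp _
    have hsq : √x = Real.exp ((l + 1) / 2) := by
      rw [hx, Real.exp_half]
    rw [hlog, hsq]
    have e1 : Real.exp ((l + 1) / 2) ≤ 2 * (Real.exp (l / 2)) := by
      rw [show (l + 1) / 2 = 1/2 + l / 2 by ring, Real.exp_add]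
      have h4 := Real.exp_bound_div_one_sub_of_interval (x := 1/2) (by norm_num) (by norm_num)
      exact mul_le_mul_of_nonneg_right (by linarith [h4, (by norm_num : (1:ℝ) / (1 - 1/2) = 2)]) (Real.exp_pos _).le
    have e2 : Real.exp (-(1/2 * l ^ (1/2:ℝ))) ≥ Real.exp (-(l/2)) := by
      refine Real.exp_le_exp.2 ?_
      have : l ^ (1/2 : ℝ) ≤ l ^ (1:ℝ) := Real.rpow_le_rpow_of_exponent_le (by linarith) (by norm_num)
      rw [Real.rpow_one] at this
      linarith
    have e3 : 1024 * l ^ (A + 1) * Real.exp (-(l/2)) ≤ δ * l ^ A :=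
      (mul_le_mul_of_nonneg_left e2 (by positivity)).trans (hsm.trans hδA)
    have hp : 0 < l ^ A := by positivity
    have e4 : 1024 * l * Real.exp (-(l/2)) ≤ δ := by
      refine le_of_mul_le_mul_right (le_trans (le_of_eq ?_) e3) hp
      rw [pow_succ]; ring
    have e5 := mul_le_mul_of_nonneg_right e4 (Real.exp_pos l).le
    have e6 : Real.exp (-(l/2)) * Real.exp l = Real.exp (l/2) := by
      rw [← Real.exp_add]; congr 1; ring
    rw [mul_assoc, e6] at e5
    have e7 := mul_le_mul_of_nonneg_right e1 (by linarith : 0 ≤ l + 1)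
    have e8 := Real.exp_pos (l/2)
    have e9 : Real.exp (l/2) * (l + 1) ≤ Real.exp (l/2) * (2 * l) := mul_le_mul_of_nonneg_left (by linarith) e8.le
    linarith
  linarith

end BK
end

section
open Real MeasureTheory
namespace BK

theorem prime_window (A : ℕ) : ∀ᶠ X : ℝ in Filter.atTop, ∀ y δ : ℝ, X / 4 ≤ y → y ≤ X / 2 → 0 < δ →
    1 ≤ δ * (Real.log y) ^ A → δ ≤ 1/4 →
    δ * X / 256 ≤ ∑ p ∈ (PS X).filter (fun p : ℕ => |Real.log p - Real.log y| < δ), Real.log p := by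
  obtain ⟨l0, hl0⟩ := Filter.eventually_atTop.1 (short_primes A)
  filter_upwards [Filter.eventually_ge_atTop (4 * Real.exp l0), Filter.eventually_ge_atTop 8] with X hX hX8 y δ hy1 hy2 hδ hδA hδ1
  have hX0 : 0 < X := by linarith
  have hy0 : 0 < y := by linarith
  have hl : l0 ≤ Real.log y := by
    rw [Real.le_log_iff_exp_le hy0]; linarith
  have h := hl0 _ hl δ hδ hδA hδ1
  rw [Real.exp_log hy0] at h
  have h2 : δ * X / 256 ≤ δ * y / 64 := by
    have := mul_le_mul_of_nonneg_left hy1 hδ.le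
    linarith
  refine h2.trans (h.trans ?_)
  refine Finset.sum_le_sum_of_subset_of_nonneg ?_ (fun p hp _ => ?_)
  · intro p hp
    rw [Finset.mem_filter] at hp ⊢
    obtain ⟨-, hpp, hd⟩ := hp
    refine ⟨(mem_PS X hX0.le p).2 ⟨hpp, ?_, ?_⟩, hd⟩
    · have hp0 : (0:ℝ) < p := by exact_mod_cast hpp.pos
      have h1 : Real.log y - 1/4 ≤ Real.log p := by linarith [(abs_lt.1 hd).1]
      have h3 := Real.exp_le_exp.2 h1
      rw [Real.exp_log hp0, sub_eq_add_neg, Real.exp_add, Real.exp_log hy0] at h3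
      have h4 := Real.add_one_le_exp (-(1/4) : ℝ)
      have := mul_le_mul_of_nonneg_left h4 hy0.le
      linarith
    · have hp0 : (0:ℝ) < p := by exact_mod_cast hpp.pos
      have h1 : Real.log p ≤ Real.log y + 1/4 := by linarith [(abs_lt.1 hd).2]
      have h3 := Real.exp_le_exp.2 h1
      rw [Real.exp_log hp0, Real.exp_add, Real.exp_log hy0] at h3
      have h4 := Real.exp_bound_div_one_sub_of_interval (x := 1/4) (by norm_num) (by norm_num)
      have h5 : Real.exp (1/4) ≤ 2 := by linarith [h4, (by norm_num : (1:ℝ) / (1 - 1/4) = 4/3)]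
      have := mul_le_mul_of_nonneg_left h5 hy0.le
      linarith
  · exact (log_PS X (by linarith) p (Finset.mem_filter.1 hp).1).1

theorem half_pow (c : ℝ) (hc2 : c ≤ 6/5) : (2/5 : ℝ) ≤ (1/2) ^ c := by
  have h1 : ((1:ℝ)/2) ^ (6/5 : ℝ) ≤ (1/2) ^ c :=
    Real.rpow_le_rpow_of_exponent_ge (by norm_num) (by norm_num) hc2
  refine le_trans ?_ h1
  refine le_of_pow_le_pow_left₀ (n := 5) (by norm_num) (by positivity) ?_
  rw [← Real.rpow_natCast, ← Real.rpow_natCast, ← Real.rpow_mul (by norm_num)]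
  norm_num

theorem root_range (c X z : ℝ) (hc1 : 1 < c) (hc2 : c < 6/5) (hX : 0 < X) (h1 : 3/10 * X ^ c ≤ z)
    (h2 : z ≤ 2/5 * X ^ c) : 0 < z ∧ (z ^ (1/c)) ^ c = z ∧ X / 4 ≤ z ^ (1/c) ∧ z ^ (1/c) ≤ X / 2 := by
  have hXc : 0 < X ^ c := Real.rpow_pos_of_pos hX c
  have hz : 0 < z := by linarith
  have hc0 : 0 < c := by linarith
  have he : (z ^ (1/c)) ^ c = z := by
    rw [← Real.rpow_mul hz.le, one_div_mul_cancel hc0.ne', Real.rpow_one]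
  have hp : 0 < z ^ (1/c) := Real.rpow_pos_of_pos hz _
  refine ⟨hz, he, ?_, ?_⟩
  · refine (Real.rpow_le_rpow_iff (by positivity) hp.le hc0).1 ?_
    rw [he, Real.div_rpow hX.le (by norm_num)]
    have h4 : (4:ℝ) ≤ 4 ^ c := by
      nth_rewrite 1 [← Real.rpow_one 4]
      exact Real.rpow_le_rpow_of_exponent_le (by norm_num) hc1.le
    have : X ^ c / 4 ^ c ≤ X ^ c / 4 := div_le_div_of_nonneg_left hXc.le (by norm_num) h4
    linarith
  · refine (Real.rpow_le_rpow_iff hp.le (by positivity) hc0).1 ?_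
    rw [he, div_eq_mul_one_div, Real.mul_rpow hX.le (by norm_num)]
    have := mul_le_mul_of_nonneg_left (half_pow c hc2.le) hXc.le
    linarith

theorem window_pow (c y δ : ℝ) (p : ℕ) (hc1 : 1 < c) (hc2 : c < 6/5) (hy : 0 < y) (hp : p.Prime)
    (hδ : δ ≤ 1/4) (h : |Real.log p - Real.log y| < δ) :
    |(p:ℝ) ^ c - y ^ c| ≤ 2 * δ * y ^ c := by
  have hp0 : (0:ℝ) < p := by exact_mod_cast hp.pos
  have hyc : 0 < y ^ c := Real.rpow_pos_of_pos hy c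
  set u := Real.log p - Real.log y with hu
  have e1 : (p:ℝ) ^ c = y ^ c * Real.exp (c * u) := by
    rw [Real.rpow_def_of_pos hp0, Real.rpow_def_of_pos hy, ← Real.exp_add]
    congr 1; rw [hu]; ring
  have h1 := abs_lt.1 h
  have hδ0 : 0 < δ := lt_of_le_of_lt (abs_nonneg _) h
  have hcu1 : c * u ≤ 6/5 * δ := by nlinarith
  have hcu2 : -(6/5 * δ) ≤ c * u := by nlinarith
  have b1 : Real.exp (c * u) ≤ 1 + 2 * δ := by
    refine (Real.exp_le_exp.2 hcu1).trans ?_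
    refine (Real.exp_bound_div_one_sub_of_interval (x := 6/5 * δ) (by linarith) (by linarith)).trans ?_
    rw [div_le_iff₀ (by linarith)]
    nlinarith
  have b2 : 1 - 2 * δ ≤ Real.exp (c * u) := by
    have := Real.add_one_le_exp (c * u)
    linarith
  rw [e1, abs_le]
  constructor
  · have := mul_le_mul_of_nonneg_left b2 hyc.le
    linarith
  · have := mul_le_mul_of_nonneg_left b1 hyc.le
    linarith

theorem gw_ge (D t : ℝ) (hD : 0 < D) (h : |t| ≤ D) : Real.exp (-π) ≤ gw D t := by
  unfold gw
  refine Real.exp_le_exp.2 ?_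
  have : (t / D) ^ 2 ≤ 1 := by
    rw [sq_le_one_iff_abs_le_one, abs_div, abs_of_pos hD, div_le_one hD]; exact h
  have := mul_le_mul_of_nonneg_left this Real.pi_pos.le
  linarith

set_option maxHeartbeats 1000000 in
theorem coarse (c : ℝ) (hc1 : 1 < c) (hc2 : c < 6/5) : ∃ c₁ > 0, ∀ᶠ X : ℝ in Filter.atTop,
    c₁ * X ^ 3 / (Real.log X) ^ 56 ≤ Nw c X (X ^ c) (X ^ c / (Real.log X) ^ 56) := by
  refine ⟨1 / 10240 * (1 / 10240 * (1 / 512 * Real.exp (-π))), by positivity, ?_⟩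
  filter_upwards [prime_window 57, ev_log_ge (2 ^ 58), Filter.eventually_ge_atTop 16] with X hw hL hX
  have hX0 : 0 < X := by linarith
  set L := Real.log X with hLd
  have hL0 : 0 < L := by linarith [(by norm_num : (0:ℝ) < 2 ^ 58)]
  have hL1 : 1 ≤ L := by linarith [(by norm_num : (1:ℝ) ≤ 2 ^ 58)]
  have hXc : 0 < X ^ c := Real.rpow_pos_of_pos hX0 c
  have hlogy : ∀ y, X / 4 ≤ y → L / 2 ≤ Real.log y := by
    intro y hy
    have h1 : Real.log (X / 4) ≤ Real.log y := Real.log_le_log (by linarith) hy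
    rw [Real.log_div hX0.ne' (by norm_num)] at h1
    have h2 : Real.log 4 ≤ L / 2 := by
      have : Real.log 4 * 2 = Real.log 16 := by
        rw [show (16:ℝ) = 4 ^ 2 by norm_num, Real.log_pow]; push_cast; ring
      have h3 : Real.log 16 ≤ L := Real.log_le_log (by norm_num) hX
      linarith
    linarith
  -- first two primes
  obtain ⟨hz1, he1, hy1, hy1'⟩ := root_range c X (8/25 * X ^ c) hc1 hc2 hX0 (by linarith) (by linarith)
  set y := (8/25 * X ^ c) ^ (1/c) with hy
  have hy0 : 0 < y := by linarith
  have hP := hw y (1/40) hy1 hy1' (by norm_num) (by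
    have h1 : 40 ≤ Real.log y := by
      have := hlogy y hy1
      linarith [(by norm_num : (80:ℝ) ≤ 2 ^ 58)]
    have h2 : Real.log y ≤ (Real.log y) ^ 57 := le_self_pow₀ (by linarith) (by norm_num)
    linarith) (by norm_num)
  set P := (PS X).filter (fun p : ℕ => |Real.log p - Real.log y| < 1/40) with hPd
  have hPc : ∀ p ∈ P, 3/10 * X ^ c ≤ (p:ℝ) ^ c ∧ (p:ℝ) ^ c ≤ 17/50 * X ^ c := by
    intro p hp
    rw [hPd, Finset.mem_filter] at hp
    have hpp := ((mem_PS X hX0.le p).1 hp.1).1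
    have := abs_le.1 (window_pow c y (1/40) p hc1 hc2 hy0 hpp (by norm_num) hp.2)
    rw [he1] at this
    constructor
    · linarith [this.1]
    · linarith [this.2]
  set δ := 1 / (2 * L ^ 56) with hδ
  have hL56 : 1 ≤ L ^ 56 := one_le_pow₀ hL1
  have hδ0 : 0 < δ := by positivity
  have hδ1 : δ ≤ 1/4 := by
    rw [hδ]
    refine one_div_le_one_div_of_le (by norm_num) ?_
    have : L ≤ L ^ 56 := le_self_pow₀ hL1 (by norm_num)
    linarith [(by norm_num : (2:ℝ) ≤ 2 ^ 58)]
  set H := X ^ c / L ^ 56 with hH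
  have hH0 : 0 < H := by positivity
  have hδH : 2 * δ * X ^ c = H := by rw [hδ, hH]; field_simp
  have hinner : ∀ p ∈ P, ∀ q ∈ P, 1 / 512 * Real.exp (-π) * (X / L ^ 56) ≤
      ∑ r ∈ PS X, Real.log r * gw H ((p:ℝ) ^ c + (q:ℝ) ^ c + (r:ℝ) ^ c - X ^ c) := by
    intro p hp q hq
    obtain ⟨p1, p2⟩ := hPc p hp
    obtain ⟨q1, q2⟩ := hPc q hq
    obtain ⟨hz, he, hY1, hY2⟩ := root_range c X (X ^ c - (p:ℝ) ^ c - (q:ℝ) ^ c) hc1 hc2 hX0 (by linarith) (by linarith)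
    set Y := (X ^ c - (p:ℝ) ^ c - (q:ℝ) ^ c) ^ (1/c) with hY
    have hY0 : 0 < Y := by linarith
    have hW := hw Y δ hY1 hY2 hδ0 (by
      have h1 : (L / 2) ^ 57 ≤ (Real.log Y) ^ 57 := pow_le_pow_left₀ (by positivity) (hlogy Y hY1) 57
      have h2 := mul_le_mul_of_nonneg_left h1 hδ0.le
      refine le_trans ?_ h2
      have h3 : δ * (L / 2) ^ 57 = L / 2 ^ 58 := by
        rw [hδ, div_pow, pow_succ L 56]; field_simp
      rw [h3, le_div_iff₀ (by positivity)]
      linarith) hδ1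
    have hXcY : Y ^ c ≤ X ^ c := by rw [he]; linarith
    calc 1 / 512 * Real.exp (-π) * (X / L ^ 56) = δ * X / 256 * Real.exp (-π) := by
          rw [hδ]; field_simp; norm_num
      _ ≤ (∑ r ∈ (PS X).filter (fun r : ℕ => |Real.log r - Real.log Y| < δ), Real.log r) * Real.exp (-π) :=
          mul_le_mul_of_nonneg_right hW (Real.exp_pos _).le
      _ = ∑ r ∈ (PS X).filter (fun r : ℕ => |Real.log r - Real.log Y| < δ), Real.log r * Real.exp (-π) :=
          Finset.sum_mul _ _ _
      _ ≤ ∑ r ∈ (PS X).filter (fun r : ℕ => |Real.log r - Real.log Y| < δ),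
          Real.log r * gw H ((p:ℝ) ^ c + (q:ℝ) ^ c + (r:ℝ) ^ c - X ^ c) := by
          refine Finset.sum_le_sum (fun r hr => ?_)
          rw [Finset.mem_filter] at hr
          have hrp := ((mem_PS X hX0.le r).1 hr.1).1
          refine mul_le_mul_of_nonneg_left (gw_ge H _ hH0 ?_) (log_PS X (by linarith) r hr.1).1
          have := window_pow c Y δ r hc1 hc2 hY0 hrp hδ1 hr.2
          have e2 : (p:ℝ) ^ c + (q:ℝ) ^ c + (r:ℝ) ^ c - X ^ c = (r:ℝ) ^ c - Y ^ c := by rw [he]; ring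
          rw [e2, ← hδH]
          refine this.trans (mul_le_mul_of_nonneg_left hXcY (by positivity))
      _ ≤ _ := Finset.sum_le_sum_of_subset_of_nonneg (Finset.filter_subset _ _)
          (fun r hr _ => mul_nonneg (log_PS X (by linarith) r hr).1 (gw_pos _ _).le)
  have hPsub : P ⊆ PS X := Finset.filter_subset _ _
  have hlog : ∀ p ∈ PS X, 0 ≤ Real.log (p:ℝ) := fun p hp => (log_PS X (by linarith) p hp).1
  set G := 1 / 512 * Real.exp (-π) * (X / L ^ 56) with hG
  have hG0 : 0 ≤ G := by positivity
  set SP := ∑ p ∈ P, Real.log (p:ℝ) with hSP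
  have hSP' : X / 10240 ≤ SP := by linarith
  have hN : Nw c X (X ^ c) H = ∑ p ∈ PS X, Real.log (p:ℝ) * ∑ q ∈ PS X, Real.log (q:ℝ) *
      ∑ r ∈ PS X, Real.log r * gw H ((p:ℝ) ^ c + (q:ℝ) ^ c + (r:ℝ) ^ c - X ^ c) := by
    unfold Nw
    refine Finset.sum_congr rfl (fun p _ => ?_)
    rw [Finset.mul_sum]
    refine Finset.sum_congr rfl (fun q _ => ?_)
    rw [Finset.mul_sum, Finset.mul_sum]
    refine Finset.sum_congr rfl (fun r _ => ?_)
    ring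
  have hr0 : ∀ p q : ℕ, 0 ≤ ∑ r ∈ PS X, Real.log (r:ℝ) * gw H ((p:ℝ) ^ c + (q:ℝ) ^ c + (r:ℝ) ^ c - X ^ c) :=
    fun p q => Finset.sum_nonneg (fun r hr => mul_nonneg (hlog r hr) (gw_pos _ _).le)
  have hq0 : ∀ p ∈ P, SP * G ≤ ∑ q ∈ PS X, Real.log (q:ℝ) *
      ∑ r ∈ PS X, Real.log r * gw H ((p:ℝ) ^ c + (q:ℝ) ^ c + (r:ℝ) ^ c - X ^ c) := by
    intro p hp
    rw [hSP, Finset.sum_mul]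
    refine (Finset.sum_le_sum (fun q hq => mul_le_mul_of_nonneg_left (hinner p hp q hq) (hlog q (hPsub hq)))).trans ?_
    exact Finset.sum_le_sum_of_subset_of_nonneg hPsub (fun q hq _ => mul_nonneg (hlog q hq) (hr0 p q))
  have hfin : SP * (SP * G) ≤ Nw c X (X ^ c) H := by
    rw [hN, hSP, Finset.sum_mul]
    refine (Finset.sum_le_sum (fun p hp => mul_le_mul_of_nonneg_left (hq0 p hp) (hlog p (hPsub hp)))).trans ?_
    exact Finset.sum_le_sum_of_subset_of_nonneg hPsub (fun p hp _ => mul_nonneg (hlog p hp)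
      (Finset.sum_nonneg (fun q hq => mul_nonneg (hlog q hq) (hr0 p q))))
  refine le_trans ?_ hfin
  have h1 : X / 10240 * G ≤ SP * G := mul_le_mul_of_nonneg_right hSP' hG0
  have h2 : X / 10240 * (X / 10240 * G) ≤ SP * (SP * G) :=
    mul_le_mul hSP' h1 (by positivity) (by linarith)
  refine le_trans (le_of_eq ?_) h2
  rw [hG]; field_simp

end BK
end

namespace BK

theorem count_ge (c η R X : ℝ) (hX : X = R ^ (1/c)) (hX0 : 0 ≤ X) :
    ((((PS X) ×ˢ (PS X) ×ˢ (PS X)).filter (fun t : ℕ × ℕ × ℕ =>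
      |(t.1:ℝ) ^ c + (t.2.1:ℝ) ^ c + (t.2.2:ℝ) ^ c - R| < R ^ (-η))).card : ℝ) ≤ (countSol c η R 3 : ℝ) := by
  set F := ((PS X) ×ˢ (PS X) ×ˢ (PS X)).filter (fun t : ℕ × ℕ × ℕ =>
      |(t.1:ℝ) ^ c + (t.2.1:ℝ) ^ c + (t.2.2:ℝ) ^ c - R| < R ^ (-η)) with hF
  set P : (Fin 3 → ℕ) → Prop := fun p => (∀ j, (p j).Prime ∧ R ^ (1 / c) / 8 < (p j : ℝ) ∧ (p j : ℝ) ≤ R ^ (1 / c)) ∧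
        |(∑ j, (p j : ℝ) ^ c) - R| < R ^ (-η) with hP
  have hfin : Finite {p : Fin 3 → ℕ // P p} := by
    refine Set.Finite.subset (Finset.finite_toSet (Fintype.piFinset (fun _ : Fin 3 => PS X))) ?_
    intro p hp
    simp only [Finset.mem_coe, Fintype.mem_piFinset]
    intro j
    have := hp.1 j
    rw [← hX] at this
    exact (mem_PS X hX0 _).2 this
  have hc : countSol c η R 3 = Nat.card {p : Fin 3 → ℕ // P p} := rfl
  rw [hc]
  have hmap : ∀ t ∈ F, P ![t.1, t.2.1, t.2.2] := by
    intro t ht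
    rw [hF, Finset.mem_filter, Finset.mem_product, Finset.mem_product] at ht
    obtain ⟨⟨h1, h2, h3⟩, h4⟩ := ht
    have g1 := (mem_PS X hX0 _).1 h1
    have g2 := (mem_PS X hX0 _).1 h2
    have g3 := (mem_PS X hX0 _).1 h3
    rw [hX] at g1 g2 g3
    refine ⟨?_, ?_⟩
    · intro j
      fin_cases j
      · exact g1
      · exact g2
      · exact g3
    · rw [Fin.sum_univ_three]
      exact h4
  have hle : Nat.card F ≤ Nat.card {p : Fin 3 → ℕ // P p} := by
    refine Nat.card_le_card_of_injective (fun t : F => (⟨![t.1.1, t.1.2.1, t.1.2.2], hmap t.1 t.2⟩ : {p : Fin 3 → ℕ // P p})) ?_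
    intro s t hst
    have h := congrArg Subtype.val hst
    have h0 := congrFun h 0
    have h1 := congrFun h 1
    have h2 := congrFun h 2
    simp only [Matrix.cons_val_zero, Matrix.cons_val_one, Matrix.cons_val] at h0 h1 h2
    exact Subtype.ext (Prod.ext h0 (Prod.ext h1 h2))
  rw [Nat.card_eq_fintype_card, Fintype.card_coe] at hle
  exact_mod_cast hle

theorem Nw_upper (c X R D : ℝ) (hX : 1 ≤ X) (hD : 0 < D) :
    3 * Nw c X R D - Nw c X R (2 * D) ≤ 3 * (Real.log X) ^ 3 *
      ((((PS X) ×ˢ (PS X) ×ˢ (PS X)).filter (fun t : ℕ × ℕ × ℕ =>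
      |(t.1:ℝ) ^ c + (t.2.1:ℝ) ^ c + (t.2.2:ℝ) ^ c - R| < D)).card : ℝ) := by
  rw [Finset.card_filter]
  push_cast
  rw [Finset.sum_product]
  unfold Nw
  simp_rw [Finset.sum_product]
  rw [Finset.mul_sum, Finset.mul_sum, ← Finset.sum_sub_distrib]
  refine Finset.sum_le_sum (fun p hp => ?_)
  rw [Finset.mul_sum, Finset.mul_sum, ← Finset.sum_sub_distrib]
  refine Finset.sum_le_sum (fun q hq => ?_)
  rw [Finset.mul_sum, Finset.mul_sum, ← Finset.sum_sub_distrib]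
  refine Finset.sum_le_sum (fun r hr => ?_)
  obtain ⟨p0, p1⟩ := log_PS X (by linarith) p hp
  obtain ⟨q0, q1⟩ := log_PS X (by linarith) q hq
  obtain ⟨r0, r1⟩ := log_PS X (by linarith) r hr
  have hw := w_le D ((p:ℝ) ^ c + (q:ℝ) ^ c + (r:ℝ) ^ c - R) hD
  have hl0 : 0 ≤ Real.log p * Real.log q * Real.log r := by positivity
  have hl1 : Real.log p * Real.log q * Real.log r ≤ (Real.log X) ^ 3 := by
    have hL : 0 ≤ Real.log X := p0.trans p1
    calc Real.log p * Real.log q * Real.log r ≤ Real.log X * Real.log X * Real.log X :=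
          mul_le_mul (mul_le_mul p1 q1 q0 hL) r1 r0 (by positivity)
      _ = _ := by ring
  have h1 := mul_le_mul_of_nonneg_left hw hl0
  by_cases hd : |(p:ℝ) ^ c + (q:ℝ) ^ c + (r:ℝ) ^ c - R| < D
  · rw [if_pos hd] at h1
    rw [if_pos hd]
    linarith
  · rw [if_neg hd] at h1
    rw [if_neg hd]
    linarith

theorem fine_lower (c : ℝ) (hc1 : 1 < c) (hc2 : c < 6/5) (ν : ℝ) (hν : 0 < ν) (h1 : c + 2 * ν ≤ 5/4)
    (h2 : 5/2 * c + 5 * ν < 3) : ∃ c₁ > 0, ∀ᶠ X : ℝ in Filter.atTop,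
    c₁ * (X ^ (-ν) * X ^ (3 - c)) ≤ 3 * Nw c X (X ^ c) (X ^ (-ν)) - Nw c X (X ^ c) (2 * X ^ (-ν)) := by
  obtain ⟨c₁, hc₁, hco⟩ := coarse c hc1 hc2
  refine ⟨c₁ / 2, by positivity, ?_⟩
  filter_upwards [hco, kernel_cmp c hc1 ν hν h1 h2 (c₁ / 10) (by positivity), ev_log_ge 1,
    Filter.eventually_gt_atTop 1] with X hX hk hL hX1
  have hX0 : 0 < X := by linarith
  have hD0 : 0 < X ^ (-ν) := Real.rpow_pos_of_pos hX0 _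
  have k1 := abs_le.1 (hk (X ^ c) (X ^ (-ν)) le_rfl (by linarith))
  have k2 := abs_le.1 (hk (X ^ c) (2 * X ^ (-ν)) (by linarith) le_rfl)
  set H := X ^ c / (Real.log X) ^ 56 with hH
  have hXc : 0 < X ^ c := Real.rpow_pos_of_pos hX0 c
  have hL0 : 0 < (Real.log X) ^ 56 := by positivity
  have hH0 : 0 < H := by positivity
  set D := X ^ (-ν) with hD
  have hX3 : X ^ 3 = X ^ c * X ^ (3 - c) := by
    rw [← Real.rpow_add hX0, ← Real.rpow_natCast]; congr 1; push_cast; ring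
  have hm := mul_le_mul_of_nonneg_left hX (by positivity : 0 ≤ D / H)
  have e1 : D / H * (c₁ * X ^ 3 / (Real.log X) ^ 56) = c₁ * (D * X ^ (3 - c)) := by
    rw [hX3, hH]; field_simp
  rw [e1] at hm
  have e2 : 2 * D / H * Nw c X (X ^ c) H = 2 * (D / H * Nw c X (X ^ c) H) := by ring
  rw [e2] at k2
  have e3 : c₁ / 10 * (2 * D) * X ^ (3 - c) = c₁ / 5 * (D * X ^ (3 - c)) := by ring
  have e4 : c₁ / 10 * D * X ^ (3 - c) = c₁ / 10 * (D * X ^ (3 - c)) := by ring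
  rw [e3] at k2
  rw [e4] at k1
  linarith [k1.1, k2.2]

end BK

theorem baker_thm2 (c : ℝ) (hc1 : 1 < c) (hc2 : c < 6/5) :
    ∃ η₀ > 0, ∀ η : ℝ, 0 < η → η ≤ η₀ →
    ∃ c₀ > 0, ∃ R₀ : ℝ, ∀ R : ℝ, R₀ ≤ R →
      c₀ * R ^ (3/c - 1 - η) / (Real.log R) ^ 3 ≤ (countSol c η R 3 : ℝ) := by
  have hc0 : 0 < c := by linarith
  refine ⟨min ((5/4 - c) / (2 * c)) ((3 - 5/2 * c) / (10 * c)),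
    lt_min (div_pos (by linarith) (by linarith)) (div_pos (by linarith) (by linarith)), fun η hη hη0 => ?_⟩
  have g1 : η ≤ (5/4 - c) / (2 * c) := hη0.trans (min_le_left _ _)
  have g2 : η ≤ (3 - 5/2 * c) / (10 * c) := hη0.trans (min_le_right _ _)
  rw [le_div_iff₀ (by linarith)] at g1 g2
  have hν : 0 < c * η := mul_pos hc0 hη
  obtain ⟨c₁, hc₁, hev⟩ := BK.fine_lower c hc1 hc2 (c * η) hν (by linarith) (by linarith)
  have hev2 := (tendsto_rpow_atTop (y := 1/c) (by positivity)).eventually hev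
  obtain ⟨R₁, hR₁⟩ := Filter.eventually_atTop.1 hev2
  refine ⟨c₁ / 3, by positivity, max R₁ 2, fun R hR => ?_⟩
  have hRa : R₁ ≤ R := (le_max_left _ _).trans hR
  have hR2 : 2 ≤ R := (le_max_right _ _).trans hR
  have hR0 : 0 < R := by linarith
  have hmain := hR₁ R hRa
  have hcnt := BK.count_ge c η R (R ^ (1/c)) rfl (by positivity)
  set X := R ^ (1/c) with hX
  have hX1 : 1 ≤ X := Real.one_le_rpow (by linarith) (by positivity)
  have hXc : X ^ c = R := by
    rw [hX, ← Real.rpow_mul hR0.le, one_div_mul_cancel hc0.ne', Real.rpow_one]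
  have hXν : X ^ (-(c * η)) = R ^ (-η) := by
    rw [hX, ← Real.rpow_mul hR0.le]; congr 1; field_simp
  have hX3 : X ^ (-(c * η)) * X ^ (3 - c) = R ^ (3/c - 1 - η) := by
    rw [hX, ← Real.rpow_mul hR0.le, ← Real.rpow_mul hR0.le, ← Real.rpow_add hR0]
    congr 1; field_simp; ring
  rw [hX3, hXν, hXc] at hmain
  have hup := BK.Nw_upper c X R (R ^ (-η)) hX1 (Real.rpow_pos_of_pos hR0 _)
  have hlogR : 0 < Real.log R := Real.log_pos (by linarith)
  have hlogX : Real.log X ≤ Real.log R := by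
    refine Real.log_le_log (by linarith) ?_
    rw [hX]
    nth_rewrite 2 [← Real.rpow_one R]
    exact Real.rpow_le_rpow_of_exponent_le (by linarith) (by rw [div_le_one hc0]; exact hc1.le)
  have hL : (Real.log X) ^ 3 ≤ (Real.log R) ^ 3 := pow_le_pow_left₀ (Real.log_nonneg hX1) hlogX 3
  have hf : 3 * (Real.log X) ^ 3 * ((((BK.PS X) ×ˢ (BK.PS X) ×ˢ (BK.PS X)).filter (fun t : ℕ × ℕ × ℕ =>
      |(t.1:ℝ) ^ c + (t.2.1:ℝ) ^ c + (t.2.2:ℝ) ^ c - R| < R ^ (-η))).card : ℝ)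
      ≤ 3 * (Real.log R) ^ 3 * (countSol c η R 3 : ℝ) :=
    mul_le_mul (by linarith) hcnt (Nat.cast_nonneg _) (by positivity)
  rw [div_le_iff₀ (by positivity)]
  linarith
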